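/- Let N ≥ 2 be an integer and y₁ < y₂ < ⋯ < y_{2N} be real numbers. For y_{2N−1} < t < s < y_{2N}, let h(·, t, s) denote the unique holomorphic function on ℍ satisfying the mixed boundary conditions: Re h has continuous boundary value 0 on (−∞,y₁) ∪ (y_{2N},+∞) and one common constant boundary value on all intervals (y_{2i}, y_{2i+1}), 1 ≤ i ≤ N−1; Im h has constant continuous boundary value on each (y_{2i−1}, y_{2i}), 1 ≤ i ≤ N−1, boundary value 0 on (y₁,y₂) ∪ (y_{2N−1},t) ∪ (s,y_{2N}) and 1 on (t,s); and Im h is bounded on ℍ and extends continuously to cl(ℍ) ∖ {t,s}. Similarly, for y₁ < t < s < y₂ let h̃(·, t, s) denote the unique holomorphic function on ℍ with the same Re-conditions, with Im h̃ having constant boundary value on each (y_{2i−1}, y_{2i}) for 2 ≤ i ≤ N, boundary value 0 on (y_{2N−1},y_{2N}) ∪ (y₁,t) ∪ (s,y₂) and 1 on (t,s), and Im h̃ bounded on ℍ and continuous on cl(ℍ) ∖ {t,s}. Then: (a) for every z ∈ ℍ and every x ∈ (y_{2N−1}, y_{2N}), the limit of Im h(z, t, s)/(s − t) as (t,s) →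 (x,x) with y_{2N−1} < t < s < y_{2N} exists in ℝ; (b) for every z ∈ ℍ and every w ∈ (y₁, y₂), the limit of Im h̃(z, t, s)/(s − t) as (t,s) → (w,w) with y₁ < t < s < y₂ exists in ℝ. -/

import Mathlib

open Set Metric Filter Complex Topology

noncomputable section

/-- The open upper half-plane in `ℂ`. -/
def UHP : Set ℂ := {z | 0 < z.im}

/-- The mixed boundary-value problem for the holomorphic observable `h(·, t, s; y₁,…,y_{2N})`,
with the Dirichlet-1 window `(t,s)` contained in `(y_{2N-1}, y_{2N})`.
Boundary values are understood as limits within the upper half-plane. -/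
def SolvesBVP (N : ℕ) (y : ℕ → ℝ) (t s : ℝ) (h : ℂ → ℂ) : Prop :=
  -- holomorphic on ℍ
  DifferentiableOn ℂ h UHP ∧
  -- (1) Re h = 0 on (-∞, y₁) ∪ (y_{2N}, +∞)
  (∀ p : ℝ, (p < y 1 ∨ y (2 * N) < p) →
    Tendsto (fun z => (h z).re) (𝓝[UHP] (p : ℂ)) (𝓝 0)) ∧
  -- (2) Re h equals one common constant on all (y_{2i}, y_{2i+1}), 1 ≤ i ≤ N-1
  (∃ c : ℝ, ∀ i : ℕ, 1 ≤ i → i ≤ N - 1 → ∀ p ∈ Set.Ioo (y (2 * i)) (y (2 * i + 1)),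
    Tendsto (fun z => (h z).re) (𝓝[UHP] (p : ℂ)) (𝓝 c)) ∧
  -- (3) Im h is constant on each (y_{2i-1}, y_{2i}), 1 ≤ i ≤ N-1
  (∀ i : ℕ, 1 ≤ i → i ≤ N - 1 → ∃ c : ℝ, ∀ p ∈ Set.Ioo (y (2 * i - 1)) (y (2 * i)),
    Tendsto (fun z => (h z).im) (𝓝[UHP] (p : ℂ)) (𝓝 c)) ∧
  -- (4) Im h = 0 on (y₁,y₂) ∪ (y_{2N-1},t) ∪ (s,y_{2N}) and Im h = 1 on (t,s)
  (∀ p ∈ Set.Ioo (y 1) (y 2) ∪ Set.Ioo (y (2 * N - 1)) t ∪ Set.Ioo s (y (2 * N)),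
    Tendsto (fun z => (h z).im) (𝓝[UHP] (p : ℂ)) (𝓝 0)) ∧
  (∀ p ∈ Set.Ioo t s, Tendsto (fun z => (h z).im) (𝓝[UHP] (p : ℂ)) (𝓝 1)) ∧
  -- (5) Im h is bounded on ℍ and continuous up to cl(ℍ) \ {t, s}
  (∃ C : ℝ, ∀ z ∈ UHP, |(h z).im| ≤ C) ∧
  (∃ g : ℂ → ℝ, ContinuousOn g (closure UHP \ {(t : ℂ), (s : ℂ)}) ∧
    ∀ z ∈ UHP, g z = (h z).im)

/-- The mixed boundary-value problem for the holomorphic observable `h̃(·, t, s; y₁,…,y_{2N})`,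
with the Dirichlet-1 window `(t,s)` contained in `(y₁, y₂)`. -/
def SolvesBVP' (N : ℕ) (y : ℕ → ℝ) (t s : ℝ) (h : ℂ → ℂ) : Prop :=
  -- holomorphic on ℍ
  DifferentiableOn ℂ h UHP ∧
  -- (1) Re h̃ = 0 on (-∞, y₁) ∪ (y_{2N}, +∞)
  (∀ p : ℝ, (p < y 1 ∨ y (2 * N) < p) →
    Tendsto (fun z => (h z).re) (𝓝[UHP] (p : ℂ)) (𝓝 0)) ∧
  -- (2) Re h̃ equals one common constant on all (y_{2i}, y_{2i+1}), 1 ≤ i ≤ N-1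
  (∃ c : ℝ, ∀ i : ℕ, 1 ≤ i → i ≤ N - 1 → ∀ p ∈ Set.Ioo (y (2 * i)) (y (2 * i + 1)),
    Tendsto (fun z => (h z).re) (𝓝[UHP] (p : ℂ)) (𝓝 c)) ∧
  -- (3) Im h̃ is constant on each (y_{2i-1}, y_{2i}), 2 ≤ i ≤ N
  (∀ i : ℕ, 2 ≤ i → i ≤ N → ∃ c : ℝ, ∀ p ∈ Set.Ioo (y (2 * i - 1)) (y (2 * i)),
    Tendsto (fun z => (h z).im) (𝓝[UHP] (p : ℂ)) (𝓝 c)) ∧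
  -- (4) Im h̃ = 0 on (y_{2N-1},y_{2N}) ∪ (y₁,t) ∪ (s,y₂) and Im h̃ = 1 on (t,s)
  (∀ p ∈ Set.Ioo (y (2 * N - 1)) (y (2 * N)) ∪ Set.Ioo (y 1) t ∪ Set.Ioo s (y 2),
    Tendsto (fun z => (h z).im) (𝓝[UHP] (p : ℂ)) (𝓝 0)) ∧
  (∀ p ∈ Set.Ioo t s, Tendsto (fun z => (h z).im) (𝓝[UHP] (p : ℂ)) (𝓝 1)) ∧
  -- (5) Im h̃ is bounded on ℍ and continuous up to cl(ℍ) \ {t, s}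
  (∃ C : ℝ, ∀ z ∈ UHP, |(h z).im| ≤ C) ∧
  (∃ g : ℂ → ℝ, ContinuousOn g (closure UHP \ {(t : ℂ), (s : ℂ)}) ∧
    ∀ z ∈ UHP, g z = (h z).im)



namespace PK
section
open scoped Interval

lemma isOpen_UHP : IsOpen UHP := isOpen_lt continuous_const Complex.continuous_im

lemma rect_zero {f : ℂ → ℂ} {a b c d : ℝ}
    (hc : ContinuousOn f ([[a, b]] ×ℂ [[c, d]]))
    (hd : ∀ z ∈ ([[a, b]] ×ℂ [[c, d]]), z.im ≠ 0 → DifferentiableAt ℂ f z)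
    (h0 : (0:ℝ) ∉ Ioo (min c d) (max c d)) :
    (∫ x : ℝ in a..b, f (x + c * I)) - (∫ x : ℝ in a..b, f (x + d * I)) +
      I • (∫ y : ℝ in c..d, f (b + y * I)) - I • (∫ y : ℝ in c..d, f (a + y * I)) = 0 := by
  have := integral_boundary_rect_eq_zero_of_continuousOn_of_differentiableOn f ⟨a, c⟩ ⟨b, d⟩
    (by simpa using hc) (by
      intro z hz
      refine (hd z ?_ ?_).differentiableWithinAt
      · simp only [mem_reProdIm] at hz ⊢
        exact ⟨Ioo_subset_Icc_self hz.1, Ioo_subset_Icc_self hz.2⟩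
      · intro h; apply h0; rw [← h]; exact hz.2)
  simpa using this

lemma painleve {f : ℂ → ℂ} {U : Set ℂ} (hU : IsOpen U) (hc : ContinuousOn f U)
    (hd : ∀ z ∈ U, z.im ≠ 0 → DifferentiableAt ℂ f z) : DifferentiableOn ℂ f U := by
  rw [← isConservativeOn_and_continuousOn_iff_isDifferentiableOn hU]
  refine ⟨?_, hc⟩
  rintro ⟨a, c⟩ ⟨b, d⟩ hzw
  rw [← add_eq_zero_iff_eq_neg, wedgeIntegral_add_wedgeIntegral_eq]
  have hsub : [[a, b]] ×ℂ [[c, d]] ⊆ U := hzw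
  simp only
  by_cases h0 : (0:ℝ) ∈ Ioo (min c d) (max c d)
  · have hm : (0:ℝ) ∈ [[c, d]] := Ioo_subset_Icc_self h0
    have s1 : [[a, b]] ×ℂ [[c, 0]] ⊆ U := fun z hz =>
      hsub ⟨hz.1, uIcc_subset_uIcc_left hm hz.2⟩
    have s2 : [[a, b]] ×ℂ [[0, d]] ⊆ U := fun z hz =>
      hsub ⟨hz.1, uIcc_subset_uIcc_right hm hz.2⟩
    have e1 := rect_zero (hc.mono s1) (fun z hz => hd z (s1 hz)) (by
      simp only [mem_Ioo, min_lt_iff, lt_max_iff]; simp; intro h; exact h.le)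
    have e2 := rect_zero (hc.mono s2) (fun z hz => hd z (s2 hz)) (by
      simp only [mem_Ioo, min_lt_iff, lt_max_iff]; simp; intro h; exact h.le)
    have ii : ∀ x ∈ [[a, b]], ∀ p q : ℝ, [[p, q]] ⊆ [[c, d]] →
        IntervalIntegrable (fun y : ℝ => f (x + y * I)) MeasureTheory.volume p q := by
      intro x hx p q hpq
      apply ContinuousOn.intervalIntegrable
      refine hc.comp (by fun_prop) ?_
      intro y hy
      apply hsub
      simp only [mem_reProdIm]
      simpa using ⟨hx, hpq hy⟩
    have k1 := uIcc_subset_uIcc_left hm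
    have k2 := uIcc_subset_uIcc_right hm
    rw [← intervalIntegral.integral_add_adjacent_intervals (ii b right_mem_uIcc c 0 k1)
      (ii b right_mem_uIcc 0 d k2), ← intervalIntegral.integral_add_adjacent_intervals
      (ii a left_mem_uIcc c 0 k1) (ii a left_mem_uIcc 0 d k2)]
    rw [smul_add, smul_add]
    linear_combination e1 + e2
  · exact rect_zero (hc.mono hsub) (fun z hz => hd z (hsub hz)) h0

/-- reflected function -/
def refl (A : ℂ → ℂ) (z : ℂ) : ℂ :=
  if 0 ≤ z.im then extendFrom UHP A z else (starRingEnd ℂ) (extendFrom UHP A ((starRingEnd ℂ) z))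

lemma closure_UHP_eq : closure UHP = {z : ℂ | 0 ≤ z.im} := by

  simp [UHP]

lemma neBot_real (p : ℂ) (hp : 0 ≤ p.im) : (𝓝[UHP] p).NeBot := by
  rw [← mem_closure_iff_nhdsWithin_neBot, closure_UHP_eq]; exact hp

lemma extend_upper {A : ℂ → ℂ} {z : ℂ} (hA : DifferentiableAt ℂ A z) (hz : 0 < z.im) :
    extendFrom UHP A z = A z := by
  apply extendFrom_eq (subset_closure (show z ∈ UHP from hz))
  exact hA.continuousAt.continuousWithinAt

lemma refl_upper {A : ℂ → ℂ} {z : ℂ} (hA : DifferentiableAt ℂ A z) (hz : 0 < z.im) :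
    refl A z = A z := by
  rw [refl, if_pos hz.le, extend_upper hA hz]

lemma refl_lower {A : ℂ → ℂ} {z : ℂ} (hA : DifferentiableAt ℂ A ((starRingEnd ℂ) z))
    (hz : z.im < 0) :
    refl A z = (starRingEnd ℂ) (A ((starRingEnd ℂ) z)) := by
  rw [refl, if_neg (not_le.2 hz), extend_upper hA (by simpa using hz)]

lemma refl_real {A : ℂ → ℂ} {p : ℝ} {a : ℂ}
    (h : Tendsto A (𝓝[UHP] (p:ℂ)) (𝓝 a)) : refl A p = a := by
  rw [refl, if_pos (by simp)]
  exact extendFrom_eq (by rw [closure_UHP_eq]; simp) h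

lemma refl_conj {A : ℂ → ℂ} (hA : DifferentiableOn ℂ A UHP) {z : ℂ} (hz : z.im ≠ 0) :
    refl A ((starRingEnd ℂ) z) = (starRingEnd ℂ) (refl A z) := by
  have hA' : ∀ w : ℂ, 0 < w.im → DifferentiableAt ℂ A w := fun w hw =>
    hA.differentiableAt (isOpen_UHP.mem_nhds hw)
  rcases lt_or_gt_of_ne hz with h | h
  · have h' : 0 < ((starRingEnd ℂ) z).im := by simpa using h
    rw [refl_lower (hA' _ h') h, refl_upper (hA' _ h') h']; simp
  · rw [refl_upper (hA' _ h) h, refl_lower (by simpa using hA' _ h) (by simpa using h)]; simp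

/-- Schwarz reflection with continuous boundary values. -/
lemma refl_diff {A : ℂ → ℂ} {U : Set ℂ} (hU : IsOpen U)
    (hA : ∀ z ∈ U, 0 < z.im → DifferentiableAt ℂ A z)
    (hUs : ∀ z ∈ U, (starRingEnd ℂ) z ∈ U)
    (hUJ : ∀ p : ℝ, (p:ℂ) ∈ U → ∃ a : ℝ, Tendsto A (𝓝[UHP] (p:ℂ)) (𝓝 (a:ℂ))) :
    DifferentiableOn ℂ (refl A) U := by
  have hup : ∀ z ∈ U, 0 < z.im → DifferentiableAt ℂ (refl A) z := by
    intro z hzU hz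
    have : refl A =ᶠ[𝓝 z] A := by
      filter_upwards [isOpen_UHP.mem_nhds hz, hU.mem_nhds hzU] with w hw hwU
        using refl_upper (hA w hwU hw) hw
    exact (hA z hzU hz).congr_of_eventuallyEq this
  have hlo : ∀ z ∈ U, z.im < 0 → DifferentiableAt ℂ (refl A) z := by
    intro z hzU hz
    have hz' : 0 < ((starRingEnd ℂ) z).im := by simpa using hz
    have : refl A =ᶠ[𝓝 z] (starRingEnd ℂ) ∘ A ∘ (starRingEnd ℂ) := by
      have : {w : ℂ | w.im < 0} ∈ 𝓝 z := (isOpen_lt Complex.continuous_im continuous_const).mem_nhds hz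
      filter_upwards [this, hU.mem_nhds hzU] with w hw hwU using
        refl_lower (hA _ (hUs w hwU) (by simpa using hw)) hw
    refine DifferentiableAt.congr_of_eventuallyEq ?_ this
    have h1 := (hA _ (hUs z hzU) hz').hasDerivAt
    have h2 := h1.conj_conj
    simp only [Complex.conj_conj] at h2
    exact h2.differentiableAt
  refine painleve hU ?_ ?_
  · -- continuity
    set B : Set ℂ := {z | 0 ≤ z.im ∧ z ∈ U} with hB
    have hBc : ContinuousOn (extendFrom UHP A) B := by
      apply continuousOn_extendFrom
      · rw [closure_UHP_eq]; exact fun z hz => hz.1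
      · intro z hz
        rcases hz.1.eq_or_lt with h | h
        · have hzz : z = (z.re : ℂ) := by apply Complex.ext <;> simp [← h]
          obtain ⟨a, ha⟩ := hUJ z.re (hzz ▸ hz.2)
          refine ⟨a, ?_⟩
          rw [hzz]
          exact ha
        · exact ⟨A z, (hA z hz.2 h).continuousAt.continuousWithinAt⟩
    intro z hz
    apply ContinuousAt.continuousWithinAt
    rcases lt_trichotomy z.im 0 with h | h | h
    · exact (hlo z hz h).continuousAt
    · have hzz : z = (z.re : ℂ) := by apply Complex.ext <;> simp [h]
      have hzB : z ∈ B := ⟨h.ge, hz⟩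
      obtain ⟨a, ha⟩ := hUJ z.re (hzz ▸ hz)
      have hrz : refl A z = a := by rw [hzz]; exact refl_real ha
      have hez : extendFrom UHP A z = a := by
        rw [refl, if_pos h.ge] at hrz; exact hrz
      have hcz : (starRingEnd ℂ) z = z := by rw [hzz]; simp
      have hBU : ∀ᶠ w in 𝓝 z, w ∈ U := hU.mem_nhds hz
      have t1 : Tendsto (extendFrom UHP A) (𝓝[B] z) (𝓝 (a:ℂ)) := by
        have := hBc z hzB; rw [ContinuousWithinAt, hez] at this; exact this
      rw [ContinuousAt, hrz]
      have hsplit : (𝓝 z) = 𝓝[{w | 0 ≤ w.im}] z ⊔ 𝓝[{w | 0 ≤ w.im}ᶜ] z := by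
        rw [← nhdsWithin_union, union_compl_self, nhdsWithin_univ]
      rw [hsplit]
      refine Tendsto.sup ?_ ?_
      · have : Tendsto (extendFrom UHP A) (𝓝[{w | 0 ≤ w.im}] z) (𝓝 (a:ℂ)) := by
          refine t1.mono_left ?_
          rw [nhdsWithin_le_iff]
          filter_upwards [self_mem_nhdsWithin, nhdsWithin_le_nhds hBU] with w hw hwU
          exact ⟨hw, hwU⟩
        refine this.congr' ?_
        filter_upwards [self_mem_nhdsWithin] with w hw
        rw [refl, if_pos hw]
      · have t2 : Tendsto (starRingEnd ℂ) (𝓝[{w : ℂ | 0 ≤ w.im}ᶜ] z) (𝓝[B] z) := by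
          apply tendsto_nhdsWithin_of_tendsto_nhds_of_eventually_within
          · have : Tendsto (starRingEnd ℂ) (𝓝 z) (𝓝 z) := by
              have := (Complex.continuous_conj).tendsto z
              rwa [hcz] at this
            exact this.mono_left nhdsWithin_le_nhds
          · filter_upwards [self_mem_nhdsWithin, nhdsWithin_le_nhds hBU] with w hw hwU
            simp only [mem_compl_iff, mem_ofPred_eq, not_le] at hw
            exact ⟨by simp; exact hw.le, hUs w hwU⟩
        have t3 := (Complex.continuous_conj.tendsto (a:ℂ)).comp (t1.comp t2)
        rw [Complex.conj_ofReal] at t3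
        refine t3.congr' ?_
        filter_upwards [self_mem_nhdsWithin] with w hw
        have hw2 : ¬ (0 ≤ w.im) := hw
        rw [refl, if_neg hw2]; rfl
    · exact (hup z hz h).continuousAt
  · intro z hz h
    rcases lt_or_gt_of_ne h with h | h
    · exact hlo z hz h
    · exact hup z hz h

end
end PK

namespace PK
section
open scoped Interval

lemma deriv_bound_re {f : ℂ → ℂ} {z : ℂ} {R C : ℝ} (hR : 0 < R) (hC : 0 < C)
    (hf : DifferentiableOn ℂ f (ball z R)) (hb : ∀ w ∈ ball z R, |(f w).re| ≤ C) :
    ‖deriv f z‖ ≤ 8 * C / R := by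
  have key : ∀ w ∈ sphere z (R/2), ‖f w - f z‖ ≤ 4 * C := by
    intro w hw
    have hmap : ∀ u ∈ ball (0:ℂ) R, z + u ∈ ball z R := by
      intro u hu; simpa using hu
    have := borelCaratheodory_zero (f := fun u => f (z + u) - f z) (M := 2 * C) (R := R)
      (z := w - z) (by positivity) (by
        refine DifferentiableOn.sub_const (hf.comp (by fun_prop) hmap) _) (by
        intro u hu
        have h1 := abs_le.1 (hb _ (hmap u hu))
        have h2 := abs_le.1 (hb z (mem_ball_self hR))
        simp only [mem_ofPred_eq, sub_re]
        linarith) hR (by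
          rw [mem_sphere, dist_eq_norm] at hw
          rw [mem_ball_zero_iff, hw]; linarith) (by simp)
    rw [mem_sphere, dist_eq_norm] at hw
    simp only [hw, add_sub_cancel] at this
    refine this.trans (le_of_eq ?_)
    field_simp; ring
  have h2 : ‖deriv (fun w => f w - f z) z‖ ≤ 4 * C / (R/2) := by
    apply norm_deriv_le_of_forall_mem_sphere_norm_le (by positivity) _ key
    apply DifferentiableOn.diffContOnCl
    rw [closure_ball _ (by positivity)]
    exact DifferentiableOn.sub_const (hf.mono (closedBall_subset_ball (by linarith))) _
  rw [deriv_sub_const] at h2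
  refine h2.trans (le_of_eq ?_)
  field_simp; ring

lemma deriv_bound_im {f : ℂ → ℂ} {z : ℂ} {R C : ℝ} (hR : 0 < R) (hC : 0 < C)
    (hf : DifferentiableOn ℂ f (ball z R)) (hb : ∀ w ∈ ball z R, |(f w).im| ≤ C) :
    ‖deriv f z‖ ≤ 8 * C / R := by
  have := deriv_bound_re (f := fun w => I * f w) hR hC (hf.const_mul I) (by
    intro w hw; simpa using hb w hw)
  rw [deriv_const_mul_field] at this
  simpa using this

lemma hasDeriv_vert {f : ℂ → ℂ} (hf : DifferentiableOn ℂ f UHP) (z : ℂ) (u : ℝ)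
    (h : 0 < z.im + u) :
    HasDerivAt (fun u : ℝ => f (z + u * I)) (I * deriv f (z + u * I)) u := by
  have h1 : HasDerivAt f (deriv f (z + u * I)) (z + u * I) :=
    (hf.differentiableAt (isOpen_UHP.mem_nhds (by simpa [UHP] using h))).hasDerivAt
  have h2 : HasDerivAt (fun u : ℝ => z + u * I) I u := by
    simpa using ((Complex.ofRealCLM.hasDerivAt (x := u)).mul_const I).const_add z
  have := h1.scomp u h2
  rw [smul_eq_mul] at this
  exact this

lemma cont_deriv {f : ℂ → ℂ} (hf : DifferentiableOn ℂ f UHP) : ContinuousOn (deriv f) UHP :=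
  (hf.deriv isOpen_UHP).continuousOn

lemma vert_int {f : ℂ → ℂ} (hf : DifferentiableOn ℂ f UHP) (z : ℂ) (a b : ℝ) (hab : a ≤ b)
    (h : 0 < z.im + a) :
    ∫ u in a..b, I * deriv f (z + u * I) = f (z + b * I) - f (z + a * I) := by
  apply intervalIntegral.integral_eq_sub_of_hasDerivAt (f := fun u : ℝ => f (z + u * I))
  · intro u hu
    rw [uIcc_of_le hab] at hu
    exact hasDeriv_vert hf z u (by linarith [hu.1])
  · apply ContinuousOn.intervalIntegrable
    refine ContinuousOn.mul continuousOn_const ((cont_deriv hf).comp (by fun_prop) ?_)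
    intro u hu
    rw [uIcc_of_le hab] at hu
    have := hu.1
    simp [UHP]; linarith

lemma log_bound {f : ℂ → ℂ} (hf : DifferentiableOn ℂ f UHP) {z : ℂ} {h C τ : ℝ}
    (hz : 0 ≤ z.im) (hτ : 0 < τ) (hτh : τ ≤ h) (hC0 : 0 ≤ C)
    (hC : ∀ u ∈ Icc τ h, ‖deriv f (z + u * I)‖ ≤ C / (z + u * I).im) :
    ‖f (z + τ * I)‖ ≤ ‖f (z + h * I)‖ + C * (Real.log h - Real.log τ) := by
  have e := vert_int hf z τ h hτh (by linarith)
  have hb : ‖∫ u in τ..h, I * deriv f (z + u * I)‖ ≤ ∫ u in τ..h, C * (1 / u) := by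
    apply intervalIntegral.norm_integral_le_of_norm_le hτh
    · refine Eventually.of_forall fun u hu => ?_
      have hu' : u ∈ Icc τ h := Ioc_subset_Icc_self hu
      have hu0 : 0 < u := hτ.trans_le hu'.1
      refine (by simpa using hC u hu' : ‖I * deriv f (z + u * I)‖ ≤ C / (z.im + u)).trans ?_
      rw [mul_one_div]
      gcongr
      linarith
    · apply ContinuousOn.intervalIntegrable
      intro u hu
      rw [uIcc_of_le hτh] at hu
      have hu0 : u ≠ 0 := (hτ.trans_le hu.1).ne'
      exact ContinuousAt.continuousWithinAt (by fun_prop (disch := assumption))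
  rw [e, intervalIntegral.integral_const_mul, integral_one_div_of_pos hτ (hτ.trans_le hτh),
    Real.log_div (hτ.trans_le hτh).ne' hτ.ne'] at hb
  have := norm_sub_norm_le (f (z + τ * I)) (f (z + h * I))
  rw [norm_sub_rev] at this
  linarith


lemma hasDeriv_avg {f : ℂ → ℂ} (hf : DifferentiableOn ℂ f UHP) {h : ℝ} (hh : 0 < h) {z : ℂ}
    (hz : 0 < z.im) :
    HasDerivAt (fun z : ℂ => I * ∫ τ in (0:ℝ)..h, f (z + τ * I)) (f (z + h * I) - f z) z := by
  set ε := z.im / 2 with hε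
  have hε0 : 0 < ε := by positivity
  have hpos : ∀ w ∈ closedBall z ε, 0 < w.im := by
    intro w hw
    rw [mem_closedBall, dist_eq_norm] at hw
    have := (Complex.abs_im_le_norm (w - z)).trans hw
    rw [sub_im, abs_le] at this
    linarith [this.1]
  have hcomp : IsCompact ((fun q : ℂ × ℝ => q.1 + q.2 * I) '' (closedBall z ε ×ˢ Icc 0 h)) :=
    ((isCompact_closedBall z ε).prod isCompact_Icc).image (by fun_prop)
  have hsub : ((fun q : ℂ × ℝ => q.1 + q.2 * I) '' (closedBall z ε ×ˢ Icc 0 h)) ⊆ UHP := by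
    rintro _ ⟨⟨w, τ⟩, ⟨h1, h2⟩, rfl⟩
    have := hpos w h1
    have h3 := h2.1
    simp [UHP] at h3 ⊢
    linarith
  obtain ⟨M, hM⟩ := hcomp.exists_bound_of_continuousOn ((cont_deriv hf).mono hsub)
  have huI : ∀ τ ∈ Ι (0:ℝ) h, τ ∈ Icc 0 h := by
    intro τ hτ; rw [uIoc_of_le hh.le] at hτ; exact Ioc_subset_Icc_self hτ
  have hmem : ∀ w ∈ closedBall z ε, ∀ τ ∈ Icc 0 h, w + τ * I ∈ UHP := by
    intro w hw τ hτ; exact hsub ⟨(w, τ), ⟨hw, hτ⟩, rfl⟩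
  have hcz : z ∈ closedBall z ε := mem_closedBall_self hε0.le
  have hI : ∀ w ∈ closedBall z ε, ContinuousOn (fun τ : ℝ => f (w + τ * I)) (Icc 0 h) := by
    intro w hw
    exact hf.continuousOn.comp (by fun_prop) (fun τ hτ => hmem w hw τ hτ)
  have := intervalIntegral.hasDerivAt_integral_of_dominated_loc_of_deriv_le
    (F := fun (w : ℂ) (τ : ℝ) => f (w + τ * I)) (F' := fun (w : ℂ) (τ : ℝ) => deriv f (w + τ * I))
    (x₀ := z) (s := ball z ε) (bound := fun _ => M) (a := 0) (b := h) (μ := MeasureTheory.volume)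
    (ball_mem_nhds z hε0) (by
      filter_upwards [closedBall_mem_nhds z hε0] with w hw
      refine ((hI w hw).mono ?_).aestronglyMeasurable measurableSet_uIoc
      exact huI) (by
      apply ContinuousOn.intervalIntegrable; rw [uIcc_of_le hh.le]; exact hI z hcz) (by
      refine (ContinuousOn.mono (s := Icc 0 h) ?_ huI).aestronglyMeasurable measurableSet_uIoc
      exact (cont_deriv hf).comp (by fun_prop) (fun τ hτ => hmem z hcz τ hτ)) (by
      refine Eventually.of_forall fun τ hτ w hw => ?_
      exact hM _ ⟨(w, τ), ⟨ball_subset_closedBall hw, huI τ hτ⟩, rfl⟩) (by simp) (by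
      refine Eventually.of_forall fun τ hτ w hw => ?_
      have := (hf.differentiableAt (isOpen_UHP.mem_nhds
        (hmem w (ball_subset_closedBall hw) τ (huI τ hτ)))).hasDerivAt
      simpa using this.comp_add_const w (τ * I))
  have h2 := this.2.const_mul I
  have e := vert_int hf z 0 h hh.le (by simpa using hz)
  rw [intervalIntegral.integral_const_mul] at e
  rw [e] at h2
  simpa using h2

lemma cont_avg {f : ℂ → ℂ} (hf : DifferentiableOn ℂ f UHP) {p r C : ℝ} (hr : 0 < r) (hC0 : 0 ≤ C)
    (hC : ∀ z ∈ UHP, z ∈ ball (p:ℂ) r → ‖deriv f z‖ ≤ C / z.im) :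
    ContinuousOn (fun z : ℂ => I * ∫ τ in (0:ℝ)..(r/4), f (z + τ * I))
      {z | z ∈ ball (p:ℂ) (r/4) ∧ 0 ≤ z.im} := by
  have hh : 0 < r / 4 := by positivity
  set h := r / 4 with hhdef
  have hin : ∀ z ∈ closedBall (p:ℂ) h, ∀ τ ∈ Icc 0 h, z + τ * I ∈ ball (p:ℂ) r := by
    intro z hz τ hτ
    rw [mem_closedBall, dist_eq_norm] at hz
    rw [mem_ball, dist_eq_norm]
    have : ‖z + τ * I - p‖ ≤ ‖z - p‖ + ‖τ * I‖ := by
      rw [show z + τ * I - p = (z - p) + τ * I by ring]; exact norm_add_le _ _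
    have h2 : ‖(τ:ℂ) * I‖ ≤ h := by simpa [abs_of_nonneg hτ.1] using hτ.2
    linarith
  have hcomp : IsCompact (closedBall (p:ℂ) h ∩ {z | 0 ≤ z.im}) :=
    (isCompact_closedBall _ _).inter_right (isClosed_le continuous_const Complex.continuous_im)
  obtain ⟨K, hK⟩ := hcomp.exists_bound_of_continuousOn (f := fun z => f (z + h * I))
    (hf.continuousOn.comp (by fun_prop) (by
      rintro z ⟨h1, h2⟩
      have h3 : 0 ≤ z.im := h2
      simp [UHP]; linarith))
  have hup : ∀ z : ℂ, 0 ≤ z.im → ∀ τ : ℝ, 0 < τ → z + τ * I ∈ UHP := by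
    intro z hz τ hτ; simp [UHP]; linarith
  have huI : ∀ τ ∈ Ι (0:ℝ) h, 0 < τ ∧ τ ≤ h := by
    intro τ hτ; rw [uIoc_of_le hh.le] at hτ; exact hτ
  refine ContinuousOn.mul continuousOn_const ?_
  intro z hz
  refine intervalIntegral.continuousWithinAt_of_dominated_interval
    (bound := fun τ => K + C * (Real.log h - Real.log τ)) ?_ ?_ ?_ ?_
  · filter_upwards [self_mem_nhdsWithin] with w hw
    refine ContinuousOn.aestronglyMeasurable ?_ measurableSet_uIoc
    refine hf.continuousOn.comp (by fun_prop) ?_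
    intro τ hτ
    exact hup w hw.2 τ (huI τ hτ).1
  · filter_upwards [self_mem_nhdsWithin] with w hw
    refine Eventually.of_forall fun τ hτ => ?_
    have hwc : w ∈ closedBall (p:ℂ) h := ball_subset_closedBall hw.1
    refine (log_bound hf hw.2 (huI τ hτ).1 (huI τ hτ).2 hC0 ?_).trans ?_
    · intro u hu
      have hu0 := (huI τ hτ).1.trans_le hu.1
      exact hC _ (hup w hw.2 u hu0) (hin w hwc u ⟨hu0.le, hu.2⟩)
    · have := hK w ⟨hwc, hw.2⟩
      linarith
  · have : IntervalIntegrable (fun τ : ℝ => Real.log τ) MeasureTheory.volume 0 h :=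
      intervalIntegral.intervalIntegrable_log'
    exact intervalIntegrable_const.add ((intervalIntegrable_const.sub this).const_mul C)
  · refine Eventually.of_forall fun τ hτ => ?_
    have hm := hup z hz.2 τ (huI τ hτ).1
    have : ContinuousAt f (z + τ * I) :=
      (hf.differentiableAt (isOpen_UHP.mem_nhds hm)).continuousAt
    have h3 : ContinuousAt (fun w : ℂ => f (w + τ * I)) z :=
      ContinuousAt.comp (f := fun w : ℂ => w + τ * I) (g := f) this (by fun_prop)
    exact h3.continuousWithinAt

end
end PK

namespace PK
section
open scoped Interval

lemma tendsto_vert (q : ℝ) : Tendsto (fun ε : ℝ => (q:ℂ) + ε * I) (𝓝[>] 0) (𝓝[UHP] (q:ℂ)) := by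
  apply tendsto_nhdsWithin_of_tendsto_nhds_of_eventually_within
  · have : ContinuousAt (fun ε : ℝ => (q:ℂ) + ε * I) 0 := by fun_prop
    have h := this.tendsto
    simp only [ofReal_zero, zero_mul, add_zero] at h
    exact h.mono_left nhdsWithin_le_nhds
  · filter_upwards [self_mem_nhdsWithin] with ε hε
    simpa [UHP] using hε

lemma hasDeriv_im_horiz {G : ℂ → ℂ} {d : ℂ} {u ε : ℝ} (h : HasDerivAt G d (u + ε * I)) :
    HasDerivAt (fun u : ℝ => (G (u + ε * I)).im) d.im u := by
  have h2 : HasDerivAt (fun u : ℝ => (u:ℂ) + ε * I) 1 u :=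
    (Complex.ofRealCLM.hasDerivAt (x := u)).add_const _
  have h3 := h.scomp u h2
  rw [one_smul] at h3
  exact (Complex.imCLM.hasFDerivAt.comp_hasDerivAt u h3)

lemma deriv_im_zero {W : ℂ → ℂ} {q : ℝ} (h : DifferentiableAt ℂ W q)
    (h0 : ∀ᶠ u : ℝ in 𝓝 q, (W u).im = 0) : (deriv W q).im = 0 := by
  have h1 : HasDerivAt W (deriv W q) ((q:ℂ) + (0:ℝ) * I) := by simpa using h.hasDerivAt
  have h2 := hasDeriv_im_horiz h1
  simp only [ofReal_zero, zero_mul, add_zero] at h2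
  have h3 : HasDerivAt (fun u : ℝ => (W u).im) 0 q :=
    (hasDerivAt_const q (0:ℝ)).congr_of_eventuallyEq h0
  exact h2.unique h3

lemma core {f : ℂ → ℂ} (hf : DifferentiableOn ℂ f UHP) {p r C : ℝ} (hr : 0 < r) (hC0 : 0 ≤ C)
    (hC : ∀ z ∈ UHP, z ∈ ball (p:ℂ) r → ‖deriv f z‖ ≤ C / z.im)
    (hb : ∀ z ∈ UHP, z ∈ ball (p:ℂ) r → |(f z).im| ≤ C)
    (h0 : ∀ q : ℝ, q ≠ p → |q - p| < r → Tendsto (fun z => (f z).im) (𝓝[UHP] (q:ℂ)) (𝓝 0)) :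
    ∃ ρ > 0, ∃ g : ℂ → ℂ, DifferentiableOn ℂ g (ball (p:ℂ) ρ) ∧
      (∀ z ∈ ball (p:ℂ) ρ, z ∈ UHP → g z = f z) ∧
      (∀ q : ℝ, (q:ℂ) ∈ ball (p:ℂ) ρ → (g q).im = 0) := by
  have hh : 0 < r / 4 := by positivity
  have hcA := cont_avg hf hr hC0 hC
  have hdA := fun z hz => hasDeriv_avg hf hh (z := z) hz
  set h := r / 4 with hhdef
  set Av := fun z : ℂ => I * ∫ τ in (0:ℝ)..h, f (z + τ * I) with hAv
  have hE : IsExactOn (fun z => f (z + h * I)) (ball (p:ℂ) h) := by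
    apply DifferentiableOn.isExactOn_ball
    refine hf.comp (by fun_prop) ?_
    intro z hz
    rw [mem_ball, dist_eq_norm] at hz
    have := (Complex.abs_im_le_norm (z - p)).trans_lt hz
    rw [abs_lt] at this
    simp [UHP] at this ⊢
    linarith [this.1]
  obtain ⟨E, hE⟩ := hE
  set G := fun z => E z - Av z with hG
  set D : Set ℂ := {z | z ∈ ball (p:ℂ) h ∧ 0 ≤ z.im} with hD
  have hGd : ∀ z ∈ ball (p:ℂ) h, 0 < z.im → HasDerivAt G (f z) z := by
    intro z hz hzi
    have := (hE z hz).sub (hdA z hzi)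
    rw [sub_sub_cancel] at this
    exact this
  have hGc : ContinuousOn G D :=
    ContinuousOn.sub (fun z hz => (hE z hz.1).continuousAt.continuousWithinAt) hcA
  have hGt : ∀ q : ℝ, (q:ℂ) ∈ ball (p:ℂ) h → Tendsto G (𝓝[UHP] (q:ℂ)) (𝓝 (G q)) := by
    intro q hq
    have h1 : ContinuousWithinAt G D q := hGc q ⟨hq, by simp⟩
    refine h1.tendsto.mono_left ?_
    rw [nhdsWithin_le_iff]
    filter_upwards [self_mem_nhdsWithin, nhdsWithin_le_nhds (isOpen_ball.mem_nhds hq)] with w hw hwb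
    exact ⟨hwb, le_of_lt hw⟩
  have hconst : ∀ q : ℝ, (q:ℂ) ∈ ball (p:ℂ) h → (G q).im = (G p).im := by
    intro q hq
    have hqp : |q - p| < h := by
      rw [mem_ball, dist_eq_norm, ← ofReal_sub, norm_real] at hq; exact hq
    have t1 : Tendsto (fun ε : ℝ => (G (q + ε * I)).im - (G (p + ε * I)).im) (𝓝[>] 0)
        (𝓝 ((G q).im - (G p).im)) := by
      have a1 := (Complex.continuous_im.tendsto _).comp ((hGt q hq).comp (tendsto_vert q))
      have a2 := (Complex.continuous_im.tendsto _).comp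
        ((hGt p (mem_ball_self hh)).comp (tendsto_vert p))
      exact a1.sub a2
    have hsm : ∀ᶠ ε : ℝ in 𝓝[>] 0, 0 < ε ∧ ε < h - |q - p| := by
      have : Ioo 0 (h - |q - p|) ∈ 𝓝[>] (0:ℝ) := Ioo_mem_nhdsGT (by linarith)
      filter_upwards [this] with ε hε using hε
    have hmem : ∀ ε : ℝ, 0 < ε ∧ ε < h - |q - p| → ∀ u ∈ [[p, q]],
        ((u:ℂ) + ε * I) ∈ ball (p:ℂ) h := by
      intro ε hε u hu
      rw [mem_ball, dist_eq_norm]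
      have h1 : |u - p| ≤ |q - p| := abs_sub_left_of_mem_uIcc hu
      have : ‖(u:ℂ) + ε * I - p‖ ≤ ‖((u - p : ℝ) : ℂ)‖ + ‖(ε:ℂ) * I‖ := by
        rw [show (u:ℂ) + ε * I - p = ((u - p : ℝ) : ℂ) + ε * I by push_cast; ring]
        exact norm_add_le _ _
      rw [norm_real, norm_mul, norm_real, norm_I, Real.norm_eq_abs, Real.norm_eq_abs,
        abs_of_pos hε.1] at this
      linarith [hε.2]
    have t2 : Tendsto (fun ε : ℝ => ∫ u in p..q, (f (u + ε * I)).im) (𝓝[>] 0)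
        (𝓝 (∫ u in p..q, (0:ℝ))) := by
      apply intervalIntegral.tendsto_integral_filter_of_dominated_convergence (fun _ => C)
      · filter_upwards [hsm] with ε hε
        refine ContinuousOn.aestronglyMeasurable ?_ measurableSet_uIoc
        refine Complex.continuous_im.comp_continuousOn (hf.continuousOn.comp (by fun_prop) ?_)
        intro u hu
        simpa [UHP] using hε.1
      · filter_upwards [hsm] with ε hε
        refine Eventually.of_forall fun u hu => ?_
        refine hb _ (by simpa [UHP] using hε.1)
          (ball_subset_ball (by linarith) (hmem ε hε u (uIoc_subset_uIcc hu)))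
      · simp
      · have : ∀ᵐ u : ℝ, u ≠ p := by
          simp [MeasureTheory.ae_iff]
        filter_upwards [this] with u hup hu
        refine (h0 u hup ?_).comp (tendsto_vert u)
        have h1 : |u - p| ≤ |q - p| := abs_sub_left_of_mem_uIcc (uIoc_subset_uIcc hu)
        linarith
    have e : ∀ᶠ ε : ℝ in 𝓝[>] 0, (∫ u in p..q, (f (u + ε * I)).im) =
        (G (q + ε * I)).im - (G (p + ε * I)).im := by
      filter_upwards [hsm] with ε hε
      apply intervalIntegral.integral_eq_sub_of_hasDerivAt
        (f := fun u : ℝ => (G (u + ε * I)).im)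
      · intro u hu
        exact hasDeriv_im_horiz (hGd _ (hmem ε hε u hu) (by simpa using hε.1))
      · apply ContinuousOn.intervalIntegrable
        refine Complex.continuous_im.comp_continuousOn (hf.continuousOn.comp (by fun_prop) ?_)
        intro u hu
        simpa [UHP] using hε.1
    have := tendsto_nhds_unique (t2.congr' e) t1
    simp at this
    linarith
  set A := fun z => G z - (G p).im * I with hA
  have hAd : ∀ z ∈ ball (p:ℂ) h, 0 < z.im → HasDerivAt A (f z) z := fun z hz hzi =>
    (hGd z hz hzi).sub_const _
  have hAt : ∀ q : ℝ, (q:ℂ) ∈ ball (p:ℂ) h →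
      Tendsto A (𝓝[UHP] (q:ℂ)) (𝓝 (((G q).re : ℝ) : ℂ)) := by
    intro q hq
    have := (hGt q hq).sub_const ((G p).im * I)
    convert this using 2
    apply Complex.ext <;> simp [hconst q hq]
  have hW : DifferentiableOn ℂ (refl A) (ball (p:ℂ) h) := by
    apply refl_diff isOpen_ball (fun z hz hzi => (hAd z hz hzi).differentiableAt)
    · intro z hz
      rw [mem_ball, dist_eq_norm] at hz ⊢
      rw [← Complex.conj_ofReal p, ← map_sub, Complex.norm_conj]
      simpa using hz
    · intro q hq
      exact ⟨_, hAt q hq⟩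
  refine ⟨h, hh, deriv (refl A), hW.deriv isOpen_ball, ?_, ?_⟩
  · intro z hz hzi
    have : refl A =ᶠ[𝓝 z] A := by
      filter_upwards [isOpen_ball.mem_nhds hz, isOpen_UHP.mem_nhds hzi] with w hw hwi
      exact refl_upper (hAd w hw hwi).differentiableAt hwi
    rw [this.deriv_eq]
    exact (hAd z hz hzi).deriv
  · intro q hq
    apply deriv_im_zero (hW.differentiableAt (isOpen_ball.mem_nhds hq))
    have : ∀ᶠ u : ℝ in 𝓝 q, (u:ℂ) ∈ ball (p:ℂ) h :=
      Complex.continuous_ofReal.continuousAt.eventually (isOpen_ball.mem_nhds hq)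
    filter_upwards [this] with u hu
    rw [refl_real (hAt u hu)]
    simp

end
end PK

namespace PK
section
open scoped Interval

/-- Principal square root. -/
def sq (z : ℂ) : ℂ := z ^ (1/2 : ℂ)

lemma sq_sq (z : ℂ) : sq z ^ 2 = z := by
  unfold sq
  rw [← Complex.cpow_nat_mul]
  norm_num

lemma norm_sq_sq (z : ℂ) : ‖sq z‖ ^ 2 = ‖z‖ := by
  rw [← norm_pow, sq_sq]

lemma norm_sq (z : ℂ) : ‖sq z‖ = √‖z‖ := by
  rw [← norm_sq_sq z, Real.sqrt_sq (norm_nonneg _)]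

lemma sq_ofReal_nonneg {p : ℝ} (hp : 0 ≤ p) : sq p = (√p : ℝ) := by
  unfold sq
  rw [Real.sqrt_eq_rpow, Complex.ofReal_cpow hp]; norm_num

lemma sq_ofReal_neg {p : ℝ} (hp : p < 0) : sq p = I * (√|p| : ℝ) := by
  unfold sq
  rw [Complex.ofReal_cpow_of_nonpos hp.le, abs_of_neg hp, Real.sqrt_eq_rpow, Complex.ofReal_cpow (by linarith)]
  have : Complex.exp (↑Real.pi * I * (1/2)) = I := by
    rw [show (↑Real.pi * I * (1/2) : ℂ) = ↑Real.pi / 2 * I by ring]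
    exact Complex.exp_pi_div_two_mul_I
  rw [this, mul_comm]; norm_num

lemma cont_sq {z : ℂ} (hz : 0 ≤ z.im) : ContinuousWithinAt sq {w | 0 ≤ w.im} z := by
  by_cases h0 : z = 0
  · subst h0
    have h1 : sq 0 = 0 := by simp [sq]
    unfold ContinuousWithinAt
    rw [h1, tendsto_zero_iff_norm_tendsto_zero]
    simp_rw [norm_sq]
    have : Continuous (fun z : ℂ => √‖z‖) := by fun_prop
    have h2 := this.tendsto 0
    simp only [norm_zero, Real.sqrt_zero] at h2
    exact h2.mono_left nhdsWithin_le_nhds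
  · have hlog : ContinuousWithinAt Complex.log {w | 0 ≤ w.im} z := by
      by_cases hs : z ∈ slitPlane
      · exact (continuousAt_clog hs).continuousWithinAt
      · rw [mem_slitPlane_iff] at hs
        push Not at hs
        have : z.re < 0 := by
          rcases lt_or_eq_of_le hs.1 with h | h
          · exact h
          · exact absurd (Complex.ext h hs.2) h0
        exact Complex.continuousWithinAt_log_of_re_neg_of_im_zero this hs.2
    have h3 : ContinuousWithinAt (fun w => Complex.exp (Complex.log w * (1/2))) {w | 0 ≤ w.im} z :=
      (hlog.mul continuousWithinAt_const).cexp
    refine h3.congr_of_eventuallyEq ?_ ?_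
    · have : ∀ᶠ w in 𝓝 z, w ≠ 0 := isOpen_ne.mem_nhds h0
      filter_upwards [nhdsWithin_le_nhds this] with w hw
      simp [sq, Complex.cpow_def_of_ne_zero hw]
    · simp [sq, Complex.cpow_def_of_ne_zero h0]

lemma diff_sq {z : ℂ} (hz : z ∈ UHP) : DifferentiableAt ℂ sq z := by
  unfold sq
  apply DifferentiableAt.cpow_const differentiableAt_id
  exact Or.inr hz.ne'

/-- The square root of the discriminant polynomial. -/
def Q (N : ℕ) (y : ℕ → ℝ) (z : ℂ) : ℂ := ∏ k ∈ Finset.Icc 1 (2*N), sq (z - y k)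
def P (N : ℕ) (y : ℕ → ℝ) (z : ℂ) : ℂ := ∏ k ∈ Finset.Icc 1 (2*N), (z - y k)
def cnt (N : ℕ) (y : ℕ → ℝ) (p : ℝ) : ℕ := ((Finset.Icc 1 (2*N)).filter (fun k => p < y k)).card

variable {N : ℕ} {y : ℕ → ℝ}

lemma Q_sq (z : ℂ) : Q N y z ^ 2 = P N y z := by
  simp [Q, P, ← Finset.prod_pow, sq_sq]

lemma cont_Q {z : ℂ} (hz : 0 ≤ z.im) : ContinuousWithinAt (Q N y) {w | 0 ≤ w.im} z := by
  have : ∀ k, ContinuousWithinAt (fun z : ℂ => sq (z - y k)) {w | 0 ≤ w.im} z := by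
    intro k
    have h := cont_sq (z := z - y k) (by simpa using hz)
    exact h.comp (f := fun z : ℂ => z - y k) (by fun_prop) (fun w hw => by simpa using hw)
  exact tendsto_finsetProd _ (fun k _ => this k)

lemma contOn_Q : ContinuousOn (Q N y) {w | 0 ≤ w.im} := fun _ hz => cont_Q hz

lemma diff_Q {z : ℂ} (hz : z ∈ UHP) : DifferentiableAt ℂ (Q N y) z := by
  have : ∀ k, DifferentiableAt ℂ (fun z : ℂ => sq (z - y k)) z := by
    intro k
    exact (diff_sq (z := z - y k) (by simpa [UHP] using hz)).comp z (f := fun z : ℂ => z - y k) (by fun_prop)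
  exact DifferentiableAt.fun_finsetProd (fun k _ => this k)

lemma tendsto_Q (p : ℝ) : Tendsto (Q N y) (𝓝[UHP] (p:ℂ)) (𝓝 (Q N y p)) := by
  have h : ContinuousWithinAt (Q N y) {w | 0 ≤ w.im} (p:ℂ) := cont_Q (by simp)
  exact h.mono_left (nhdsWithin_mono _ (fun w hw => le_of_lt (show 0 < w.im from hw)))

lemma Q_ne_zero {z : ℂ} (h : ∀ k ∈ Finset.Icc 1 (2*N), z ≠ y k) : Q N y z ≠ 0 := by
  intro h0
  have : P N y z = 0 := by rw [← Q_sq, h0]; simp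
  rw [P, Finset.prod_eq_zero_iff] at this
  obtain ⟨k, hk, hk2⟩ := this
  exact h k hk (sub_eq_zero.mp hk2)

lemma Q_ne_zero_UHP {z : ℂ} (hz : z ∈ UHP) : Q N y z ≠ 0 := by
  apply Q_ne_zero
  intro k _ h
  rw [h] at hz; simp [UHP] at hz

lemma norm_Q (z : ℂ) : ‖Q N y z‖ = ∏ k ∈ Finset.Icc 1 (2*N), √‖z - y k‖ := by
  simp [Q, norm_sq]

/-- Value of Q on the real axis. -/
lemma Q_real (p : ℝ) : Q N y p = I ^ cnt N y p * ((‖Q N y p‖ : ℝ) : ℂ) := by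
  rw [norm_Q, Q, cnt, Finset.card_filter, ← Finset.prod_pow_eq_pow_sum, Complex.ofReal_prod, ← Finset.prod_mul_distrib]
  apply Finset.prod_congr rfl
  intro k _
  rw [← ofReal_sub, Complex.norm_real, Real.norm_eq_abs]
  by_cases h : p < y k
  · rw [sq_ofReal_neg (by linarith)]; simp [h]
  · rw [sq_ofReal_nonneg (by linarith), abs_of_nonneg (by linarith)]; simp [h]

lemma Q_even {p : ℝ} (h : Even (cnt N y p)) : ∃ a : ℝ, Q N y p = a ∧ |a| = ‖Q N y p‖ := by
  obtain ⟨n, hn⟩ := h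
  refine ⟨(-1)^n * ‖Q N y p‖, ?_, ?_⟩
  · conv_lhs => rw [Q_real, hn, ← two_mul, pow_mul, I_sq]
    push_cast; rfl
  · simp [abs_mul]

lemma Q_odd {p : ℝ} (h : Odd (cnt N y p)) : ∃ a : ℝ, Q N y p = I * a := by
  obtain ⟨n, hn⟩ := h
  refine ⟨(-1)^n * ‖Q N y p‖, ?_⟩
  conv_lhs => rw [Q_real, hn, pow_succ, pow_mul, I_sq]
  push_cast; ring

lemma norm_Q_mono {w : ℂ} (hw : 0 ≤ w.im) {ε : ℝ} (hε : 0 ≤ ε) : ‖Q N y w‖ ≤ ‖Q N y (w + ε * I)‖ := by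
  rw [norm_Q, norm_Q]
  apply Finset.prod_le_prod (fun _ _ => Real.sqrt_nonneg _)
  intro k _
  apply Real.sqrt_le_sqrt
  rw [Complex.norm_eq_sqrt_sq_add_sq, Complex.norm_eq_sqrt_sq_add_sq]
  apply Real.sqrt_le_sqrt
  simp
  nlinarith

lemma norm_Q_le {z : ℂ} {M : ℝ} (hM : ∀ k ∈ Finset.Icc 1 (2*N), ‖z - y k‖ ≤ M) (hM0 : 0 ≤ M) : ‖Q N y z‖ ≤ M ^ N := by
  have h : ‖Q N y z‖ ^ 2 ≤ (M ^ N) ^ 2 := by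
    rw [← norm_pow, Q_sq, P, norm_prod]
    calc _ ≤ ∏ k ∈ Finset.Icc 1 (2*N), M := Finset.prod_le_prod (fun _ _ => norm_nonneg _) hM
      _ = (M^N)^2 := by simp [← pow_mul, mul_comm]
  exact le_of_sq_le_sq h (by positivity)

lemma norm_Q_near {k : ℕ} (hk : k ∈ Finset.Icc 1 (2*N)) : ∃ C > 0, ∀ z ∈ ball ((y k : ℝ) : ℂ) 1,
    ‖Q N y z‖ ≤ C * √‖z - y k‖ := by
  refine ⟨(∏ j ∈ (Finset.Icc 1 (2*N)).erase k, √(1 + ‖((y k : ℝ):ℂ) - y j‖)), ?_, ?_⟩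
  · apply Finset.prod_pos; intro j _; positivity
  · intro z hz
    rw [norm_Q, ← Finset.prod_erase_mul _ _ hk]
    gcongr with j hj
    have : z - y j = (z - y k) + (y k - y j) := by ring
    rw [this]
    refine (norm_add_le _ _).trans ?_
    rw [mem_ball, dist_eq_norm] at hz
    gcongr

lemma P_diff : Differentiable ℂ (P N y) := by
  unfold P; fun_prop

/-- Difference quotient bound for Q at real points that are not marked. -/
lemma Q_lip {s : ℝ} (hs : ∀ k ∈ Finset.Icc 1 (2*N), s ≠ y k) : ∃ C > 0, ∃ r > 0,
    ∀ z ∈ UHP, z ∈ ball (s:ℂ) r → ‖Q N y z - Q N y s‖ ≤ C * ‖z - s‖ := by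
  have hne : Q N y s ≠ 0 := Q_ne_zero (fun k hk h => hs k hk (by exact_mod_cast h))
  obtain ⟨C, hC⟩ := (P_diff (N := N) (y := y) (s:ℂ)).isBigO_sub.bound
  have h1 : ∀ᶠ z in 𝓝[UHP] (s:ℂ), ‖Q N y s‖ < ‖Q N y z + Q N y s‖ := by
    have h2 := ((tendsto_Q (N := N) (y := y) s).add_const (Q N y s)).norm
    apply h2.eventually_const_lt
    rw [← two_mul, norm_mul]
    have : 0 < ‖Q N y s‖ := norm_pos_iff.mpr hne
    norm_num
    linarith
  have h3 := h1.and (nhdsWithin_le_nhds hC)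
  rw [eventually_nhdsWithin_iff, Metric.eventually_nhds_iff_ball] at h3
  obtain ⟨r, hr, h3⟩ := h3
  refine ⟨(|C|+1) / ‖Q N y s‖, by positivity, r, hr, fun z hz hzr => ?_⟩
  obtain ⟨h4, h5⟩ := h3 z hzr hz
  have h6 : ‖Q N y z - Q N y s‖ * ‖Q N y z + Q N y s‖ ≤ C * ‖z - s‖ := by
    rw [← norm_mul]
    have : (Q N y z - Q N y s) * (Q N y z + Q N y s) = P N y z - P N y s := by
      rw [← Q_sq, ← Q_sq]; ring
    rwa [this]
  have h7 : ‖Q N y z - Q N y s‖ * ‖Q N y s‖ ≤ (|C|+1) * ‖z - s‖ := by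
    refine (mul_le_mul_of_nonneg_left h4.le (norm_nonneg _)).trans (h6.trans ?_)
    gcongr; linarith [le_abs_self C]
  have h8 : 0 < ‖Q N y s‖ := norm_pos_iff.mpr hne
  rw [div_mul_eq_mul_div, le_div_iff₀ h8]
  exact h7

/-- Convergence of difference quotients of Q along the real axis. -/
lemma Q_strict {x : ℝ} (hx : ∀ k ∈ Finset.Icc 1 (2*N), x ≠ y k) : ∃ d : ℂ,
    Tendsto (fun p : ℝ × ℝ => (Q N y p.2 - Q N y p.1) / ((p.2:ℂ) - p.1)) (𝓝[{p | p.1 ≠ p.2}] (x, x)) (𝓝 d) := by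
  have hne : Q N y x ≠ 0 := Q_ne_zero (fun k hk h => hx k hk (by exact_mod_cast h))
  have hcont : ContinuousAt (fun u : ℝ => Q N y u) x := by
    have h : ContinuousWithinAt (Q N y) {w | 0 ≤ w.im} (x:ℂ) := cont_Q (by simp)
    have h2 := h.comp (f := fun u : ℝ => (u:ℂ)) (s := univ) (x := x) (by fun_prop) (fun u _ => by simp)
    exact (continuousWithinAt_univ _ _).mp h2
  have hP : HasStrictDerivAt (P N y) (deriv (P N y) x) (x:ℂ) := 
    (P_diff.contDiff (n := 1)).contDiffAt.hasStrictDerivAt (by norm_num)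
  have hS := hP.hasStrictFDerivAt.isLittleO
  have hmap : Tendsto (fun p : ℝ × ℝ => ((p.2:ℂ), (p.1:ℂ))) (𝓝[{p | p.1 ≠ p.2}] (x, x)) (𝓝 ((x:ℂ),(x:ℂ))) := by
    have : Continuous (fun p : ℝ × ℝ => ((p.2:ℂ), (p.1:ℂ))) := by fun_prop
    exact (this.tendsto (x,x)).mono_left nhdsWithin_le_nhds
  have h1 := (hS.comp_tendsto hmap).tendsto_div_nhds_zero
  have h2 : Tendsto (fun p : ℝ × ℝ => (P N y p.2 - P N y p.1) / ((p.2:ℂ) - p.1)) (𝓝[{p | p.1 ≠ p.2}] (x, x)) (𝓝 (deriv (P N y) x)) := by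
    rw [← zero_add (deriv (P N y) x)]
    refine (h1.add_const (deriv (P N y) x)).congr' ?_
    filter_upwards [self_mem_nhdsWithin] with p hp
    have : (p.2:ℂ) - p.1 ≠ 0 := by
      rw [sub_ne_zero]; exact_mod_cast Ne.symm hp
    simp
    field_simp
    ring
  have hs1 : Tendsto (fun p : ℝ × ℝ => Q N y p.2 + Q N y p.1) (𝓝[{p | p.1 ≠ p.2}] (x, x)) (𝓝 (Q N y x + Q N y x)) := by
    have a1 : Tendsto (fun p : ℝ × ℝ => p.2) (𝓝[{p | p.1 ≠ p.2}] (x, x)) (𝓝 x) := (continuous_snd.tendsto (x,x)).mono_left nhdsWithin_le_nhds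
    have a2 : Tendsto (fun p : ℝ × ℝ => p.1) (𝓝[{p | p.1 ≠ p.2}] (x, x)) (𝓝 x) := (continuous_fst.tendsto (x,x)).mono_left nhdsWithin_le_nhds
    exact (hcont.tendsto.comp a1).add (hcont.tendsto.comp a2)
  have hne2 : Q N y x + Q N y x ≠ 0 := by rw [← two_mul]; exact mul_ne_zero two_ne_zero hne
  refine ⟨_, (h2.div hs1 hne2).congr' ?_⟩
  filter_upwards [self_mem_nhdsWithin, hs1.eventually_ne hne2] with p hp hp2
  have : (p.2:ℂ) - p.1 ≠ 0 := by
    rw [sub_ne_zero]; exact_mod_cast Ne.symm hp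
  simp only [Pi.div_apply]
  rw [← Q_sq, ← Q_sq]
  field_simp
  ring

end
end PK

namespace PK
section
open scoped Interval

/-- The singular points on the real axis. -/
def Sg (N : ℕ) (y : ℕ → ℝ) (t s : ℝ) : Finset ℝ := insert t (insert s ((Finset.Icc 1 (2*N)).image y))

structure Sol (N : ℕ) (y : ℕ → ℝ) (t s m1 mN : ℝ) (h : ℂ → ℂ) : Prop where
  diff : DifferentiableOn ℂ h UHP
  bdd : ∃ C > 0, ∀ z ∈ UHP, |(h z).im| ≤ C
  locD : ∀ p R : ℝ, 0 < R → (∀ σ ∈ Sg N y t s, R ≤ |σ - p|) → Odd (cnt N y p) →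
    ∃ c : ℝ, ∀ q : ℝ, |q - p| < R → Tendsto (fun z => (h z).im) (𝓝[UHP] (q:ℂ)) (𝓝 c)
  locN : ∀ p R : ℝ, 0 < R → (∀ σ ∈ Sg N y t s, R ≤ |σ - p|) → Even (cnt N y p) →
    ∃ c : ℝ, ∀ q : ℝ, |q - p| < R → Tendsto (fun z => (h z).re) (𝓝[UHP] (q:ℂ)) (𝓝 c)
  ts : t < s
  win : ∃ ρ > 0, (∀ q ∈ Ioo (t - ρ) t ∪ Ioo s (s + ρ), Tendsto (fun z => (h z).im) (𝓝[UHP] (q:ℂ)) (𝓝 0)) ∧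
    (∀ q ∈ Ioo t s, Tendsto (fun z => (h z).im) (𝓝[UHP] (q:ℂ)) (𝓝 1))
  todd : Odd (cnt N y t)
  sodd : Odd (cnt N y s)
  tY : ∀ k ∈ Finset.Icc 1 (2*N), t ≠ y k
  sY : ∀ k ∈ Finset.Icc 1 (2*N), s ≠ y k
  zero1 : Tendsto (fun z => (h z).im) (𝓝[UHP] (m1:ℂ)) (𝓝 0)
  zeroN : Tendsto (fun z => (h z).im) (𝓝[UHP] (mN:ℂ)) (𝓝 0)
  gap : ∃ c : ℝ, ∀ i : ℕ, 1 ≤ i → i ≤ N - 1 → ∀ p ∈ Set.Ioo (y (2 * i)) (y (2 * i + 1)),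
    Tendsto (fun z => (h z).re) (𝓝[UHP] (p : ℂ)) (𝓝 c)

variable {N : ℕ} {y : ℕ → ℝ} {t s m1 mN : ℝ} {h : ℂ → ℂ}

lemma lim_le {f : ℂ → ℝ} {q c C : ℝ} (hf : Tendsto f (𝓝[UHP] (q:ℂ)) (𝓝 c)) (hb : ∀ z ∈ UHP, |f z| ≤ C) : |c| ≤ C := by
  have := neBot_real (q:ℂ) (by simp)
  refine le_of_tendsto hf.abs ?_
  filter_upwards [self_mem_nhdsWithin] with z hz using hb z hz

lemma Sol.deriv_im (H : Sol N y t s m1 mN h) {C : ℝ} (hC0 : 0 < C) (hC : ∀ z ∈ UHP, |(h z).im| ≤ C)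
    {z : ℂ} (hz : z ∈ UHP) : ‖deriv h z‖ ≤ 8 * C / z.im := by
  have hsub : ball z z.im ⊆ UHP := by
    intro w hw
    rw [mem_ball, dist_eq_norm] at hw
    have := (abs_lt.mp (lt_of_le_of_lt (abs_im_le_norm (w - z)) hw)).1
    simp only [sub_im] at this
    show 0 < w.im
    linarith
  exact deriv_bound_im hz hC0 (H.diff.mono hsub) (fun w hw => hC w (hsub hw))

lemma Sol.locF (H : Sol N y t s m1 mN h) {C : ℝ} (hC0 : 0 < C) (hC : ∀ z ∈ UHP, |(h z).im| ≤ C)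
    {p R : ℝ} (hR : 0 < R) (hS : ∀ σ ∈ Sg N y t s, R ≤ |σ - p|) :
    ∃ κ c : ℂ, ((κ = 1 ∧ Odd (cnt N y p) ∧ ∀ z ∈ UHP, |(κ * (h z - c)).im| ≤ 2 * C) ∨
      (κ = I ∧ Even (cnt N y p) ∧ ∀ z ∈ UHP, |(κ * (h z - c)).re| ≤ 2 * C)) ∧
      ∀ q : ℝ, |q - p| < R → Tendsto (fun z => (κ * (h z - c)).im) (𝓝[UHP] (q:ℂ)) (𝓝 0) := by
  rcases Nat.even_or_odd (cnt N y p) with he | ho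
  · obtain ⟨c, hc⟩ := H.locN p R hR hS he
    refine ⟨I, c, Or.inr ⟨rfl, he, ?_⟩, ?_⟩
    · intro z hz
      simp
      linarith [hC z hz]
    · intro q hq
      simpa using (hc q hq).sub_const c
  · obtain ⟨c, hc⟩ := H.locD p R hR hS ho
    refine ⟨1, c * I, Or.inl ⟨rfl, ho, ?_⟩, ?_⟩
    · intro z hz
      simp
      have h1 := lim_le (hc p (by simpa using hR)) hC
      have h2 := hC z hz
      rw [abs_le] at *
      constructor <;> linarith
    · intro q hq
      simpa using (hc q hq).sub_const c

lemma Sol.locG (H : Sol N y t s m1 mN h) {C : ℝ} (hC0 : 0 < C) (hC : ∀ z ∈ UHP, |(h z).im| ≤ C)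
    {κ c : ℂ} (hκ : ‖κ‖ = 1) {p R : ℝ} 
    (hl : ∀ q : ℝ, |q - p| < R → Tendsto (fun z => (κ * (h z - c)).im) (𝓝[UHP] (q:ℂ)) (𝓝 0))
    {q : ℝ} (hq : |q - p| < R) :
    ∃ ρ > 0, ∃ g : ℂ → ℂ, DifferentiableOn ℂ g (ball (q:ℂ) ρ) ∧
      (∀ z ∈ ball (q:ℂ) ρ, z ∈ UHP → g z = κ * (h z - c)) ∧ (∀ u : ℝ, (u:ℂ) ∈ ball (q:ℂ) ρ → (g u).im = 0) := by
  have h1 : ∀ᶠ z in 𝓝[UHP] (q:ℂ), |(κ * (h z - c)).im| < 1 := by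
    have := (hl q hq).abs
    rw [abs_zero] at this
    exact this.eventually_lt_const one_pos
  rw [eventually_nhdsWithin_iff, Metric.eventually_nhds_iff_ball] at h1
  obtain ⟨r, hr, h1⟩ := h1
  have hf : DifferentiableOn ℂ (fun z => κ * (h z - c)) UHP := (H.diff.sub_const c).const_mul κ
  refine core (C := 8 * C + 1) (r := min r (R - |q - p|)) hf (lt_min hr (by linarith)) (by linarith) ?_ ?_ ?_
  · intro z hz _
    have hd : DifferentiableAt ℂ h z := H.diff.differentiableAt (isOpen_UHP.mem_nhds hz)
    have : deriv (fun z => κ * (h z - c)) z = κ * deriv h z := by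
      rw [deriv_const_mul _ (hd.sub_const c), deriv_sub_const]
    rw [this, norm_mul, hκ, one_mul]
    refine (H.deriv_im hC0 hC hz).trans ?_
    have hz0 : 0 < z.im := hz
    gcongr; linarith
  · intro z hz hzb
    have := h1 z (ball_subset_ball (min_le_left _ _) hzb) hz
    linarith
  · intro u _ hu
    apply hl
    have h2 := lt_of_lt_of_le hu (min_le_right _ _)
    have := abs_sub_le u q p
    linarith

lemma exists_sep {S : Finset ℝ} {p : ℝ} (hp : p ∉ S) : ∃ R > 0, ∀ σ ∈ S, R ≤ |σ - p| := by
  have : ∀ᶠ q in 𝓝 p, q ∉ (S : Set ℝ) := (S.finite_toSet.isClosed.isOpen_compl).mem_nhds (by simpa using hp)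
  rw [Metric.eventually_nhds_iff_ball] at this
  obtain ⟨R, hR, h⟩ := this
  refine ⟨R, hR, fun σ hσ => ?_⟩
  by_contra! hlt
  exact h σ (by rwa [mem_ball, Real.dist_eq]) (by simpa using hσ)

lemma Sol.A_lim (H : Sol N y t s m1 mN h) {p : ℝ} (hp : p ∉ Sg N y t s) :
    ∃ a : ℝ, Tendsto (fun z => deriv h z * Q N y z / I) (𝓝[UHP] (p:ℂ)) (𝓝 (a:ℂ)) := by
  obtain ⟨C, hC0, hC⟩ := H.bdd
  obtain ⟨R, hR, hS⟩ := exists_sep hp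
  obtain ⟨κ, c, hκ, hl⟩ := H.locF hC0 hC hR hS
  have hκ1 : ‖κ‖ = 1 := by rcases hκ with h | h <;> simp [h.1]
  obtain ⟨ρ, hρ, g, hg, hgf, hg0⟩ := H.locG hC0 hC hκ1 hl (q := p) (by simpa using hR)
  have hpb : (p:ℂ) ∈ ball (p:ℂ) ρ := mem_ball_self hρ
  have hgd : DifferentiableAt ℂ g p := hg.differentiableAt (isOpen_ball.mem_nhds hpb)
  have him : (deriv g p).im = 0 := by
    apply deriv_im_zero hgd
    have : ∀ᶠ u : ℝ in 𝓝 p, (u:ℂ) ∈ ball (p:ℂ) ρ := 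
      (continuous_ofReal.continuousAt (x := p)).eventually_mem (isOpen_ball.mem_nhds hpb)
    filter_upwards [this] with u hu using hg0 u hu
  have hcd : ContinuousAt (deriv g) p := ((hg.deriv isOpen_ball).differentiableAt (isOpen_ball.mem_nhds hpb)).continuousAt
  have h1 : Tendsto (fun z => κ * deriv h z) (𝓝[UHP] (p:ℂ)) (𝓝 (deriv g p)) := by
    refine (hcd.tendsto.mono_left nhdsWithin_le_nhds).congr' ?_
    filter_upwards [self_mem_nhdsWithin, nhdsWithin_le_nhds (isOpen_ball.mem_nhds hpb)] with z hz hzb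
    have hd : DifferentiableAt ℂ h z := H.diff.differentiableAt (isOpen_UHP.mem_nhds hz)
    have h2 : g =ᶠ[𝓝 z] fun z => κ * (h z - c) := by
      filter_upwards [isOpen_UHP.mem_nhds hz, isOpen_ball.mem_nhds hzb] with w hw hwb using hgf w hwb hw
    rw [h2.deriv_eq, deriv_const_mul _ (hd.sub_const c), deriv_sub_const]
  have hd : deriv g p = ((deriv g p).re : ℂ) := Complex.ext (by simp) (by simp [him])
  have hκ0 : κ ≠ 0 := by intro h0; simp [h0] at hκ1
  have h2 := (h1.mul (tendsto_Q (N := N) (y := y) p)).div_const (κ * I)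
  have h3 : Tendsto (fun z => deriv h z * Q N y z / I) (𝓝[UHP] (p:ℂ)) (𝓝 (deriv g p * Q N y p / (κ * I))) := by
    refine h2.congr ?_
    intro z
    field_simp
  rcases hκ with ⟨hk, ho, _⟩ | ⟨hk, he, _⟩
  · obtain ⟨a, ha⟩ := Q_odd ho
    refine ⟨(deriv g p).re * a, ?_⟩
    convert h3 using 2
    rw [hd, ha, hk]
    push_cast
    simp only [ofReal_re]
    have := I_ne_zero
    field_simp
  · obtain ⟨a, ha, _⟩ := Q_even he
    refine ⟨-((deriv g p).re * a), ?_⟩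
    convert h3 using 2
    rw [hd, ha, hk]
    push_cast
    simp only [ofReal_re]
    rw [I_mul_I]; ring

lemma Sol.bound (H : Sol N y t s m1 mN h) : ∃ K > 0, ∀ z ∈ UHP, ∀ d > 0, (∀ σ ∈ Sg N y t s, d ≤ ‖z - σ‖) →
    ‖deriv h z‖ ≤ K / d := by
  obtain ⟨C, hC0, hC⟩ := H.bdd
  refine ⟨32 * C, by linarith, fun z hz d hd hS => ?_⟩
  have hz0 : 0 < z.im := hz
  by_cases hzd : d / 4 ≤ z.im
  · refine (H.deriv_im hC0 hC hz).trans ?_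
    rw [div_le_div_iff₀ hz0 hd]
    nlinarith
  push Not at hzd
  have hS2 : ∀ σ ∈ Sg N y t s, 3 * d / 4 ≤ |σ - z.re| := by
    intro σ hσ
    have h1 := hS σ hσ
    have h2 := Complex.norm_le_abs_re_add_abs_im (z - σ)
    simp only [sub_re, ofReal_re, sub_im, ofReal_im, sub_zero, abs_of_pos hz0] at h2
    rw [abs_sub_comm]; linarith
  obtain ⟨κ, c, hκ, hl⟩ := H.locF hC0 hC (p := z.re) (R := 3 * d / 4) (by linarith) hS2
  have hκ1 : ‖κ‖ = 1 := by rcases hκ with h | h <;> simp [h.1]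
  set f : ℂ → ℂ := fun z => κ * (h z - c) with hf
  have hfd : ∀ w ∈ UHP, DifferentiableAt ℂ f w := fun w hw =>
    ((H.diff.differentiableAt (isOpen_UHP.mem_nhds hw)).sub_const c).const_mul κ
  set U := ball (z.re : ℂ) (3 * d / 4) with hU
  have hlim : ∀ p : ℝ, (p:ℂ) ∈ U → ∃ a : ℝ, Tendsto f (𝓝[UHP] (p:ℂ)) (𝓝 (a:ℂ)) := by
    intro p hp
    have hp' : |p - z.re| < 3 * d / 4 := by
      rwa [hU, mem_ball, dist_eq_norm, ← ofReal_sub, Complex.norm_real] at hp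
    obtain ⟨ρ, hρ, g, hg, hgf, hg0⟩ := H.locG hC0 hC hκ1 hl hp'
    have hpb : (p:ℂ) ∈ ball (p:ℂ) ρ := mem_ball_self hρ
    have hgd : ContinuousAt g p := (hg.differentiableAt (isOpen_ball.mem_nhds hpb)).continuousAt
    refine ⟨(g p).re, ?_⟩
    have : ((g p).re : ℂ) = g p := Complex.ext (by simp) (by simp [hg0 p hpb])
    rw [this]
    refine (hgd.tendsto.mono_left nhdsWithin_le_nhds).congr' ?_
    filter_upwards [self_mem_nhdsWithin, nhdsWithin_le_nhds (isOpen_ball.mem_nhds hpb)] with w hw hwb using hgf w hwb hw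
  have hconj : ∀ w ∈ U, (starRingEnd ℂ) w ∈ U := by
    intro w hw
    rw [hU, mem_ball, dist_eq_norm] at hw ⊢
    rw [← Complex.norm_conj]; simpa using hw
  have hdiff : DifferentiableOn ℂ (refl f) U := refl_diff isOpen_ball (fun w _ hw => hfd w hw) hconj hlim
  have hballU : ball z (d/2) ⊆ U := by
    apply ball_subset_ball'
    rw [dist_eq_norm]
    have : z - (z.re:ℂ) = z.im * I := by apply Complex.ext <;> simp
    rw [this]; simp [abs_of_pos hz0]; linarith
  have hder : deriv (refl f) z = κ * deriv h z := by
    have h2 : refl f =ᶠ[𝓝 z] f := by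
      filter_upwards [isOpen_UHP.mem_nhds hz] with w hw using refl_upper (hfd w hw) hw
    rw [h2.deriv_eq, hf]
    have hd : DifferentiableAt ℂ h z := H.diff.differentiableAt (isOpen_UHP.mem_nhds hz)
    rw [deriv_const_mul _ (hd.sub_const c), deriv_sub_const]
  have hnorm : ‖deriv h z‖ = ‖deriv (refl f) z‖ := by rw [hder, norm_mul, hκ1, one_mul]
  have hfin : ‖deriv (refl f) z‖ ≤ 8 * (2 * C) / (d/2) := by
    rcases hκ with ⟨_, _, hb⟩ | ⟨_, _, hb⟩
    · apply deriv_bound_im (by linarith) (by linarith) (hdiff.mono hballU)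
      intro w hw
      rcases lt_trichotomy w.im 0 with h0 | h0 | h0
      · have hcw : (starRingEnd ℂ) w ∈ UHP := by simpa [UHP] using h0
        rw [refl_lower (hfd _ hcw) h0, conj_im, abs_neg]
        exact hb _ hcw
      · have hwr : w = (w.re : ℂ) := Complex.ext (by simp) (by simp [h0])
        obtain ⟨a, ha⟩ := hlim w.re (hwr ▸ hballU hw)
        rw [hwr, refl_real ha]; simp; linarith
      · rw [refl_upper (hfd _ h0) h0]; exact hb _ h0
    · apply deriv_bound_re (by linarith) (by linarith) (hdiff.mono hballU)
      intro w hw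
      rcases lt_trichotomy w.im 0 with h0 | h0 | h0
      · have hcw : (starRingEnd ℂ) w ∈ UHP := by simpa [UHP] using h0
        rw [refl_lower (hfd _ hcw) h0, conj_re]
        exact hb _ hcw
      · have hwr : w = (w.re : ℂ) := Complex.ext (by simp) (by simp [h0])
        obtain ⟨a, ha⟩ := hlim w.re (hwr ▸ hballU hw)
        rw [hwr, refl_real ha]
        have h5 := (Complex.continuous_re.tendsto _).comp ha
        exact lim_le (q := w.re) h5 hb
      · rw [refl_upper (hfd _ h0) h0]; exact hb _ h0
  rw [hnorm]
  refine hfin.trans (le_of_eq ?_)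
  field_simp; ring

end
end PK

namespace PK
section
open scoped Interval
variable {N : ℕ} {y : ℕ → ℝ} {t s m1 mN : ℝ} {h : ℂ → ℂ}

lemma arg_lim_pos {p q : ℝ} (hq : p < q) : Tendsto (fun z : ℂ => (Complex.log (z - p)).im) (𝓝[UHP] (q:ℂ)) (𝓝 0) := by
  have hs : ((q:ℂ) - p) ∈ slitPlane := by rw [mem_slitPlane_iff]; left; simpa using hq
  have h1 : ContinuousAt (fun z : ℂ => (Complex.log (z - p)).im) q := by
    apply Complex.continuous_im.continuousAt.comp
    exact (continuousAt_clog hs).comp (f := fun z : ℂ => z - p) (by fun_prop)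
  have h2 : (Complex.log ((q:ℂ) - p)).im = 0 := by
    rw [← ofReal_sub, Complex.log_im, Complex.arg_ofReal_of_nonneg (by linarith)]
  have := h1.tendsto.mono_left (nhdsWithin_le_nhds (s := UHP))
  rwa [h2] at this

lemma arg_lim_neg {p q : ℝ} (hq : q < p) : Tendsto (fun z : ℂ => (Complex.log (z - p)).im) (𝓝[UHP] (q:ℂ)) (𝓝 Real.pi) := by
  have h1 : ContinuousWithinAt Complex.log {w | 0 ≤ w.im} ((q:ℂ) - p) := 
    Complex.continuousWithinAt_log_of_re_neg_of_im_zero (by simpa using hq) (by simp)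
  have h2 : ContinuousWithinAt (fun z : ℂ => Complex.log (z - p)) {w | 0 ≤ w.im} (q:ℂ) := 
    h1.comp (f := fun z : ℂ => z - p) (by fun_prop) (fun w hw => by simpa using hw)
  have h3 := (Complex.continuous_im.continuousAt.tendsto.comp h2).mono_left 
    (nhdsWithin_mono _ (fun w hw => le_of_lt (show 0 < w.im from hw)) : 𝓝[UHP] (q:ℂ) ≤ _)
  have h4 : (Complex.log ((q:ℂ) - p)).im = Real.pi := by
    rw [← ofReal_sub, Complex.log_im, Complex.arg_ofReal_of_neg (by linarith)]
  rw [h4] at h3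
  exact h3

lemma Sol.near (H : Sol N y t s m1 mN h) {p ρ e b : ℝ} (hρ : 0 < ρ)
    (hr : ∀ q ∈ Ioo p (p + ρ), Tendsto (fun z => (h z).im) (𝓝[UHP] (q:ℂ)) (𝓝 b))
    (hl : ∀ q ∈ Ioo (p - ρ) p, Tendsto (fun z => (h z).im) (𝓝[UHP] (q:ℂ)) (𝓝 (e + b))) :
    ∃ r > 0, ∃ K > 0, ∀ z ∈ UHP, z ∈ ball (p:ℂ) r → ‖deriv h z - (e / Real.pi : ℝ) / (z - p)‖ ≤ K := by
  obtain ⟨C, hC0, hC⟩ := H.bdd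
  set D : ℂ → ℂ := fun z => h z - (e / Real.pi : ℝ) * Complex.log (z - p) - b * I with hD
  have hpi := Real.pi_pos
  have hlogd : ∀ z ∈ UHP, HasDerivAt (fun z : ℂ => Complex.log (z - p)) (1 / (z - p)) z := by
    intro z hz
    have : z - p ∈ slitPlane := by
      rw [mem_slitPlane_iff]; right
      simpa using (show 0 < z.im from hz).ne'
    exact ((hasDerivAt_id z).sub_const (p:ℂ)).clog this
  have hDd : ∀ z ∈ UHP, HasDerivAt D (deriv h z - (e / Real.pi : ℝ) / (z - p)) z := by
    intro z hz
    have h1 := (H.diff.differentiableAt (isOpen_UHP.mem_nhds hz)).hasDerivAt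
    have h2 := (h1.sub ((hlogd z hz).const_mul ((e / Real.pi : ℝ):ℂ))).sub_const (b * I : ℂ)
    rw [mul_one_div] at h2
    exact h2
  have hne : ∀ z ∈ UHP, z.im ≤ ‖z - p‖ := by
    intro z hz
    have := abs_im_le_norm (z - p)
    simp at this
    exact (le_abs_self _).trans this
  have hcore := core (f := D) (p := p) (r := ρ) (C := 8 * C + C + |e| + |b| + |e|/Real.pi)
    (fun z hz => (hDd z hz).differentiableAt.differentiableWithinAt) hρ (by positivity) ?_ ?_ ?_
  · obtain ⟨r, hr0, g, hg, hgf, -⟩ := hcore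
    have hpb : (p:ℂ) ∈ ball (p:ℂ) r := mem_ball_self hr0
    have hcd : ContinuousAt (deriv g) p := ((hg.deriv isOpen_ball).differentiableAt (isOpen_ball.mem_nhds hpb)).continuousAt
    have h1 : ∀ᶠ z in 𝓝 (p:ℂ), ‖deriv g z‖ < ‖deriv g p‖ + 1 := hcd.norm.tendsto.eventually_lt_const (by linarith)
    have h2 := h1.and (isOpen_ball.mem_nhds hpb)
    rw [Metric.eventually_nhds_iff_ball] at h2
    obtain ⟨r', hr', h2⟩ := h2
    refine ⟨r', hr', ‖deriv g p‖ + 1, by positivity, fun z hz hzb => ?_⟩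
    obtain ⟨h3, h4⟩ := h2 z hzb
    have h5 : g =ᶠ[𝓝 z] D := by
      filter_upwards [isOpen_UHP.mem_nhds hz, isOpen_ball.mem_nhds h4] with w hw hwb using hgf w hwb hw
    rw [← (hDd z hz).deriv, ← h5.deriv_eq]
    exact h3.le
  · intro z hz _
    have hz0 : 0 < z.im := hz
    rw [(hDd z hz).deriv]
    refine (norm_sub_le _ _).trans ?_
    have h1 := H.deriv_im hC0 hC hz
    have h2 : ‖((e / Real.pi : ℝ):ℂ) / (z - p)‖ ≤ (|e|/Real.pi) / z.im := by
      rw [norm_div, Complex.norm_real, Real.norm_eq_abs, abs_div, abs_of_pos hpi]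
      gcongr
      exact hne z hz
    refine (add_le_add h1 h2).trans ?_
    rw [← add_div]
    gcongr
    have := abs_nonneg e
    have := abs_nonneg b
    linarith
  · intro z hz _
    have h1 := hC z hz
    have h2 : |(Complex.log (z - p)).im| ≤ Real.pi := by
      rw [Complex.log_im]; exact Complex.abs_arg_le_pi _
    have h3 : (D z).im = (h z).im - (e / Real.pi) * (Complex.log (z - p)).im - b := by
      simp only [hD, sub_im, im_ofReal_mul, I_im, mul_one]
    rw [h3]
    refine (abs_sub _ _).trans ?_
    have h4 := abs_sub ((h z).im) ((e / Real.pi) * (Complex.log (z - p)).im)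
    have h5 : |(e / Real.pi) * (Complex.log (z - p)).im| ≤ |e| := by
      rw [abs_mul, abs_div, abs_of_pos hpi, div_mul_eq_mul_div, div_le_iff₀ hpi]
      gcongr
    have : 0 ≤ |e| / Real.pi := by positivity
    linarith
  · intro q hqp hq
    have h3 : ∀ z, (D z).im = (h z).im - (e / Real.pi) * (Complex.log (z - p)).im - b := by
      intro z
      simp only [hD, sub_im, im_ofReal_mul, I_im, mul_one]
    simp_rw [h3]
    rw [abs_lt] at hq
    rcases lt_or_gt_of_ne hqp with hlt | hlt
    · have h4 := ((hl q ⟨by linarith, hlt⟩).sub ((arg_lim_neg hlt).const_mul (e / Real.pi))).sub_const b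
      convert h4 using 2
      field_simp; ring
    · have h4 := ((hr q ⟨hlt, by linarith⟩).sub ((arg_lim_pos hlt).const_mul (e / Real.pi))).sub_const b
      convert h4 using 2
      ring

lemma Sol.near_s (H : Sol N y t s m1 mN h) : 
    ∃ r > 0, ∃ K > 0, ∀ z ∈ UHP, z ∈ ball (s:ℂ) r → ‖deriv h z - (1 / Real.pi : ℝ) / (z - s)‖ ≤ K := by
  obtain ⟨ρ, hρ, h1, h2⟩ := H.win
  have := H.ts
  apply H.near (ρ := min ρ (s - t)) (b := 0) (lt_min hρ (by linarith))
  · intro q hq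
    exact h1 q (Or.inr ⟨hq.1, by linarith [hq.2, min_le_left ρ (s-t)]⟩)
  · intro q hq
    rw [add_zero]
    exact h2 q ⟨by linarith [hq.1, min_le_right ρ (s-t)], hq.2⟩

lemma Sol.near_t (H : Sol N y t s m1 mN h) : 
    ∃ r > 0, ∃ K > 0, ∀ z ∈ UHP, z ∈ ball (t:ℂ) r → ‖deriv h z + (1 / Real.pi : ℝ) / (z - t)‖ ≤ K := by
  obtain ⟨ρ, hρ, h1, h2⟩ := H.win
  have := H.ts
  have h3 := H.near (p := t) (ρ := min ρ (s - t)) (b := 1) (e := -1) (lt_min hρ (by linarith)) ?_ ?_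
  · obtain ⟨r, hr, K, hK, h3⟩ := h3
    refine ⟨r, hr, K, hK, fun z hz hzb => ?_⟩
    convert h3 z hz hzb using 2
    push_cast; ring
  · intro q hq
    exact h2 q ⟨hq.1, by linarith [hq.2, min_le_right ρ (s-t)]⟩
  · intro q hq
    rw [neg_add_cancel]
    exact h1 q (Or.inl ⟨by linarith [hq.1, min_le_left ρ (s-t)], hq.2⟩)

/-- Poles of the explicit part. -/
def Mp (N : ℕ) (y : ℕ → ℝ) (t s : ℝ) (z : ℂ) : ℂ := (1 / Real.pi : ℝ) * (Q N y s / (z - s) - Q N y t / (z - t))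

def A2 (N : ℕ) (y : ℕ → ℝ) (t s : ℝ) (h : ℂ → ℂ) (z : ℂ) : ℂ := (deriv h z * Q N y z - Mp N y t s z) / I

lemma UHP_ne {z : ℂ} (hz : z ∈ UHP) (p : ℝ) : z - p ≠ 0 := by
  intro h0
  have : (z - p).im = 0 := by rw [h0]; simp
  simp at this
  exact (show 0 < z.im from hz).ne' this

lemma Sol.A2_diff (H : Sol N y t s m1 mN h) {z : ℂ} (hz : z ∈ UHP) : DifferentiableAt ℂ (A2 N y t s h) z := by
  have h1 : DifferentiableAt ℂ (deriv h) z := (H.diff.deriv isOpen_UHP).differentiableAt (isOpen_UHP.mem_nhds hz)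
  have h2 := diff_Q (N := N) (y := y) hz
  have h3 := UHP_ne hz s
  have h4 := UHP_ne hz t
  unfold A2 Mp
  fun_prop (disch := assumption)

lemma Sol.A2_lim (H : Sol N y t s m1 mN h) {p : ℝ} (hp : p ∉ Sg N y t s) :
    ∃ a : ℝ, Tendsto (A2 N y t s h) (𝓝[UHP] (p:ℂ)) (𝓝 (a:ℂ)) := by
  obtain ⟨a, ha⟩ := H.A_lim hp
  obtain ⟨b, hb⟩ := Q_odd H.sodd
  obtain ⟨c, hc⟩ := Q_odd H.todd
  simp only [Sg, Finset.mem_insert, not_or] at hp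
  have h3 : (p:ℂ) - s ≠ 0 := by rw [sub_ne_zero]; exact_mod_cast hp.2.1
  have h4 : (p:ℂ) - t ≠ 0 := by rw [sub_ne_zero]; exact_mod_cast hp.1
  refine ⟨a - (1 / Real.pi) * (b / (p - s) - c / (p - t)), ?_⟩
  have h5 : ContinuousAt (fun z => Mp N y t s z / I) p := by
    unfold Mp
    fun_prop (disch := assumption)
  have h6 := ha.sub (h5.tendsto.mono_left nhdsWithin_le_nhds)
  have h7 : Mp N y t s p / I = ((1 / Real.pi) * (b / (p - s) - c / (p - t)) : ℝ) := by
    unfold Mp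
    rw [hb, hc]
    push_cast
    have := I_ne_zero
    field_simp
  rw [h7] at h6
  push_cast at h6 ⊢
  refine h6.congr ?_
  intro z; unfold A2; ring

end
end PK

namespace PK
section
open scoped Interval
variable {N : ℕ} {y : ℕ → ℝ} {t s m1 mN : ℝ} {h : ℂ → ℂ}

lemma refl_norm_le {A : ℂ → ℂ} {φ : ℂ → ℝ} {U : Set ℂ} (hA : ∀ z ∈ UHP, DifferentiableAt ℂ A z) (hU : IsOpen U)
    (hUs : ∀ z ∈ U, (starRingEnd ℂ) z ∈ U) 
    (hlim : ∀ p : ℝ, (p:ℂ) ∈ U → ∃ a : ℝ, Tendsto A (𝓝[UHP] (p:ℂ)) (𝓝 (a:ℂ)))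
    (hφ : ContinuousOn φ U) (hφc : ∀ z ∈ U, φ ((starRingEnd ℂ) z) = φ z)
    (hb : ∀ z ∈ U, z ∈ UHP → ‖A z‖ ≤ φ z) : ∀ z ∈ U, ‖refl A z‖ ≤ φ z := by
  intro w hw
  rcases lt_trichotomy w.im 0 with h0 | h0 | h0
  · have hcw : (starRingEnd ℂ) w ∈ UHP := by simpa [UHP] using h0
    rw [refl_lower (hA _ hcw) h0, Complex.norm_conj, ← hφc w hw]
    exact hb _ (hUs w hw) hcw
  · have hwr : w = (w.re : ℂ) := Complex.ext (by simp) (by simp [h0])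
    rw [hwr] at hw ⊢
    obtain ⟨a, ha⟩ := hlim w.re hw
    rw [refl_real ha]
    have := neBot_real (w.re:ℂ) (by simp)
    have h1 : Tendsto φ (𝓝[UHP] (w.re:ℂ)) (𝓝 (φ (w.re:ℂ))) := 
      (hφ.continuousAt (hU.mem_nhds hw)).tendsto.mono_left nhdsWithin_le_nhds
    refine le_of_tendsto_of_tendsto ha.norm h1 ?_
    filter_upwards [self_mem_nhdsWithin, nhdsWithin_le_nhds (hU.mem_nhds hw)] with z hz hzU using hb z hzU hz
  · rw [refl_upper (hA _ h0) h0]; exact hb _ hw h0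

lemma removable_finite {S : Set ℂ} (hS : S.Finite) {f : ℂ → ℂ} (hf : DifferentiableOn ℂ f Sᶜ)
    (ho : ∀ σ ∈ S, (fun z => f z) =o[𝓝[≠] σ] (fun z => (z - σ)⁻¹)) :
    ∃ E : ℂ → ℂ, Differentiable ℂ E ∧ ∀ z ∉ S, E z = f z := by
  classical
  refine ⟨fun z => if z ∈ S then limUnder (𝓝[≠] z) f else f z, ?_, fun z hz => by simp [hz]⟩
  intro z
  by_cases hz : z ∈ S
  · have hT : IsOpen ((S \ {z})ᶜ) := (hS.subset sdiff_subset).isClosed.isOpen_compl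
    have hzT : z ∈ (S \ {z})ᶜ := by simp
    have hsub : (S \ {z})ᶜ \ {z} ⊆ Sᶜ := by
      intro w hw hwS
      exact hw.1 ⟨hwS, hw.2⟩
    have hconst : (fun _ : ℂ => f z) =o[𝓝[≠] z] (fun w => (w - z)⁻¹) := by
      rw [Asymptotics.isLittleO_const_left]
      right
      have : Tendsto (fun w : ℂ => w - z) (𝓝[≠] z) (𝓝[≠] 0) := by
        have h1 : Tendsto (fun w : ℂ => w - z) (𝓝 z) (𝓝 0) := by
          have : Continuous (fun w : ℂ => w - z) := by fun_prop
          simpa using this.tendsto z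
        apply tendsto_nhdsWithin_of_tendsto_nhds_of_eventually_within _ (h1.mono_left nhdsWithin_le_nhds)
        filter_upwards [self_mem_nhdsWithin] with w hw
        simpa [sub_eq_zero] using hw
      exact (tendsto_norm_inv_nhdsNE_zero_atTop).comp this
    have h1 := Complex.differentiableOn_update_limUnder_of_isLittleO (hT.mem_nhds hzT) (hf.mono hsub) ((ho z hz).sub hconst)
    have h2 := h1.differentiableAt (hT.mem_nhds hzT)
    refine h2.congr_of_eventuallyEq ?_
    filter_upwards [hT.mem_nhds hzT] with w hw
    by_cases hwz : w = z
    · subst hwz; simp [hz]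
    · have : w ∉ S := fun h => hw ⟨h, hwz⟩
      simp [this, hwz]
  · have hT : IsOpen Sᶜ := hS.isClosed.isOpen_compl
    refine (hf.differentiableAt (hT.mem_nhds hz)).congr_of_eventuallyEq ?_
    filter_upwards [hT.mem_nhds hz] with w hw
    simp only [if_neg hw]

lemma entire_poly (n : ℕ) : ∀ (E : ℂ → ℂ) (_ : Differentiable ℂ E) (C M : ℝ) 
    (_ : ∀ z, M ≤ ‖z‖ → ‖E z‖ ≤ C * ‖z‖ ^ n), ∃ p : Polynomial ℂ, p.natDegree ≤ n ∧ ∀ z, E z = p.eval z := by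
  induction n with
  | zero =>
    intro E hE C M hb
    obtain ⟨C', hC'⟩ := (isCompact_closedBall (0:ℂ) M).exists_bound_of_continuousOn hE.continuous.continuousOn
    refine ⟨Polynomial.C (E 0), by simp, fun z => ?_⟩
    simp only [Polynomial.eval_C]
    apply hE.apply_eq_apply_of_bounded
    rw [isBounded_iff_forall_norm_le]
    refine ⟨max C C', ?_⟩
    rintro _ ⟨w, rfl⟩
    rcases le_total M ‖w‖ with h1 | h1
    · have := hb w h1
      simp at this
      exact this.trans (le_max_left _ _)
    · exact (hC' w (by simpa using h1)).trans (le_max_right _ _)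
  | succ n ih =>
    intro E hE C M hb
    have hd : Differentiable ℂ (dslope E 0) := by
      rw [← differentiableOn_univ] at hE ⊢
      exact (Complex.differentiableOn_dslope univ_mem).mpr hE
    have heq : ∀ z, E z = E 0 + z * dslope E 0 z := by
      intro z
      have := sub_smul_dslope E 0 z
      simp at this
      rw [this]; ring
    obtain ⟨p, hp, hpe⟩ := ih (dslope E 0) hd (C + ‖E 0‖) (max M 1) (by
      intro z hz
      have hz1 : 1 ≤ ‖z‖ := (le_max_right _ _).trans hz
      have h1 := hb z ((le_max_left _ _).trans hz)
      have h2 : ‖z‖ * ‖dslope E 0 z‖ ≤ C * ‖z‖ ^ (n+1) + ‖E 0‖ := by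
        rw [← norm_mul, show z * dslope E 0 z = E z - E 0 by rw [heq z]; ring]
        exact (norm_sub_le _ _).trans (by linarith)
      have h3 : ‖E 0‖ ≤ ‖E 0‖ * ‖z‖ ^ (n+1) := le_mul_of_one_le_right (norm_nonneg _) (one_le_pow₀ hz1)
      have h4 : ‖z‖ * ‖dslope E 0 z‖ ≤ ‖z‖ * ((C + ‖E 0‖) * ‖z‖ ^ n) := by
        rw [pow_succ] at h2 h3
        nlinarith
      exact le_of_mul_le_mul_left h4 (by linarith))
    refine ⟨Polynomial.C (E 0) + Polynomial.X * p, ?_, fun z => ?_⟩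
    · refine (Polynomial.natDegree_add_le _ _).trans (max_le (by simp) ?_)
      exact (Polynomial.natDegree_mul_le).trans (by rw [Polynomial.natDegree_X]; omega)
    · rw [heq z, hpe]; simp

lemma real_poly {p : Polynomial ℂ} (hp : ∀ z ∈ UHP, p.eval ((starRingEnd ℂ) z) = (starRingEnd ℂ) (p.eval z)) :
    ∃ q : Polynomial ℝ, q.natDegree = p.natDegree ∧ ∀ z : ℂ, p.eval z = q.aeval z := by
  have hmap : p.map (starRingEnd ℂ) = p := by
    apply Polynomial.eq_of_infinite_eval_eq
    refine Set.Infinite.mono (s := (fun r : ℝ => (r:ℂ) - I) '' univ) ?_ ?_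
    · rintro _ ⟨r, -, rfl⟩
      have h1 := hp (r + I) (by simp [UHP])
      have h2 : (starRingEnd ℂ) ((r:ℂ) + I) = r - I := by simp; ring
      rw [h2] at h1
      show Polynomial.eval ((r:ℂ) - I) _ = Polynomial.eval ((r:ℂ) - I) _
      rw [h1, ← h2, Polynomial.eval_map, Polynomial.eval₂_hom]
    · apply Set.Infinite.image
      · intro a _ b _ hab
        simpa using hab
      · exact infinite_univ
  have hl : p ∈ Polynomial.lifts ofRealHom := by
    rw [Polynomial.lifts_iff_coeff_lifts]
    intro n
    have : (starRingEnd ℂ) (p.coeff n) = p.coeff n := by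
      conv_rhs => rw [← hmap]
      simp
    refine ⟨(p.coeff n).re, ?_⟩
    simpa using (Complex.conj_eq_iff_re.mp this)
  rw [Polynomial.mem_lifts] at hl
  obtain ⟨q, hq⟩ := hl
  refine ⟨q, ?_, fun z => ?_⟩
  · rw [← hq, Polynomial.natDegree_map_eq_of_injective ofRealHom.injective]
  · rw [← hq, Polynomial.eval_map, Polynomial.aeval_def]; rfl

end
end PK

namespace PK
section
open scoped Interval
variable {N : ℕ} {y : ℕ → ℝ} {t s m1 mN : ℝ} {h : ℂ → ℂ}

lemma one_bigO_sqrt (p : ℝ) : (fun _ : ℂ => (1:ℝ)) =O[𝓝[UHP] (p:ℂ)] (fun z : ℂ => (√‖z - p‖)⁻¹) := by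
  apply Asymptotics.IsBigO.of_bound 1
  filter_upwards [self_mem_nhdsWithin, nhdsWithin_le_nhds (ball_mem_nhds (p:ℂ) one_pos)] with z hz hzb
  rw [mem_ball, dist_eq_norm] at hzb
  have h0 : 0 < √‖z - p‖ := Real.sqrt_pos.mpr (norm_pos_iff.mpr (UHP_ne hz p))
  have h1 : √‖z - p‖ ≤ 1 := Real.sqrt_le_one.mpr hzb.le
  rw [one_mul, norm_one, Real.norm_of_nonneg (by positivity)]
  exact (one_le_inv₀ h0).mpr h1

lemma inv_bigO {p q : ℝ} (hpq : p ≠ q) (c : ℂ) : (fun z : ℂ => c / (z - q)) =O[𝓝[UHP] (p:ℂ)] (fun _ => (1:ℝ)) := by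
  have h3 : (p:ℂ) - q ≠ 0 := by rw [sub_ne_zero]; exact_mod_cast hpq
  have h5 : ContinuousAt (fun z : ℂ => c / (z - q)) p := by
    fun_prop (disch := assumption)
  exact (h5.tendsto.mono_left nhdsWithin_le_nhds).isBigO_one ℝ

lemma Qdiff_bigO {p : ℝ} (hp : ∀ k ∈ Finset.Icc 1 (2*N), p ≠ y k) :
    (fun z : ℂ => (Q N y z - Q N y p) / (z - p)) =O[𝓝[UHP] (p:ℂ)] (fun _ => (1:ℝ)) := by
  obtain ⟨C, hC, r, hr, hb⟩ := Q_lip hp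
  apply Asymptotics.IsBigO.of_bound C
  filter_upwards [self_mem_nhdsWithin, nhdsWithin_le_nhds (ball_mem_nhds (p:ℂ) hr)] with z hz hzb
  have h0 : 0 < ‖z - p‖ := norm_pos_iff.mpr (UHP_ne hz p)
  rw [norm_div, div_le_iff₀ h0]
  simpa using hb z hz hzb

lemma Sol.A2_near (H : Sol N y t s m1 mN h) {σ : ℝ} (hσ : σ ∈ Sg N y t s) :
    (A2 N y t s h) =O[𝓝[UHP] (σ:ℂ)] (fun z : ℂ => (√‖z - σ‖)⁻¹) := by
  have hts : t ≠ s := H.ts.ne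
  have hQ1 : ∀ p : ℝ, (Q N y) =O[𝓝[UHP] (p:ℂ)] (fun _ => (1:ℝ)) := fun p => (tendsto_Q p).isBigO_one ℝ
  have hdiv : ∀ {l : Filter ℂ} {f : ℂ → ℂ} {g : ℂ → ℝ} (c : ℂ), f =O[l] g → (fun z => f z / c) =O[l] g := by
    intro l f g c hf
    simpa [div_eq_inv_mul] using hf.const_mul_left c⁻¹
  by_cases h1 : σ = s
  · subst h1
    refine Asymptotics.IsBigO.trans ?_ (one_bigO_sqrt σ)
    obtain ⟨r, hr, K, hK, hb⟩ := H.near_s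
    have hd : (fun z => deriv h z - (1 / Real.pi : ℝ) / (z - σ)) =O[𝓝[UHP] (σ:ℂ)] (fun _ => (1:ℝ)) := by
      apply Asymptotics.IsBigO.of_bound K
      filter_upwards [self_mem_nhdsWithin, nhdsWithin_le_nhds (ball_mem_nhds (σ:ℂ) hr)] with z hz hzb
      simpa using hb z hz hzb
    have e1 : (fun z => (deriv h z - (1 / Real.pi : ℝ) / (z - σ)) * Q N y z) =O[𝓝[UHP] (σ:ℂ)] (fun _ => (1:ℝ)) := by
      simpa using hd.mul (hQ1 σ)
    have e2 := (Qdiff_bigO H.sY).const_mul_left ((1 / Real.pi : ℝ) : ℂ)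
    have e3 := (inv_bigO (p := σ) hts.symm (Q N y t)).const_mul_left ((1 / Real.pi : ℝ) : ℂ)
    refine (hdiv I ((e1.add e2).add e3)).congr' ?_ (EventuallyEq.refl _ _)
    filter_upwards [] with z
    unfold A2 Mp
    ring
  by_cases h2 : σ = t
  · subst h2
    refine Asymptotics.IsBigO.trans ?_ (one_bigO_sqrt σ)
    obtain ⟨r, hr, K, hK, hb⟩ := H.near_t
    have hd : (fun z => deriv h z + (1 / Real.pi : ℝ) / (z - σ)) =O[𝓝[UHP] (σ:ℂ)] (fun _ => (1:ℝ)) := by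
      apply Asymptotics.IsBigO.of_bound K
      filter_upwards [self_mem_nhdsWithin, nhdsWithin_le_nhds (ball_mem_nhds (σ:ℂ) hr)] with z hz hzb
      simpa using hb z hz hzb
    have e1 : (fun z => (deriv h z + (1 / Real.pi : ℝ) / (z - σ)) * Q N y z) =O[𝓝[UHP] (σ:ℂ)] (fun _ => (1:ℝ)) := by
      simpa using hd.mul (hQ1 σ)
    have e2 := (Qdiff_bigO H.tY).const_mul_left ((1 / Real.pi : ℝ) : ℂ)
    have e3 := (inv_bigO (p := σ) hts (Q N y s)).const_mul_left ((1 / Real.pi : ℝ) : ℂ)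
    refine (hdiv I ((e1.sub e2).sub e3)).congr' ?_ (EventuallyEq.refl _ _)
    filter_upwards [] with z
    unfold A2 Mp
    ring
  · have hσ' := hσ
    simp only [Sg, Finset.mem_insert, h1, h2, false_or, Finset.mem_image] at hσ'
    obtain ⟨k, hk, hkσ⟩ := hσ'
    obtain ⟨K, hK, hb⟩ := H.bound
    obtain ⟨C, hC, hQ⟩ := norm_Q_near (y := y) hk
    rw [hkσ] at hQ
    obtain ⟨R, hR, hsep⟩ := exists_sep (S := (Sg N y t s).erase σ) (p := σ) (by simp)
    have e1 : (fun z => deriv h z * Q N y z) =O[𝓝[UHP] (σ:ℂ)] (fun z : ℂ => (√‖z - σ‖)⁻¹) := by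
      apply Asymptotics.IsBigO.of_bound (K * C)
      filter_upwards [self_mem_nhdsWithin, nhdsWithin_le_nhds (ball_mem_nhds (σ:ℂ) one_pos),
        nhdsWithin_le_nhds (ball_mem_nhds (σ:ℂ) (half_pos hR))] with z hz hz1 hzR
      have h0 : 0 < ‖z - σ‖ := norm_pos_iff.mpr (UHP_ne hz σ)
      rw [mem_ball, dist_eq_norm] at hzR
      have a1 := hb z hz _ h0 (by
        intro τ hτ
        by_cases hτσ : τ = σ
        · rw [hτσ]
        have := hsep τ (Finset.mem_erase.mpr ⟨hτσ, hτ⟩)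
        have h5 : |τ - σ| ≤ ‖z - σ‖ + ‖z - τ‖ := by
          rw [← Real.norm_eq_abs, ← Complex.norm_real]
          push_cast
          rw [show (τ:ℂ) - σ = (z - σ) - (z - τ) by ring]
          exact norm_sub_le _ _
        linarith)
      have a2 := hQ z hz1
      rw [norm_mul, norm_inv, Real.norm_of_nonneg (Real.sqrt_nonneg _)]
      calc _ ≤ K / ‖z - σ‖ * (C * √‖z - σ‖) := by gcongr
        _ = K * C * (√‖z - σ‖)⁻¹ := by
          have h6 : 0 < √‖z - σ‖ := Real.sqrt_pos.mpr h0
          have h7 := Real.mul_self_sqrt h0.le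
          rw [← h7]
          field_simp
          rw [Real.sqrt_sq h6.le]
    have e2 := ((inv_bigO (p := σ) h1 (Q N y s)).const_mul_left ((1 / Real.pi : ℝ) : ℂ)).trans (one_bigO_sqrt σ)
    have e3 := ((inv_bigO (p := σ) h2 (Q N y t)).const_mul_left ((1 / Real.pi : ℝ) : ℂ)).trans (one_bigO_sqrt σ)
    refine (hdiv I ((e1.sub e2).add e3)).congr' ?_ (EventuallyEq.refl _ _)
    filter_upwards [] with z
    unfold A2 Mp
    ring

/-- complexified singular set -/
def Sc (N : ℕ) (y : ℕ → ℝ) (t s : ℝ) : Set ℂ := (fun x : ℝ => (x:ℂ)) '' (Sg N y t s : Set ℝ)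

lemma Sc_finite : (Sc N y t s).Finite := (Finset.finite_toSet _).image _

lemma mem_Sc {p : ℝ} : (p:ℂ) ∈ Sc N y t s ↔ p ∈ Sg N y t s := by
  simp [Sc]

lemma Sc_conj {z : ℂ} (hz : z ∉ Sc N y t s) : (starRingEnd ℂ) z ∉ Sc N y t s := by
  rintro ⟨x, hx, hxz⟩
  apply hz
  refine ⟨x, hx, ?_⟩
  have := congrArg (starRingEnd ℂ) hxz
  simpa using this

lemma Sol.W_diff (H : Sol N y t s m1 mN h) : DifferentiableOn ℂ (refl (A2 N y t s h)) (Sc N y t s)ᶜ := by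
  apply refl_diff Sc_finite.isClosed.isOpen_compl
  · intro z _ hz
    exact H.A2_diff hz
  · intro z hz
    exact Sc_conj hz
  · intro p hp
    exact H.A2_lim (fun h => hp (mem_Sc.mpr h))

lemma Sol.W_near (H : Sol N y t s m1 mN h) {σ : ℂ} (hσ : σ ∈ Sc N y t s) :
    (refl (A2 N y t s h)) =o[𝓝[≠] σ] (fun z => (z - σ)⁻¹) := by
  obtain ⟨σ, hσ, rfl⟩ := hσ
  simp only [SetLike.mem_coe] at hσ
  have hO := H.A2_near hσ
  obtain ⟨C, hC⟩ := hO.bound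
  rw [eventually_nhdsWithin_iff, Metric.eventually_nhds_iff_ball] at hC
  obtain ⟨r, hr, hC⟩ := hC
  obtain ⟨R, hR, hsep⟩ := exists_sep (S := (Sg N y t s).erase σ) (p := σ) (by simp)
  set U : Set ℂ := ball (σ:ℂ) (min r R) \ {(σ:ℂ)} with hU
  have hUo : IsOpen U := isOpen_ball.sdiff isClosed_singleton
  have hconjn : ∀ z : ℂ, ‖(starRingEnd ℂ) z - σ‖ = ‖z - σ‖ := by
    intro z
    rw [← Complex.norm_conj]; simp
  have hb := refl_norm_le (A := A2 N y t s h) (φ := fun z : ℂ => C * (√‖z - σ‖)⁻¹) (U := U) (fun z hz => H.A2_diff hz) hUo ?_ ?_ ?_ ?_ ?_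
  · have h1 : (refl (A2 N y t s h)) =O[𝓝[≠] (σ:ℂ)] (fun z : ℂ => (√‖z - σ‖)⁻¹) := by
      apply Asymptotics.IsBigO.of_bound C
      filter_upwards [self_mem_nhdsWithin, nhdsWithin_le_nhds (ball_mem_nhds (σ:ℂ) (lt_min hr hR))] with z hz hzb
      have := hb z ⟨hzb, hz⟩
      rwa [norm_inv, Real.norm_of_nonneg (Real.sqrt_nonneg _)]
    refine h1.trans_isLittleO ?_
    rw [Asymptotics.isLittleO_iff]
    intro c hc
    have h2 : Tendsto (fun z : ℂ => √‖z - σ‖) (𝓝[≠] (σ:ℂ)) (𝓝 0) := by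
      have : Continuous (fun z : ℂ => √‖z - σ‖) := by fun_prop
      simpa using (this.tendsto (σ:ℂ)).mono_left nhdsWithin_le_nhds
    filter_upwards [h2.eventually_lt_const hc, self_mem_nhdsWithin] with z hz hz2
    have h0 : 0 < ‖z - σ‖ := norm_pos_iff.mpr (sub_ne_zero.mpr hz2)
    have h6 : 0 < √‖z - σ‖ := Real.sqrt_pos.mpr h0
    rw [norm_inv, norm_inv, Real.norm_of_nonneg h6.le]
    have h7 := Real.mul_self_sqrt h0.le
    rw [← div_eq_mul_inv, le_div_iff₀ h0, inv_mul_le_iff₀ h6]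
    nlinarith
  · rintro z ⟨hz, hz2⟩
    refine ⟨?_, ?_⟩
    · rw [mem_ball, dist_eq_norm, hconjn, ← dist_eq_norm]; exact hz
    · intro h0
      apply hz2
      have := congrArg (starRingEnd ℂ) (mem_singleton_iff.mp h0)
      simpa using this
  · rintro p ⟨hp, hp2⟩
    apply H.A2_lim
    intro hpS
    have hpσ : p ≠ σ := fun h0 => hp2 (by simp [h0])
    have := hsep p (Finset.mem_erase.mpr ⟨hpσ, hpS⟩)
    rw [mem_ball, dist_eq_norm, ← ofReal_sub, Complex.norm_real, Real.norm_eq_abs] at hp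
    linarith [min_le_right r R]
  · intro z hz
    have h0 : 0 < ‖z - σ‖ := norm_pos_iff.mpr (sub_ne_zero.mpr hz.2)
    have h1 : √‖z - σ‖ ≠ 0 := (Real.sqrt_pos.mpr h0).ne'
    apply ContinuousAt.continuousWithinAt
    fun_prop (disch := assumption)
  · intro z _
    simp only [hconjn]
  · intro z hz hzU
    have := hC z (ball_subset_ball (min_le_left _ _) hz.1) hzU
    rwa [norm_inv, Real.norm_of_nonneg (Real.sqrt_nonneg _)] at this

lemma Sol.A2_growth (H : Sol N y t s m1 mN h) (hN : 1 ≤ N) : ∃ C M : ℝ, 0 < M ∧ (∀ σ ∈ Sg N y t s, |σ| < M) ∧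
    ∀ z ∈ UHP, M < ‖z‖ → ‖A2 N y t s h z‖ ≤ C * ‖z‖ ^ (N-1) := by
  obtain ⟨K, hK, hb⟩ := H.bound
  obtain ⟨M0, hM0, hM⟩ : ∃ M0 > 0, ∀ σ ∈ Sg N y t s, |σ| ≤ M0 := by
    obtain ⟨M0, h⟩ := ((Sg N y t s).finite_toSet.isBounded).exists_norm_le
    exact ⟨|M0| + 1, by positivity, fun σ hσ => (h σ (by simpa using hσ)).trans (by linarith [le_abs_self M0])⟩
  set B := (1 / Real.pi) * (‖Q N y s‖ + ‖Q N y t‖) with hB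
  have hB0 : 0 ≤ B := by have := Real.pi_pos; positivity
  refine ⟨2 * K * 2 ^ N + B, 2 * M0 + 2, by linarith, fun σ hσ => by linarith [hM σ hσ], fun z hz hzM => ?_⟩
  have hd : ∀ σ ∈ Sg N y t s, ‖z‖ / 2 ≤ ‖z - σ‖ := by
    intro σ hσ
    have h1 := norm_sub_norm_le z (σ:ℂ)
    rw [Complex.norm_real, Real.norm_eq_abs] at h1
    linarith [hM σ hσ]
  have hz0 : 0 < ‖z‖ := by linarith
  have h1 := hb z hz (‖z‖/2) (by linarith) hd
  have h2 : ‖Q N y z‖ ≤ (2 * ‖z‖) ^ N := by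
    apply norm_Q_le _ (by linarith)
    intro k hk
    have h3 : y k ∈ Sg N y t s := by
      simp only [Sg, Finset.mem_insert, Finset.mem_image]
      exact Or.inr (Or.inr ⟨k, hk, rfl⟩)
    have := norm_sub_le z (y k : ℂ)
    rw [Complex.norm_real, Real.norm_eq_abs] at this
    linarith [hM _ h3]
  have h3 : ‖Mp N y t s z‖ ≤ B := by
    unfold Mp
    have hpi := Real.pi_pos
    rw [norm_mul, Complex.norm_real, Real.norm_of_nonneg (by positivity), hB]
    gcongr
    refine (norm_sub_le _ _).trans ?_
    have hs : 1 ≤ ‖z - s‖ := by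
      have := hd s (by simp [Sg]); linarith
    have ht : 1 ≤ ‖z - t‖ := by
      have := hd t (by simp [Sg]); linarith
    rw [norm_div, norm_div]
    gcongr
    · exact div_le_self (norm_nonneg _) hs
    · exact div_le_self (norm_nonneg _) ht
  have h4 : 1 ≤ ‖z‖ ^ (N-1) := one_le_pow₀ (by linarith)
  unfold A2
  rw [norm_div, Complex.norm_I, div_one]
  refine (norm_sub_le _ _).trans ?_
  rw [norm_mul]
  calc _ ≤ K / (‖z‖/2) * (2 * ‖z‖) ^ N + B := by gcongr
    _ = 2 * K * 2 ^ N * ‖z‖ ^ (N-1) + B := by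
      obtain ⟨n, rfl⟩ : ∃ n, N = n + 1 := ⟨N - 1, by omega⟩
      rw [Nat.add_sub_cancel, mul_pow, pow_succ ‖z‖]
      field_simp
    _ ≤ _ := by rw [add_mul]; nlinarith

lemma Sol.poly0 (H : Sol N y t s m1 mN h) (hN : 1 ≤ N) : ∃ p : Polynomial ℝ, p.natDegree ≤ N - 1 ∧
    ∀ z ∈ UHP, deriv h z * Q N y z = Mp N y t s z + I * p.aeval z := by
  obtain ⟨E, hE, hEW⟩ := removable_finite Sc_finite H.W_diff (fun σ hσ => H.W_near hσ)
  obtain ⟨C, M, hM0, hM, hb⟩ := H.A2_growth hN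
  have hU : IsOpen {z : ℂ | M < ‖z‖} := isOpen_lt continuous_const continuous_norm
  have hnS : ∀ z : ℂ, M < ‖z‖ → z ∉ Sc N y t s := by
    rintro z hz ⟨x, hx, rfl⟩
    have := hM x (by simpa using hx)
    simp at hz
    linarith
  have hW : ∀ z ∈ {z : ℂ | M < ‖z‖}, ‖refl (A2 N y t s h) z‖ ≤ C * ‖z‖ ^ (N-1) := by
    apply refl_norm_le (fun z hz => H.A2_diff hz) hU
    · intro z hz; simpa using hz
    · intro p hp
      exact H.A2_lim (fun h => hnS p hp (mem_Sc.mpr h))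
    · fun_prop
    · intro z _; simp
    · intro z hz hzU; exact hb z hzU hz
  obtain ⟨p, hp, hpE⟩ := entire_poly (N-1) E hE C (M+1) (by
    intro z hz
    have hz' : M < ‖z‖ := by linarith
    rw [hEW z (hnS z hz')]
    exact hW z hz')
  have hUS : ∀ z : ℂ, z.im ≠ 0 → z ∉ Sc N y t s := by
    rintro z hz ⟨x, hx, rfl⟩
    simp at hz
  obtain ⟨q, hq, hpq⟩ := real_poly (p := p) (by
    intro z hz
    have hz0 : 0 < z.im := hz
    rw [← hpE, ← hpE, hEW _ (hUS _ hz0.ne'), hEW _ (hUS _ (by simpa using hz0.ne'))]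
    exact refl_conj (fun z hz => (H.A2_diff hz).differentiableWithinAt) hz0.ne')
  refine ⟨q, hq ▸ hp, fun z hz => ?_⟩
  have hz0 : 0 < z.im := hz
  rw [← hpq, ← hpE, hEW _ (hUS _ hz0.ne'), refl_upper (H.A2_diff hz) hz]
  unfold A2
  have := I_ne_zero
  field_simp
  ring

end
end PK

namespace PK
section
open scoped Interval
variable {N : ℕ} {y : ℕ → ℝ} {t s m1 mN : ℝ} {h : ℂ → ℂ}

lemma log_growth {u u' : ℝ → ℝ} {C a : ℝ} (hu : ∀ v > 0, HasDerivAt u (u' v) v) (hb : ∀ v > 0, |u v| ≤ C)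
    (ha : Tendsto (fun v => v * u' v) atTop (𝓝 a)) : a ≤ 0 := by
  by_contra! hpos
  have h1 : ∀ᶠ v in atTop, a / 2 < v * u' v := ha.eventually_const_lt (by linarith)
  obtain ⟨Y, hY⟩ := (h1.and (eventually_gt_atTop 0)).exists_forall_of_atTop
  have hY0 : 0 < Y := (hY Y le_rfl).2
  have hmono : MonotoneOn (fun v => u v - a / 2 * Real.log v) (Ici Y) := by
    have hd : ∀ v ∈ Ici Y, HasDerivAt (fun v => u v - a / 2 * Real.log v) (u' v - a / 2 * v⁻¹) v := by
      intro v hv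
      have hv0 : 0 < v := lt_of_lt_of_le hY0 hv
      exact (hu v hv0).sub ((Real.hasDerivAt_log hv0.ne').const_mul _)
    apply monotoneOn_of_deriv_nonneg (convex_Ici Y)
    · exact fun v hv => (hd v hv).continuousAt.continuousWithinAt
    · intro v hv
      rw [interior_Ici] at hv
      exact (hd v (mem_Ici.mpr (le_of_lt hv))).differentiableAt.differentiableWithinAt
    · intro v hv
      rw [interior_Ici] at hv
      rw [(hd v (mem_Ici.mpr (le_of_lt hv))).deriv]
      have h2 := hY v (le_of_lt hv)
      have hv0 := h2.2
      rw [sub_nonneg, ← div_eq_mul_inv, div_le_iff₀ hv0]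
      linarith
  have h3 : Tendsto (fun v => a / 2 * Real.log v) atTop atTop := Real.tendsto_log_atTop.const_mul_atTop (by linarith)
  obtain ⟨v, hv1, hv2⟩ := ((h3.eventually_gt_atTop (2 * C + a / 2 * Real.log Y)).and (eventually_ge_atTop Y)).exists
  have h4 := hmono self_mem_Ici hv2 hv2
  simp only at h4
  have h5 := hb v (lt_of_lt_of_le hY0 hv2)
  have h6 := hb Y hY0
  rw [abs_le] at h5 h6
  linarith

lemma sq_pos_mul {r : ℝ} (hr : 0 < r) (z : ℂ) : sq (r * z) = (√r : ℝ) * sq z := by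
  have h1 : sq (r:ℂ) = (√r : ℝ) := sq_ofReal_nonneg hr.le
  rw [← h1]
  unfold sq
  by_cases hz : z = 0
  · simp [hz]
  rw [Complex.cpow_def_of_ne_zero (mul_ne_zero (by exact_mod_cast hr.ne') hz), Complex.log_ofReal_mul hr hz,
    add_mul, Complex.exp_add, ← Complex.cpow_def_of_ne_zero hz, Complex.ofReal_log hr.le, ← Complex.cpow_def_of_ne_zero (by exact_mod_cast hr.ne')]

lemma Q_asymp : Tendsto (fun v : ℝ => Q N y (v * I) / (v:ℂ) ^ N) atTop (𝓝 (I ^ N)) := by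
  have hI : DifferentiableAt ℂ sq I := diff_sq (by simp [UHP])
  have h1 : ∀ k, Tendsto (fun v : ℝ => sq (I - (y k : ℂ) / v)) atTop (𝓝 (sq I)) := by
    intro k
    have h2 : Tendsto (fun v : ℝ => I - (y k : ℂ) / v) atTop (𝓝 I) := by
      have h3 : Tendsto (fun v : ℝ => ((y k / v : ℝ) : ℂ)) atTop (𝓝 ((0:ℝ):ℂ)) :=
        (continuous_ofReal.tendsto 0).comp (tendsto_const_nhds.div_atTop tendsto_id)
      simpa using h3.const_sub I
    exact hI.continuousAt.tendsto.comp h2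
  have h2 : Tendsto (fun v : ℝ => ∏ k ∈ Finset.Icc 1 (2*N), sq (I - (y k : ℂ) / v)) atTop (𝓝 (∏ k ∈ Finset.Icc 1 (2*N), sq I)) :=
    tendsto_finsetProd _ (fun k _ => h1 k)
  have h3 : ∏ k ∈ Finset.Icc 1 (2*N), sq I = I ^ N := by
    simp [pow_mul, sq_sq]
  rw [h3] at h2
  refine h2.congr' ?_
  filter_upwards [eventually_gt_atTop 0] with v hv
  have hv' : (v:ℂ) ≠ 0 := by exact_mod_cast hv.ne'
  rw [eq_div_iff (pow_ne_zero _ hv')]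
  have h4 : (v:ℂ)^N = ∏ k ∈ Finset.Icc 1 (2*N), ((√v : ℝ):ℂ) := by
    simp only [Finset.prod_const, Nat.card_Icc, Nat.add_sub_cancel, pow_mul]
    rw [← ofReal_pow √v 2, Real.sq_sqrt hv.le]
  rw [h4, ← Finset.prod_mul_distrib, Q]
  apply Finset.prod_congr rfl
  intro k _
  rw [mul_comm, ← sq_pos_mul hv]
  congr 1
  field_simp

lemma poly_asymp (p : Polynomial ℝ) {n : ℕ} (hp : p.natDegree ≤ n) :
    Tendsto (fun v : ℝ => p.aeval ((v:ℂ) * I) / (v:ℂ)^n) atTop (𝓝 (p.coeff n * I ^ n)) := by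
  have h1 : ∀ j ∈ Finset.range (n+1), Tendsto (fun v : ℝ => (p.coeff j : ℂ) * ((v:ℂ) * I)^j / (v:ℂ)^n) atTop
      (𝓝 (if j = n then (p.coeff n : ℂ) * I ^ n else 0)) := by
    intro j hj
    by_cases hjn : j = n
    · subst hjn
      rw [if_pos rfl]
      refine tendsto_const_nhds.congr' ?_
      filter_upwards [eventually_gt_atTop 0] with v hv
      have hv' : (v:ℂ) ≠ 0 := by exact_mod_cast hv.ne'
      rw [mul_pow]
      field_simp
    · rw [if_neg hjn]
      have hlt : j < n := by have := Finset.mem_range.mp hj; omega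
      have h3 : Tendsto (fun v : ℝ => ((1 / v ^ (n - j) : ℝ) : ℂ)) atTop (𝓝 ((0:ℝ):ℂ)) :=
        (continuous_ofReal.tendsto 0).comp (tendsto_const_nhds.div_atTop (tendsto_pow_atTop (by omega)))
      have h4 := h3.const_mul ((p.coeff j : ℂ) * I ^ j)
      rw [ofReal_zero, mul_zero] at h4
      refine h4.congr' ?_
      filter_upwards [eventually_gt_atTop 0] with v hv
      have hv' : (v:ℂ) ≠ 0 := by exact_mod_cast hv.ne'
      have h5 : (v:ℂ)^n = (v:ℂ)^(n-j) * (v:ℂ)^j := by rw [← pow_add]; congr 1; omega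
      push_cast
      rw [h5, mul_pow]
      field_simp
  have h2 := tendsto_finsetSum _ h1
  rw [Finset.sum_ite_eq' (Finset.range (n+1)) n, if_pos (by simp)] at h2
  refine h2.congr ?_
  intro v
  rw [Polynomial.aeval_eq_sum_range' (Nat.lt_succ_of_le hp), Finset.sum_div]
  apply Finset.sum_congr rfl
  intro j _
  rw [Complex.real_smul]

lemma Sol.poly (H : Sol N y t s m1 mN h) (hN : 2 ≤ N) : ∃ p ∈ Polynomial.degreeLT ℝ (N-1),
    ∀ z ∈ UHP, deriv h z * Q N y z = Mp N y t s z + I * p.aeval z := by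
  obtain ⟨p, hp, hpz⟩ := H.poly0 (by omega)
  refine ⟨p, ?_, hpz⟩
  suffices hc : p.coeff (N-1) = 0 by
    rw [Polynomial.mem_degreeLT]
    rw [Polynomial.degree_lt_iff_coeff_zero]
    intro m hm
    rcases Nat.eq_or_lt_of_le hm with h | h
    · rw [← h]; exact hc
    · exact Polynomial.coeff_eq_zero_of_natDegree_lt (by omega)
  set a := p.coeff (N-1) with ha
  -- asymptotics
  have hM : Tendsto (fun v : ℝ => (v:ℂ) * Mp N y t s (v * I) / (v:ℂ)^N) atTop (𝓝 0) := by
    have h1 : ∀ x : ℝ, Tendsto (fun v : ℝ => (v:ℂ) / (v * I - x)) atTop (𝓝 (1 / I)) := by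
      intro x
      have h3 : Tendsto (fun v : ℝ => ((x / v : ℝ) : ℂ)) atTop (𝓝 ((0:ℝ):ℂ)) :=
        (continuous_ofReal.tendsto 0).comp (tendsto_const_nhds.div_atTop tendsto_id)
      have h4 := (h3.const_sub I).inv₀ (by simp)
      simp only [ofReal_zero, sub_zero] at h4
      rw [one_div]
      refine h4.congr' ?_
      filter_upwards [eventually_gt_atTop 0] with v hv
      have hv' : (v:ℂ) ≠ 0 := by exact_mod_cast hv.ne'
      have hne : (v:ℂ) * I - x ≠ 0 := UHP_ne (by simpa [UHP] using hv) x
      push_cast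
      rw [inv_eq_iff_eq_inv, inv_div]
      field_simp
    have h2 := (((h1 s).const_mul (Q N y s)).sub ((h1 t).const_mul (Q N y t))).const_mul ((1 / Real.pi : ℝ) : ℂ)
    have h3 : Tendsto (fun v : ℝ => ((1 / v ^ N : ℝ) : ℂ)) atTop (𝓝 ((0:ℝ):ℂ)) :=
      (continuous_ofReal.tendsto 0).comp (tendsto_const_nhds.div_atTop (tendsto_pow_atTop (by omega)))
    have h4 := h2.mul h3
    rw [ofReal_zero, mul_zero] at h4
    refine h4.congr ?_
    intro v
    unfold Mp
    push_cast
    ring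
  have hI : I ^ N ≠ 0 := pow_ne_zero _ I_ne_zero
  have hlim : Tendsto (fun v : ℝ => (v:ℂ) * deriv h (v * I)) atTop (𝓝 (a:ℂ)) := by
    have h1 := (hM.add ((poly_asymp p hp).const_mul I)).div (Q_asymp (N := N) (y := y)) hI
    have h2 : (0 + I * ((p.coeff (N-1) : ℂ) * I ^ (N-1))) / I ^ N = (a:ℂ) := by
      obtain ⟨n, rfl⟩ : ∃ n, N = n + 1 := ⟨N - 1, by omega⟩
      rw [Nat.add_sub_cancel] at *
      rw [pow_succ]
      have := I_ne_zero
      field_simp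
      rw [zero_add, ha]; ring
    rw [h2] at h1
    refine h1.congr' ?_
    filter_upwards [eventually_gt_atTop 0] with v hv
    have hz : (v:ℂ) * I ∈ UHP := by simpa [UHP] using hv
    have hv' : (v:ℂ) ≠ 0 := by exact_mod_cast hv.ne'
    have h3 := hpz _ hz
    have h4 : Q N y (v * I) ≠ 0 := Q_ne_zero_UHP hz
    have h5 : (v:ℂ)^N = (v:ℂ)^(N-1) * v := by rw [← pow_succ]; congr 1; omega
    simp only [Pi.div_apply]
    rw [eq_comm, eq_div_iff (div_ne_zero h4 (pow_ne_zero _ hv'))]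
    rw [show (v:ℂ) * deriv h (v * I) * (Q N y (v * I) / (v:ℂ)^N) = v * (deriv h (v * I) * Q N y (v * I)) / (v:ℂ)^N by ring, h3, h5]
    field_simp
  obtain ⟨C, hC0, hC⟩ := H.bdd
  have hder : ∀ v : ℝ, v > 0 → HasDerivAt (fun v : ℝ => (h (v * I)).im) (deriv h (v * I)).re v := by
    intro v hv
    have h1 := hasDeriv_vert H.diff 0 v (by simpa using hv)
    simp only [zero_add] at h1
    have h2 := Complex.imCLM.hasFDerivAt.comp_hasDerivAt v h1
    have h3 : imCLM (I * deriv h (v * I)) = (deriv h (v * I)).re := by simp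
    rw [h3] at h2
    exact h2
  have hre : Tendsto (fun v : ℝ => v * (deriv h (v * I)).re) atTop (𝓝 a) := by
    have := (Complex.continuous_re.tendsto _).comp hlim
    simp only [ofReal_re] at this
    refine this.congr ?_
    intro v; simp
  have hbb : ∀ v : ℝ, v > 0 → |(h (v * I)).im| ≤ C := fun v hv => hC _ (by simpa [UHP] using hv)
  have l1 := log_growth hder hbb hre
  have l2 := log_growth (u := fun v => -(h (v * I)).im) (u' := fun v => -(deriv h (v * I)).re) (C := C) (a := -a)
    (fun v hv => (hder v hv).neg) (fun v hv => by rw [abs_neg]; exact hbb v hv) (by simpa using hre.neg)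
  linarith

end
end PK

namespace PK
section
open scoped Interval
open MeasureTheory
variable {N : ℕ} {y : ℕ → ℝ} {t s m1 mN : ℝ} {h : ℂ → ℂ}

lemma int_sq (c a b : ℝ) : IntervalIntegrable (fun x : ℝ => ‖sq ((x:ℂ) - c)‖⁻¹) volume a b := by
  have h1 := (intervalIntegral.intervalIntegrable_cpow' (r := (-(1/2) : ℂ)) (a := a - c) (b := b - c) (by norm_num)).norm
  have h2 := h1.comp_sub_right c
  simp only [sub_add_cancel] at h2
  refine h2.congr ?_
  intro x _
  simp only [sq]
  rw [Complex.cpow_neg, norm_inv]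
  push_cast; rfl

lemma int_Q (hy : ∀ i j : ℕ, 1 ≤ i → i < j → j ≤ 2 * N → y i < y j) (a b : ℝ) :
    IntervalIntegrable (fun x : ℝ => ‖Q N y x‖⁻¹) volume a b := by
  have hinj : ∀ i ∈ Finset.Icc 1 (2*N), ∀ j ∈ Finset.Icc 1 (2*N), i ≠ j → y i ≠ y j := by
    intro i hi j hj hij
    rw [Finset.mem_Icc] at hi hj
    rcases lt_or_gt_of_ne hij with h | h
    · exact (hy i j hi.1 h hj.2).ne
    · exact (hy j i hj.1 h hi.2).ne'
  obtain ⟨δ, hδ, hsep⟩ : ∃ δ > 0, ∀ i ∈ Finset.Icc 1 (2*N), ∀ j ∈ Finset.Icc 1 (2*N), i ≠ j → 2 * δ ≤ |y i - y j| := by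
    have h1 : ∀ i ∈ Finset.Icc 1 (2*N), ∃ R > 0, ∀ j ∈ Finset.Icc 1 (2*N), i ≠ j → R ≤ |y i - y j| := by
      intro i hi
      obtain ⟨R, hR, h2⟩ := exists_sep (S := ((Finset.Icc 1 (2*N)).erase i).image y) (p := y i) (by
        intro h
        obtain ⟨j, hj, hji⟩ := Finset.mem_image.mp h
        rw [Finset.mem_erase] at hj
        exact hinj j hj.2 i hi hj.1 hji)
      refine ⟨R, hR, fun j hj hij => ?_⟩
      rw [abs_sub_comm]
      exact h2 _ (Finset.mem_image.mpr ⟨j, Finset.mem_erase.mpr ⟨hij.symm, hj⟩, rfl⟩)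
    choose! R hR h1 using h1
    by_cases hne : (Finset.Icc 1 (2*N)).Nonempty
    · obtain ⟨i0, hi0, hmin⟩ := Finset.exists_min_image _ R hne
      refine ⟨R i0 / 2, by linarith [hR i0 hi0], fun i hi j hj hij => ?_⟩
      linarith [hmin i hi, h1 i hi j hj hij]
    · refine ⟨1, one_pos, fun i hi => absurd ⟨i, hi⟩ hne⟩
  set D := max 1 (√δ)⁻¹ with hD
  have hD1 : 1 ≤ D := le_max_left _ _
  have hfac : ∀ (x : ℝ) (k : ℕ), δ ≤ |x - y k| → ‖sq ((x:ℂ) - y k)‖⁻¹ ≤ D := by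
    intro x k hk
    refine le_trans ?_ (le_max_right _ _)
    rw [norm_sq, ← ofReal_sub, Complex.norm_real, Real.norm_eq_abs]
    have := Real.sqrt_pos.mpr hδ
    gcongr
  have hbound : ∀ x : ℝ, ‖Q N y x‖⁻¹ ≤ D ^ (2*N) * (1 + ∑ k ∈ Finset.Icc 1 (2*N), ‖sq ((x:ℂ) - y k)‖⁻¹) := by
    intro x
    have hQ : ‖Q N y x‖⁻¹ = ∏ k ∈ Finset.Icc 1 (2*N), ‖sq ((x:ℂ) - y k)‖⁻¹ := by
      rw [Q, norm_prod, Finset.prod_inv_distrib]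
    have hsum : 0 ≤ ∑ k ∈ Finset.Icc 1 (2*N), ‖sq ((x:ℂ) - y k)‖⁻¹ := Finset.sum_nonneg (fun _ _ => by positivity)
    by_cases hex : ∃ k ∈ Finset.Icc 1 (2*N), |x - y k| < δ
    · obtain ⟨k, hk, hkx⟩ := hex
      rw [hQ, ← Finset.prod_erase_mul _ _ hk]
      have h1 : ∏ j ∈ (Finset.Icc 1 (2*N)).erase k, ‖sq ((x:ℂ) - y j)‖⁻¹ ≤ D ^ (2*N) := by
        calc _ ≤ ∏ j ∈ (Finset.Icc 1 (2*N)).erase k, D := by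
              apply Finset.prod_le_prod (fun _ _ => by positivity)
              intro j hj
              rw [Finset.mem_erase] at hj
              apply hfac
              have h3 := hsep j hj.2 k hk hj.1
              have h4 := abs_sub_le (y j) x (y k)
              rw [abs_sub_comm (y j) x] at h4
              linarith
          _ = D ^ ((Finset.Icc 1 (2*N)).erase k).card := by simp
          _ ≤ _ := pow_le_pow_right₀ hD1 ((Finset.card_erase_le).trans (by simp))
      have h2 : ‖sq ((x:ℂ) - y k)‖⁻¹ ≤ 1 + ∑ k ∈ Finset.Icc 1 (2*N), ‖sq ((x:ℂ) - y k)‖⁻¹ := by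
        have := Finset.single_le_sum (f := fun k => ‖sq ((x:ℂ) - y k)‖⁻¹) (fun _ _ => by positivity) hk
        linarith
      exact mul_le_mul h1 h2 (by positivity) (by positivity)
    · push Not at hex
      rw [hQ]
      calc _ ≤ ∏ j ∈ (Finset.Icc 1 (2*N)), D := Finset.prod_le_prod (fun _ _ => by positivity) (fun j hj => hfac x j (hex j hj))
        _ = D ^ (2*N) := by simp
        _ ≤ _ := le_mul_of_one_le_right (by positivity) (by linarith)
  have hInt : IntervalIntegrable (fun x : ℝ => D ^ (2*N) * (1 + ∑ k ∈ Finset.Icc 1 (2*N), ‖sq ((x:ℂ) - y k)‖⁻¹)) volume a b := by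
    apply IntervalIntegrable.const_mul
    refine IntervalIntegrable.add intervalIntegrable_const ?_
    have := IntervalIntegrable.sum (Finset.Icc 1 (2*N)) (f := fun k (x:ℝ) => ‖sq ((x:ℂ) - y k)‖⁻¹) (μ := volume) (a := a) (b := b) (fun k _ => int_sq (y k) a b)
    simpa [Finset.sum_fn] using this
  refine hInt.mono_fun' ?_ ?_
  · have : Continuous (fun x : ℝ => Q N y x) := 
      contOn_Q.comp_continuous continuous_ofReal (fun x => by simp)
    exact (this.norm.measurable.inv).aestronglyMeasurable
  · filter_upwards [] with x
    rw [Real.norm_of_nonneg (by positivity)]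
    exact hbound x

/-- An admissible segment in the closed upper half-plane. -/
structure GP (N : ℕ) (y : ℕ → ℝ) (u v : ℂ) (a b : ℝ) : Prop where
  hab : a ≤ b
  hv : v ≠ 0
  him : ∀ τ ∈ Icc a b, 0 ≤ (u + τ * v).im
  hInt : IntervalIntegrable (fun τ : ℝ => ‖Q N y (u + τ * v)‖⁻¹) volume a b

def Lam (N : ℕ) (y : ℕ → ℝ) (u v : ℂ) (a b : ℝ) (g : ℂ → ℂ) : ℂ := ∫ τ in a..b, v * (g (u + τ * v) / Q N y (u + τ * v))

variable {u v : ℂ} {a b : ℝ}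

lemma GP.meas (G : GP N y u v a b) {g : ℂ → ℂ} (hg : ContinuousOn (fun τ : ℝ => g (u + τ * v)) (Icc a b)) :
    AEStronglyMeasurable (fun τ : ℝ => v * (g (u + τ * v) / Q N y (u + τ * v))) (volume.restrict (Ι a b)) := by
  have hQ : ContinuousOn (fun τ : ℝ => Q N y (u + τ * v)) (Icc a b) := 
    contOn_Q.comp (by fun_prop) (fun τ hτ => G.him τ hτ)
  have h1 : AEMeasurable (fun τ : ℝ => v * (g (u + τ * v) / Q N y (u + τ * v))) (volume.restrict (Icc a b)) :=
    ((hg.aemeasurable measurableSet_Icc).div (hQ.aemeasurable measurableSet_Icc)).const_mul v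
  refine h1.aestronglyMeasurable.mono_measure (Measure.restrict_mono ?_ le_rfl)
  rw [uIoc_of_le G.hab]; exact Ioc_subset_Icc_self

lemma GP.int (G : GP N y u v a b) {g : ℂ → ℂ} (hg : ContinuousOn (fun τ : ℝ => g (u + τ * v)) (Icc a b)) :
    IntervalIntegrable (fun τ : ℝ => v * (g (u + τ * v) / Q N y (u + τ * v))) volume a b := by
  obtain ⟨C, hC⟩ := isCompact_Icc.exists_bound_of_continuousOn hg
  refine (G.hInt.const_mul (‖v‖ * C)).mono_fun' (G.meas hg) ?_
  rw [Filter.EventuallyLE, ae_restrict_iff' measurableSet_uIoc]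
  filter_upwards [] with τ hτ
  rw [uIoc_of_le G.hab] at hτ
  rw [norm_mul, norm_div, mul_assoc, ← div_eq_mul_inv]
  gcongr
  exact hC τ (Ioc_subset_Icc_self hτ)

lemma GP.Lam_add (G : GP N y u v a b) {g g' : ℂ → ℂ} (hg : ContinuousOn (fun τ : ℝ => g (u + τ * v)) (Icc a b))
    (hg' : ContinuousOn (fun τ : ℝ => g' (u + τ * v)) (Icc a b)) :
    Lam N y u v a b (fun z => g z + g' z) = Lam N y u v a b g + Lam N y u v a b g' := by
  unfold Lam
  rw [← intervalIntegral.integral_add (G.int hg) (G.int hg')]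
  congr 1; ext τ; ring

lemma Lam_const_mul (c : ℂ) (g : ℂ → ℂ) : Lam N y u v a b (fun z => c * g z) = c * Lam N y u v a b g := by
  unfold Lam
  rw [← intervalIntegral.integral_const_mul]
  congr 1; ext τ; ring

lemma poly_cont (p : Polynomial ℝ) : Continuous (fun z : ℂ => I * p.aeval z) := by
  have : Continuous (fun z : ℂ => p.aeval z) := Polynomial.continuous_aeval p
  fun_prop

def GP.lin (G : GP N y u v a b) : Polynomial ℝ →ₗ[ℝ] ℂ where
  toFun p := Lam N y u v a b (fun z => I * p.aeval z)
  map_add' p q := by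
    rw [← G.Lam_add]
    · congr 1; ext z; simp; ring
    · exact ((poly_cont p).comp (by fun_prop : Continuous (fun τ : ℝ => u + τ * v))).continuousOn
    · exact ((poly_cont q).comp (by fun_prop : Continuous (fun τ : ℝ => u + τ * v))).continuousOn
  map_smul' c p := by
    rw [RingHom.id_apply, Complex.real_smul, ← Lam_const_mul]
    congr 1; ext z; simp; ring

lemma GP.finite_zero (G : GP N y u v a b) : {τ : ℝ | Q N y (u + τ * v) = 0}.Finite := by
  have hsub : {τ : ℝ | Q N y (u + τ * v) = 0} ⊆ (fun τ : ℝ => u + τ * v) ⁻¹' ((fun k => ((y k : ℝ):ℂ)) '' (Finset.Icc 1 (2*N) : Finset ℕ)) := by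
    intro τ hτ
    by_contra hn
    refine Q_ne_zero (N := N) (y := y) (z := u + τ * v) ?_ hτ
    intro k hk h0
    exact hn ⟨k, by simpa using hk, h0.symm⟩
  refine Set.Finite.subset (Set.Finite.preimage ?_ ((Finset.finite_toSet _).image _)) hsub
  intro τ _ τ' _ h0
  simp only [add_right_inj] at h0
  exact_mod_cast mul_right_cancel₀ G.hv h0

lemma GP.ae_ne (G : GP N y u v a b) : ∀ᵐ τ : ℝ, Q N y (u + τ * v) ≠ 0 := by
  have := G.finite_zero.measure_zero volume
  rw [ae_iff]
  simpa using this

/-- Boundary limit of the increments of `h` along an admissible segment. -/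
lemma GP.lim (G : GP N y u v a b) (hd : DifferentiableOn ℂ h UHP) {g : ℂ → ℂ} {T : Set ℂ} (hT : ∀ z ∈ T, z.im = 0)
    (hg : ContinuousOn g Tᶜ) (hpath : ∀ τ ∈ Icc a b, u + (τ:ℂ) * v ∉ T) 
    (hh : ∀ z ∈ UHP, deriv h z * Q N y z = g z) :
    Tendsto (fun ε : ℝ => h (u + b * v + ε * I) - h (u + a * v + ε * I)) (𝓝[>] 0) (𝓝 (Lam N y u v a b g)) := by
  have hU : ∀ τ ∈ Icc a b, ∀ ε : ℝ, 0 < ε → u + (τ:ℂ) * v + ε * I ∈ UHP := by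
    intro τ hτ ε hε
    have := G.him τ hτ
    show 0 < (u + (τ:ℂ) * v + ε * I).im
    rw [add_im]; simp only [im_ofReal_mul, I_im, mul_one]; linarith
  have hnT : ∀ τ ∈ Icc a b, ∀ ε : ℝ, 0 ≤ ε → u + (τ:ℂ) * v + ε * I ∈ Tᶜ := by
    intro τ hτ ε hε h0
    rcases hε.eq_or_lt with h1 | h1
    · rw [← h1] at h0; simp at h0; exact hpath τ hτ h0
    · have := hU τ hτ ε h1
      exact (show 0 < (u + (τ:ℂ) * v + ε * I).im from this).ne' (hT _ h0)
  obtain ⟨C, hC⟩ : ∃ C, ∀ q ∈ Icc a b ×ˢ Icc (0:ℝ) 1, ‖g (u + (q.1:ℂ) * v + (q.2:ℝ) * I)‖ ≤ C := by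
    apply (isCompact_Icc.prod isCompact_Icc).exists_bound_of_continuousOn
    apply hg.comp (by fun_prop)
    intro q hq
    exact hnT q.1 hq.1 q.2 hq.2.1
  have hftc : ∀ ε : ℝ, 0 < ε → ∫ τ in a..b, v * (g (u + τ * v + ε * I) / Q N y (u + τ * v + ε * I)) 
      = h (u + b * v + ε * I) - h (u + a * v + ε * I) := by
    intro ε hε
    have h1 : ∫ τ in a..b, v * deriv h (u + τ * v + ε * I) = h (u + b * v + ε * I) - h (u + a * v + ε * I) := by
      apply intervalIntegral.integral_eq_sub_of_hasDerivAt (f := fun τ : ℝ => h (u + τ * v + ε * I))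
      · intro τ hτ
        rw [uIcc_of_le G.hab] at hτ
        have h2 := (hd.differentiableAt (isOpen_UHP.mem_nhds (hU τ hτ ε hε))).hasDerivAt
        have h3 : HasDerivAt (fun τ : ℝ => u + (τ:ℂ) * v + ε * I) v τ := by
          simpa using (((Complex.ofRealCLM.hasDerivAt (x := τ)).mul_const v).const_add u).add_const (ε * I)
        have h4 := h2.scomp τ h3
        rw [smul_eq_mul] at h4
        exact h4
      · apply ContinuousOn.intervalIntegrable
        rw [uIcc_of_le G.hab]
        apply ContinuousOn.mul continuousOn_const
        exact (cont_deriv hd).comp (by fun_prop) (fun τ hτ => hU τ hτ ε hε)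
    rw [← h1]
    apply intervalIntegral.integral_congr
    intro τ hτ
    rw [uIcc_of_le G.hab] at hτ
    simp only
    rw [← hh _ (hU τ hτ ε hε), mul_div_cancel_right₀ _ (Q_ne_zero_UHP (hU τ hτ ε hε))]
  have hlim : Tendsto (fun ε : ℝ => ∫ τ in a..b, v * (g (u + τ * v + ε * I) / Q N y (u + τ * v + ε * I))) (𝓝[>] 0)
      (𝓝 (Lam N y u v a b g)) := by
    unfold Lam
    apply intervalIntegral.tendsto_integral_filter_of_dominated_convergence (fun τ : ℝ => ‖v‖ * C * ‖Q N y (u + τ * v)‖⁻¹)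
    · filter_upwards [self_mem_nhdsWithin] with ε hε
      have hQ : ContinuousOn (fun τ : ℝ => Q N y (u + τ * v + ε * I)) (Icc a b) := 
        contOn_Q.comp (by fun_prop) (fun τ hτ => le_of_lt (show 0 < (u + (τ:ℂ) * v + ε * I).im from hU τ hτ ε hε))
      have hgc : ContinuousOn (fun τ : ℝ => g (u + τ * v + ε * I)) (Icc a b) := 
        hg.comp (by fun_prop) (fun τ hτ => hnT τ hτ ε (le_of_lt hε))
      have h1 : AEMeasurable (fun τ : ℝ => v * (g (u + τ * v + ε * I) / Q N y (u + τ * v + ε * I))) (volume.restrict (Icc a b)) :=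
        ((hgc.aemeasurable measurableSet_Icc).div (hQ.aemeasurable measurableSet_Icc)).const_mul v
      refine h1.aestronglyMeasurable.mono_measure (Measure.restrict_mono ?_ le_rfl)
      rw [uIoc_of_le G.hab]; exact Ioc_subset_Icc_self
    · filter_upwards [self_mem_nhdsWithin, nhdsWithin_le_nhds (Iic_mem_nhds one_pos)] with ε hε hε1
      filter_upwards [G.ae_ne] with τ hQ0 hτ
      rw [uIoc_of_le G.hab] at hτ
      have hτ' := Ioc_subset_Icc_self hτ
      have hε0 : 0 < ε := hε
      have h1 := hC (τ, ε) ⟨hτ', hε0.le, hε1⟩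
      have h2 := norm_Q_mono (N := N) (y := y) (G.him τ hτ') hε0.le
      have h3 : 0 < ‖Q N y (u + τ * v)‖ := norm_pos_iff.mpr hQ0
      rw [norm_mul, norm_div, mul_assoc, ← div_eq_mul_inv]
      gcongr
      exact (norm_nonneg _).trans h1
    · exact G.hInt.const_mul _
    · filter_upwards [G.ae_ne] with τ hQ0 hτ
      rw [uIoc_of_le G.hab] at hτ
      have hτ' := Ioc_subset_Icc_self hτ
      have hb : Tendsto (fun ε : ℝ => u + (τ:ℂ) * v + ε * I) (𝓝[>] 0) (𝓝[Tᶜ ∩ {w | 0 ≤ w.im}] (u + τ * v)) := by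
        apply tendsto_nhdsWithin_of_tendsto_nhds_of_eventually_within
        · have : Continuous (fun ε : ℝ => u + (τ:ℂ) * v + ε * I) := by fun_prop
          have h2 := (this.tendsto 0).mono_left (nhdsWithin_le_nhds (s := Ioi 0))
          simpa using h2
        · filter_upwards [self_mem_nhdsWithin] with ε hε
          exact ⟨hnT τ hτ' ε (le_of_lt hε), le_of_lt (show 0 < (u + (τ:ℂ) * v + ε * I).im from hU τ hτ' ε hε)⟩
      have h1 := (hg (u + τ * v) (hpath τ hτ')).mono_left (nhdsWithin_mono _ (inter_subset_left (t := {w : ℂ | 0 ≤ w.im})))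
      have h2 := (cont_Q (N := N) (y := y) (G.him τ hτ')).mono_left (nhdsWithin_mono _ (inter_subset_right (s := Tᶜ)))
      exact ((h1.comp hb).div (h2.comp hb) hQ0).const_mul v
  refine hlim.congr' ?_
  filter_upwards [self_mem_nhdsWithin] with ε hε using hftc ε hε

end
end PK

namespace PK
section
open scoped Interval
open MeasureTheory
variable {N : ℕ} {y : ℕ → ℝ} {t s m1 mN : ℝ} {h : ℂ → ℂ} {u v : ℂ} {a b : ℝ}

lemma GP.real (hy : ∀ i j : ℕ, 1 ≤ i → i < j → j ≤ 2 * N → y i < y j) (hab : a ≤ b) : GP N y 0 1 a b where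
  hab := hab
  hv := one_ne_zero
  him := by intro τ _; simp
  hInt := by simpa using int_Q hy a b

lemma GP.slant {z0 : ℂ} (hz : z0 ∈ UHP) (hm : ∀ k ∈ Finset.Icc 1 (2*N), mN ≠ y k) : GP N y mN (z0 - mN) 0 1 where
  hab := zero_le_one
  hv := UHP_ne hz mN
  him := by
    intro τ hτ
    have : 0 < z0.im := hz
    simp; exact mul_nonneg hτ.1 this.le
  hInt := by
    apply ContinuousOn.intervalIntegrable
    rw [uIcc_of_le zero_le_one]
    have him : ∀ τ ∈ Icc (0:ℝ) 1, 0 ≤ ((mN:ℂ) + τ * (z0 - mN)).im := by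
      intro τ hτ
      have : 0 < z0.im := hz
      simp; exact mul_nonneg hτ.1 this.le
    apply ContinuousOn.inv₀
    · exact (contOn_Q.comp (by fun_prop) (fun τ hτ => him τ hτ)).norm
    · intro τ hτ
      rw [norm_ne_zero_iff]
      apply Q_ne_zero
      intro k hk h0
      rcases hτ.1.eq_or_lt with h1 | h1
      · rw [← h1] at h0; simp at h0; exact hm k hk h0
      · have h2 := congrArg Complex.im h0
        simp at h2
        have : 0 < z0.im := hz
        rcases h2 with h2 | h2 <;> linarith

lemma GP.Lam_tendsto (G : GP N y u v a b) {α : Type*} {l : Filter α} [l.IsCountablyGenerated] {g : α → ℂ → ℂ} {g0 : ℂ → ℂ} {C : ℝ}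
    (hc : ∀ᶠ p in l, ContinuousOn (fun τ : ℝ => g p (u + τ * v)) (Icc a b))
    (hb : ∀ᶠ p in l, ∀ τ ∈ Icc a b, ‖g p (u + τ * v)‖ ≤ C)
    (hl : ∀ τ ∈ Icc a b, Tendsto (fun p => g p (u + τ * v)) l (𝓝 (g0 (u + τ * v)))) :
    Tendsto (fun p => Lam N y u v a b (g p)) l (𝓝 (Lam N y u v a b g0)) := by
  unfold Lam
  apply intervalIntegral.tendsto_integral_filter_of_dominated_convergence (fun τ : ℝ => ‖v‖ * C * ‖Q N y (u + τ * v)‖⁻¹)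
  · filter_upwards [hc] with p hp using G.meas hp
  · filter_upwards [hb] with p hp
    filter_upwards [] with τ hτ
    rw [uIoc_of_le G.hab] at hτ
    rw [norm_mul, norm_div, mul_assoc, ← div_eq_mul_inv]
    gcongr
    exact hp τ (Ioc_subset_Icc_self hτ)
  · exact G.hInt.const_mul _
  · filter_upwards [] with τ hτ
    rw [uIoc_of_le G.hab] at hτ
    exact ((hl τ (Ioc_subset_Icc_self hτ)).div_const _).const_mul v

lemma GP.tslim (G : GP N y u v a b) {x : ℝ} (hx : ∀ k ∈ Finset.Icc 1 (2*N), x ≠ y k) 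
    (hav : ∀ τ ∈ Icc a b, u + (τ:ℂ) * v ≠ x) : 
    ∃ ℓ : ℂ, Tendsto (fun p : ℝ × ℝ => Lam N y u v a b (Mp N y p.1 p.2) / ((p.2 : ℂ) - p.1)) (𝓝[{p | p.1 ≠ p.2}] (x,x)) (𝓝 ℓ) := by
  obtain ⟨d, hd⟩ := Q_strict (N := N) (y := y) hx
  obtain ⟨δ, hδ, hsep⟩ : ∃ δ > 0, ∀ τ ∈ Icc a b, δ ≤ ‖u + (τ:ℂ) * v - x‖ := by
    obtain ⟨τ0, h0, hmin⟩ := isCompact_Icc.exists_isMinOn (nonempty_Icc.mpr G.hab) 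
      (by fun_prop : ContinuousOn (fun τ : ℝ => ‖u + (τ:ℂ) * v - x‖) (Icc a b))
    exact ⟨_, norm_pos_iff.mpr (sub_ne_zero.mpr (hav τ0 h0)), fun τ hτ => hmin hτ⟩
  set l := 𝓝[{p : ℝ × ℝ | p.1 ≠ p.2}] (x,x) with hl
  have t1 : Tendsto (fun p : ℝ × ℝ => p.1) l (𝓝 x) := (continuous_fst.tendsto (x,x)).mono_left nhdsWithin_le_nhds
  have t2 : Tendsto (fun p : ℝ × ℝ => p.2) l (𝓝 x) := (continuous_snd.tendsto (x,x)).mono_left nhdsWithin_le_nhds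
  have e1 := t1.eventually (Metric.ball_mem_nhds x (half_pos hδ))
  have e2 := t2.eventually (Metric.ball_mem_nhds x (half_pos hδ))
  have eD : ∀ᶠ p in l, ‖(Q N y (p.2:ℝ) - Q N y (p.1:ℝ)) / ((p.2:ℂ) - p.1)‖ < ‖d‖ + 1 := 
    hd.norm.eventually (gt_mem_nhds (by linarith))
  have tQ : Tendsto (fun p : ℝ × ℝ => Q N y (p.1:ℝ)) l (𝓝 (Q N y x)) := by
    have : Continuous (fun x : ℝ => Q N y x) := 
      contOn_Q.comp_continuous continuous_ofReal (fun x => by simp)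
    exact (this.tendsto x).comp t1
  have eQ : ∀ᶠ p in l, ‖Q N y (p.1:ℝ)‖ < ‖Q N y x‖ + 1 := 
    tQ.norm.eventually (gt_mem_nhds (by linarith))
  have ene : ∀ᶠ p in l, p.1 ≠ p.2 := self_mem_nhdsWithin
  have hfar : ∀ q : ℝ, q ∈ Metric.ball x (δ/2) → ∀ τ ∈ Icc a b, δ/2 ≤ ‖u + (τ:ℂ) * v - q‖ := by
    intro q hq τ hτ
    have h1 := hsep τ hτ
    have h2 : ‖(q:ℂ) - x‖ < δ/2 := by
      rw [← ofReal_sub, Complex.norm_real]; simpa [Real.dist_eq] using hq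
    have h3 : ‖u + (τ:ℂ) * v - x‖ ≤ ‖u + (τ:ℂ) * v - q‖ + ‖(q:ℂ) - x‖ := by
      calc _ = ‖(u + (τ:ℂ) * v - q) + ((q:ℂ) - x)‖ := by congr 1; ring
        _ ≤ _ := norm_add_le _ _
    linarith
  let g : ℝ × ℝ → ℂ → ℂ := fun p z => (1/Real.pi:ℝ) * ((Q N y (p.2:ℝ) - Q N y (p.1:ℝ)) / ((p.2:ℂ) - p.1) / (z - p.2) + Q N y (p.1:ℝ) / ((z - p.2) * (z - p.1)))
  let g0 : ℂ → ℂ := fun z => (1/Real.pi:ℝ) * (d / (z - x) + Q N y x / ((z - x) * (z - x)))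
  refine ⟨Lam N y u v a b g0, ?_⟩
  have key : Tendsto (fun p => Lam N y u v a b (g p)) l (𝓝 (Lam N y u v a b g0)) := by
    apply G.Lam_tendsto (C := ‖((1/Real.pi:ℝ):ℂ)‖ * ((‖d‖ + 1) / (δ/2) + (‖Q N y x‖ + 1) / (δ/2 * (δ/2))))
    · filter_upwards [e1, e2] with p h1 h2
      have hne : ∀ q : ℝ, q ∈ Metric.ball x (δ/2) → ∀ τ ∈ Icc a b, u + (τ:ℂ) * v - q ≠ 0 := fun q hq τ hτ =>
        norm_pos_iff.mp (lt_of_lt_of_le (half_pos hδ) (hfar q hq τ hτ))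
      apply ContinuousOn.mul continuousOn_const
      apply ContinuousOn.add
      · exact ContinuousOn.div continuousOn_const (by fun_prop) (hne _ h2)
      · exact ContinuousOn.div continuousOn_const (by fun_prop) (fun τ hτ => mul_ne_zero (hne _ h2 τ hτ) (hne _ h1 τ hτ))
    · filter_upwards [e1, e2, eD, eQ] with p h1 h2 h3 h4 τ hτ
      have f1 := hfar _ h1 τ hτ
      have f2 := hfar _ h2 τ hτ
      have hδ2 := half_pos hδ
      rw [norm_mul]
      apply mul_le_mul_of_nonneg_left _ (norm_nonneg _)
      refine (norm_add_le _ _).trans (add_le_add ?_ ?_)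
      · rw [norm_div]
        exact div_le_div₀ (by positivity) h3.le hδ2 f2
      · rw [norm_div, norm_mul]
        exact div_le_div₀ (by positivity) h4.le (by positivity) (mul_le_mul f2 f1 hδ2.le (norm_nonneg _))
    · intro τ hτ
      have hne := sub_ne_zero.mpr (hav τ hτ)
      have c1 : Tendsto (fun p : ℝ × ℝ => u + (τ:ℂ) * v - (p.1:ℂ)) l (𝓝 (u + (τ:ℂ) * v - x)) :=
        ((continuous_ofReal.tendsto x).comp t1).const_sub _
      have c2 : Tendsto (fun p : ℝ × ℝ => u + (τ:ℂ) * v - (p.2:ℂ)) l (𝓝 (u + (τ:ℂ) * v - x)) :=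
        ((continuous_ofReal.tendsto x).comp t2).const_sub _
      exact ((hd.div c2 hne).add (tQ.div (c2.mul c1) (mul_ne_zero hne hne))).const_mul _
  refine key.congr' ?_
  filter_upwards [ene, e1, e2] with p hp h1 h2
  have hp' : (p.2:ℂ) - p.1 ≠ 0 := by
    rw [sub_ne_zero]; exact_mod_cast hp.symm
  rw [eq_div_iff hp', mul_comm, ← Lam_const_mul]
  unfold Lam
  apply intervalIntegral.integral_congr
  intro τ hτ
  rw [uIcc_of_le G.hab] at hτ
  have n1 : u + (τ:ℂ) * v - p.1 ≠ 0 := norm_pos_iff.mp (lt_of_lt_of_le (half_pos hδ) (hfar _ h1 τ hτ))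
  have n2 : u + (τ:ℂ) * v - p.2 ≠ 0 := norm_pos_iff.mp (lt_of_lt_of_le (half_pos hδ) (hfar _ h2 τ hτ))
  simp only [g, Mp]
  congr 2
  generalize u + (τ:ℂ) * v = z at n1 n2 ⊢
  generalize ((1/Real.pi:ℝ):ℂ) = c
  field_simp
  ring

end
end PK

namespace PK
section
open scoped Interval
open MeasureTheory
variable {N : ℕ} {y : ℕ → ℝ} {t s m1 mN : ℝ} {h : ℂ → ℂ} {u v : ℂ} {a b : ℝ}

lemma y_mono (hy : ∀ i j : ℕ, 1 ≤ i → i < j → j ≤ 2 * N → y i < y j) {i j : ℕ} (hi : 1 ≤ i) (hij : i ≤ j) (hj : j ≤ 2*N) : y i ≤ y j := by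
  rcases hij.eq_or_lt with h | h
  · rw [h]
  · exact (hy i j hi h hj).le

lemma comp_exists (hy : ∀ i j : ℕ, 1 ≤ i → i < j → j ≤ 2 * N → y i < y j) (p : ℝ) :
    ∃ k ≤ 2*N, ∀ j, 1 ≤ j → j ≤ 2*N → (p < y j ↔ k < j) := by
  classical
  let P : ℕ → Prop := fun k => k = 0 ∨ (1 ≤ k ∧ y k ≤ p)
  have h0 : P (Nat.findGreatest P (2*N)) := Nat.findGreatest_spec (Nat.zero_le _) (Or.inl rfl)
  refine ⟨Nat.findGreatest P (2*N), Nat.findGreatest_le _, fun j hj hj2 => ⟨fun h => ?_, fun h => ?_⟩⟩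
  · by_contra hn
    push Not at hn
    rcases h0 with h0 | h0
    · omega
    · have := y_mono hy hj hn (Nat.findGreatest_le _)
      linarith [h0.2]
  · have := Nat.findGreatest_is_greatest h hj2
    by_contra hn
    push Not at hn
    exact this (Or.inr ⟨hj, hn⟩)

lemma cnt_eq {p : ℝ} {k : ℕ} (hk : ∀ j, 1 ≤ j → j ≤ 2*N → (p < y j ↔ k < j)) : cnt N y p = 2*N - k := by
  have : (Finset.Icc 1 (2*N)).filter (fun j => p < y j) = Finset.Ioc k (2*N) := by
    ext j
    simp only [Finset.mem_filter, Finset.mem_Icc, Finset.mem_Ioc]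
    constructor
    · rintro ⟨⟨h1, h2⟩, h3⟩; exact ⟨(hk j h1 h2).mp h3, h2⟩
    · rintro ⟨h1, h2⟩; exact ⟨⟨by omega, h2⟩, (hk j (by omega) h2).mpr h1⟩
  rw [cnt, this, Nat.card_Ioc]

lemma iff_of_Ico (hy : ∀ i j : ℕ, 1 ≤ i → i < j → j ≤ 2 * N → y i < y j) {p : ℝ} {k : ℕ} (h1 : 1 ≤ k) (h2 : k + 1 ≤ 2 * N) 
    (hp : p ∈ Ico (y k) (y (k+1))) : ∀ j, 1 ≤ j → j ≤ 2*N → (p < y j ↔ k < j) := by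
  intro j hj hj2
  constructor
  · intro h; by_contra hn
    push Not at hn
    have := y_mono hy hj hn (by omega)
    linarith [hp.1]
  · intro h
    have := y_mono hy (by omega) (show k + 1 ≤ j by omega) hj2
    linarith [hp.2]

lemma cnt_Ico (hy : ∀ i j : ℕ, 1 ≤ i → i < j → j ≤ 2 * N → y i < y j) {p : ℝ} {k : ℕ} (h1 : 1 ≤ k) (h2 : k + 1 ≤ 2 * N) 
    (hp : p ∈ Ico (y k) (y (k+1))) : cnt N y p = 2*N - k := cnt_eq (iff_of_Ico hy h1 h2 hp)

lemma ival_even {R : Polynomial ℝ} {τ : ℝ} {m : ℕ} (hc : cnt N y τ = 2 * m) :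
    I * R.aeval (τ:ℂ) / Q N y τ = (((-1)^m * R.eval τ * ‖Q N y τ‖⁻¹ : ℝ) : ℂ) * I := by
  rw [show R.aeval (τ:ℂ) = ((R.eval τ : ℝ):ℂ) from Polynomial.aeval_ofReal R τ]
  conv_lhs => rw [Q_real, hc, pow_mul, I_sq]
  rcases neg_one_pow_eq_or ℂ m with h | h <;> rcases neg_one_pow_eq_or ℝ m with h' | h' 
  · rw [h, h']; push_cast; ring
  · exfalso
    have : (((-1)^m : ℝ) : ℂ) = (-1)^m := by push_cast; rfl
    rw [h, h'] at this; norm_num at this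
  · exfalso
    have : (((-1)^m : ℝ) : ℂ) = (-1)^m := by push_cast; rfl
    rw [h, h'] at this; norm_num at this
  · rw [h, h']; push_cast; ring

lemma ival_odd {R : Polynomial ℝ} {τ : ℝ} {m : ℕ} (hc : cnt N y τ = 2 * m + 1) :
    I * R.aeval (τ:ℂ) / Q N y τ = (((-1)^m * R.eval τ * ‖Q N y τ‖⁻¹ : ℝ) : ℂ) := by
  rw [show R.aeval (τ:ℂ) = ((R.eval τ : ℝ):ℂ) from Polynomial.aeval_ofReal R τ]
  conv_lhs => rw [Q_real, hc, pow_succ, pow_mul, I_sq]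
  rcases neg_one_pow_eq_or ℂ m with h | h <;> rcases neg_one_pow_eq_or ℝ m with h' | h' 
  · rw [h, h', one_mul, mul_div_mul_left _ _ I_ne_zero]; push_cast; ring
  · exfalso
    have : (((-1)^m : ℝ) : ℂ) = (-1)^m := by push_cast; rfl
    rw [h, h'] at this; norm_num at this
  · exfalso
    have : (((-1)^m : ℝ) : ℂ) = (-1)^m := by push_cast; rfl
    rw [h, h'] at this; norm_num at this
  · rw [h, h', neg_one_mul, neg_mul, div_neg, mul_div_mul_left _ _ I_ne_zero]; push_cast; ring

lemma integral_pos_aux {f : ℝ → ℝ} {a b c d : ℝ} (hf : IntervalIntegrable f volume a b) (hcd : c < d) (hac : a ≤ c) (hdb : d ≤ b)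
    (h0 : ∀ x ∈ Icc a b, 0 ≤ f x) (h1 : ∀ x ∈ Ioo c d, 0 < f x) : 0 < ∫ x in a..b, f x := by
  have hab : a < b := by linarith
  rw [intervalIntegral.integral_pos_iff_support_of_nonneg_ae' _ hf]
  · refine ⟨hab, lt_of_lt_of_le ?_ (measure_mono (s := Ioo c d) ?_)⟩
    · simp [hcd]
    · intro x hx
      exact ⟨(h1 x hx).ne', by linarith [hx.1], by linarith [hx.2]⟩
  · rw [Filter.EventuallyLE, ae_restrict_iff' measurableSet_uIoc]
    filter_upwards [] with x hx
    rw [uIoc_of_le hab.le] at hx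
    exact h0 x (Ioc_subset_Icc_self hx)

lemma GP.real_int (hy : ∀ i j : ℕ, 1 ≤ i → i < j → j ≤ 2 * N → y i < y j) (hab : a ≤ b) (R : Polynomial ℝ) :
    IntervalIntegrable (fun τ : ℝ => I * R.aeval (τ:ℂ) / Q N y τ) volume a b := by
  have := (GP.real hy hab).int (g := fun z => I * R.aeval z) ((poly_cont R).comp (by fun_prop : Continuous (fun τ : ℝ => (0:ℂ) + τ * 1))).continuousOn
  simpa using this

lemma Lam_real (g : ℂ → ℂ) : Lam N y 0 1 a b g = ∫ τ in a..b, g (τ:ℂ) / Q N y τ := by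
  simp [Lam]

def pt (y : ℕ → ℝ) (i : ℕ) : ℝ := (y (2*i) + y (2*i+1)) / 2

def cL (N : ℕ) (y : ℕ → ℝ) (m1 mN : ℝ) (i : ℕ) (g : ℂ → ℂ) : ℝ := 
  if i = 0 then (Lam N y 0 1 m1 mN g).im else (Lam N y 0 1 (pt y i) (pt y (i+1)) g).re

lemma pt_mem (hy : ∀ i j : ℕ, 1 ≤ i → i < j → j ≤ 2 * N → y i < y j) {i : ℕ} (h1 : 1 ≤ i) (h2 : i ≤ N - 1) : pt y i ∈ Ioo (y (2*i)) (y (2*i+1)) := by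
  have := hy (2*i) (2*i+1) (by omega) (by omega) (by omega)
  constructor <;> simp only [pt] <;> linarith

lemma root_exists (hy : ∀ i j : ℕ, 1 ≤ i → i < j → j ≤ 2 * N → y i < y j) {i : ℕ} (h1 : 1 ≤ i) (h2 : i ≤ N - 2) (hN : 2 ≤ N) {R : Polynomial ℝ}
    (h0 : cL N y m1 mN i (fun z => I * R.aeval z) = 0) : ∃ ξ ∈ Ioo (y (2*i+1)) (y (2*i+2)), R.eval ξ = 0 := by
  by_contra hno
  push Not at hno
  have hp1 := pt_mem hy h1 (by omega)
  have hp2 := pt_mem hy (i := i+1) (by omega) (by omega)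
  have hy1 := hy (2*i+1) (2*i+2) (by omega) (by omega) (by omega)
  simp only [show 2*(i+1) = 2*i+2 by ring] at hp2
  have hab : pt y i ≤ pt y (i+1) := by linarith [hp1.2, hp2.1]
  obtain ⟨m, hm⟩ : ∃ m, 2*N - (2*i+1) = 2*m+1 := ⟨N - i - 1, by omega⟩
  have hInt := GP.real_int hy hab R
  have hre : ∫ τ in (pt y i)..(pt y (i+1)), (I * R.aeval (τ:ℂ) / Q N y τ).re = 0 := by
    have h3 := Complex.reCLM.intervalIntegral_comp_comm hInt
    simp only [Complex.reCLM_apply] at h3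
    rw [h3]
    simpa [cL, Lam_real, show i ≠ 0 by omega] using h0
  obtain ⟨σ, hσ⟩ : ∃ σ : ℝ, ∀ x ∈ Ioo (y (2*i+1)) (y (2*i+2)), 0 < σ * ((-1)^m * R.eval x) := by
    set x0 := (y (2*i+1) + y (2*i+2))/2 with hx0
    have hx0m : x0 ∈ Ioo (y (2*i+1)) (y (2*i+2)) := by constructor <;> simp only [hx0] <;> linarith
    refine ⟨(-1)^m * R.eval x0, fun x hx => ?_⟩
    have hpow : ((-1:ℝ)^m) * (-1)^m = 1 := by rw [← mul_pow]; norm_num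
    have : (-1)^m * R.eval x0 * ((-1)^m * R.eval x) = R.eval x0 * R.eval x := by
      linear_combination R.eval x0 * R.eval x * hpow
    rw [this]
    by_contra hneg
    have hneg' : R.eval x0 * R.eval x ≤ 0 := not_lt.mp hneg
    have hcon := (isPreconnected_Ioo (a := y (2*i+1)) (b := y (2*i+2)))
    rcases lt_or_gt_of_ne (hno x0 hx0m) with q | q
    · have q2 : 0 ≤ R.eval x := by by_contra h; push Not at h; nlinarith
      obtain ⟨ξ, hξ, hξ0⟩ := hcon.intermediate_value hx0m hx R.continuous.continuousOn ⟨q.le, q2⟩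
      exact hno ξ hξ hξ0
    · have q2 : R.eval x ≤ 0 := by by_contra h; push Not at h; nlinarith
      obtain ⟨ξ, hξ, hξ0⟩ := hcon.intermediate_value hx hx0m R.continuous.continuousOn ⟨q2, q.le⟩
      exact hno ξ hξ hξ0
  have hodd : ∀ x ∈ Ico (y (2*i+1)) (y (2*i+2)), σ * (I * R.aeval (x:ℂ) / Q N y x).re = σ * ((-1)^m * R.eval x) * ‖Q N y x‖⁻¹ := by
    intro x hx
    rw [ival_odd ((cnt_Ico hy (by omega) (by omega) hx).trans hm), ofReal_re]; ring
  have hpos := integral_pos_aux (f := fun τ : ℝ => σ * (I * R.aeval (τ:ℂ) / Q N y τ).re) (a := pt y i) (b := pt y (i+1)) (c := y (2*i+1)) (d := y (2*i+2)) 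
    ((show IntervalIntegrable (fun τ : ℝ => (I * R.aeval (τ:ℂ) / Q N y τ).re) volume _ _ from 
      ⟨hInt.1.re, hInt.2.re⟩).const_mul σ) hy1 hp1.2.le hp2.1.le ?_ ?_
  · rw [intervalIntegral.integral_const_mul, hre, mul_zero] at hpos
    exact lt_irrefl _ hpos
  · intro x hx
    by_cases c1 : x < y (2*i+1)
    · rw [ival_even (m := N - i) ((cnt_Ico hy (k := 2*i) (by omega) (by omega) ⟨by linarith [hx.1, hp1.1], c1⟩).trans (by omega))]
      rw [re_ofReal_mul, I_re, mul_zero, mul_zero]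
    by_cases c2 : x < y (2*i+2)
    · rw [hodd x ⟨not_lt.mp c1, c2⟩]
      rcases (not_lt.mp c1).eq_or_lt with c3 | c3
      · have : Q N y x = 0 := by
          rw [Q]; apply Finset.prod_eq_zero (i := 2*i+1) (by rw [Finset.mem_Icc]; omega)
          rw [c3, sub_self, ← norm_eq_zero, norm_sq]; simp
        rw [this]; simp
      · exact mul_nonneg (hσ x ⟨c3, c2⟩).le (by positivity)
    · rw [ival_even (m := N - (i+1)) ((cnt_Ico hy (k := 2*i+2) (by omega) (by omega) ⟨not_lt.mp c2, by linarith [hx.2, hp2.2]⟩).trans (by omega))]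
      rw [re_ofReal_mul, I_re, mul_zero, mul_zero]
  · intro x hx
    show 0 < σ * _
    rw [hodd x ⟨hx.1.le, hx.2⟩]
    refine mul_pos (hσ x hx) (inv_pos.mpr (norm_pos_iff.mpr (Q_ne_zero ?_)))
    intro k hk h0
    rw [Finset.mem_Icc] at hk
    have h0' : x = y k := by exact_mod_cast h0
    have := iff_of_Ico hy (k := 2*i+1) (by omega) (by omega) ⟨hx.1.le, hx.2⟩ k hk.1 hk.2
    rw [h0'] at this
    simp at this
    have := y_mono hy hk.1 this (by omega)
    linarith [hx.1]

lemma prod_sign {ξ : ℕ → ℝ} {τ : ℝ} {i n : ℕ} (hi : 1 ≤ i) (h1 : ∀ j ∈ Finset.Icc 1 n, i ≤ j → τ < ξ j) (h2 : ∀ j ∈ Finset.Icc 1 n, j < i → ξ j < τ) :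
    ∃ r > 0, ∏ j ∈ Finset.Icc 1 n, (τ - ξ j) = (-1)^(n+1-i) * r := by
  refine ⟨∏ j ∈ Finset.Icc 1 n, |τ - ξ j|, Finset.prod_pos ?_, ?_⟩
  · intro j hj
    rw [abs_pos, sub_ne_zero]
    rcases lt_or_ge j i with c | c
    · exact (h2 j hj c).ne'
    · exact (h1 j hj c).ne
  · have h3 : ∏ j ∈ Finset.Icc 1 n, (τ - ξ j) = ∏ j ∈ Finset.Icc 1 n, ((-1)^(if i ≤ j then 1 else 0) * |τ - ξ j|) := by
      apply Finset.prod_congr rfl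
      intro j hj
      rcases lt_or_ge j i with c | c
      · rw [if_neg (by omega), abs_of_pos (by linarith [h2 j hj c])]; ring
      · rw [if_pos c, abs_of_neg (by linarith [h1 j hj c])]; ring
    rw [h3, Finset.prod_mul_distrib, Finset.prod_pow_eq_pow_sum, ← Finset.card_filter]
    congr 2
    have : (Finset.Icc 1 n).filter (fun j => i ≤ j) = Finset.Icc i n := by
      ext j; simp only [Finset.mem_filter, Finset.mem_Icc]; omega
    rw [this, Nat.card_Icc]

lemma poly_factor {n : ℕ} {R : Polynomial ℝ} (hR : R.degree < ((n+1 : ℕ) : WithBot ℕ)) {ξ : ℕ → ℝ} (hinj : ∀ i ∈ Finset.Icc 1 n, ∀ j ∈ Finset.Icc 1 n, i ≠ j → ξ i ≠ ξ j)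
    (h0 : ∀ j ∈ Finset.Icc 1 n, R.eval (ξ j) = 0) : ∃ c : ℝ, ∀ x, R.eval x = c * ∏ j ∈ Finset.Icc 1 n, (x - ξ j) := by
  have hdvd : ∏ j ∈ Finset.Icc 1 n, (Polynomial.X - Polynomial.C (ξ j)) ∣ R := by
    apply Finset.prod_dvd_of_coprime
    · intro i hi j hj hij
      exact Polynomial.isCoprime_X_sub_C_of_isUnit_sub (sub_ne_zero.mpr (hinj i (by simpa using hi) j (by simpa using hj) hij)).isUnit
    · intro j hj
      exact Polynomial.dvd_iff_isRoot.mpr (h0 j hj)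
  obtain ⟨S, hS⟩ := hdvd
  have hdegW : (∏ j ∈ Finset.Icc 1 n, (Polynomial.X - Polynomial.C (ξ j))).degree = (n : WithBot ℕ) := by
    rw [Polynomial.degree_prod]; simp
  by_cases hS0 : S = 0
  · exact ⟨0, fun x => by rw [hS, hS0]; simp⟩
  have hSdeg : S.degree ≤ 0 := by
    rw [hS, Polynomial.degree_mul, hdegW, Polynomial.degree_eq_natDegree hS0] at hR
    have : n + S.natDegree < n + 1 := by exact_mod_cast hR
    rw [Polynomial.degree_eq_natDegree hS0]
    have h3 : S.natDegree = 0 := by omega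
    rw [h3]; simp
  refine ⟨S.coeff 0, fun x => ?_⟩
  rw [hS, Polynomial.eval_mul, Polynomial.eq_C_of_degree_le_zero hSdeg, Polynomial.eval_prod]
  simp [mul_comm]

end
end PK

namespace PK
section
open scoped Interval
open MeasureTheory
variable {N : ℕ} {y : ℕ → ℝ} {t s m1 mN : ℝ} {h : ℂ → ℂ} {u v : ℂ} {a b : ℝ}

lemma inj_aux (hy : ∀ i j : ℕ, 1 ≤ i → i < j → j ≤ 2 * N → y i < y j) (hN : 2 ≤ N) (hm1 : m1 ∈ Ioo (y 1) (y 2)) 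
    (hmN : mN ∈ Ioo (y (2*N-1)) (y (2*N))) {R : Polynomial ℝ} (hR : R.degree < ((N-1 : ℕ) : WithBot ℕ))
    (h0 : ∀ i < N - 1, cL N y m1 mN i (fun z => I * R.aeval z) = 0) : R = 0 := by
  have hroot : ∀ i ∈ Finset.Icc 1 (N-2), ∃ ξ ∈ Ioo (y (2*i+1)) (y (2*i+2)), R.eval ξ = 0 := by
    intro i hi
    rw [Finset.mem_Icc] at hi
    exact root_exists hy hi.1 hi.2 hN (h0 i (by omega))
  choose! ξ hξ hξ0 using hroot
  have hlt : ∀ i ∈ Finset.Icc 1 (N-2), ∀ j ∈ Finset.Icc 1 (N-2), i < j → ξ i < ξ j := by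
    intro i hi j hj hij
    have h1 := hξ i hi
    have h2 := hξ j hj
    rw [Finset.mem_Icc] at hi hj
    have := y_mono hy (show 1 ≤ 2*i+2 by omega) (show 2*i+2 ≤ 2*j+1 by omega) (by omega)
    linarith [h1.2, h2.1]
  obtain ⟨c, hc⟩ := poly_factor (n := N-2) (R := R) (by rwa [show N-2+1 = N-1 by omega]) (ξ := ξ) (by
    intro i hi j hj hij
    rcases lt_or_gt_of_ne hij with q | q
    · exact (hlt i hi j hj q).ne
    · exact (hlt j hj i hi q).ne') hξ0
  by_cases hc0 : c = 0
  · apply Polynomial.funext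
    intro x; rw [hc x, hc0]; simp
  exfalso
  have hab : m1 ≤ mN := by
    have := y_mono hy (show 1 ≤ 2 by omega) (show 2 ≤ 2*N-1 by omega) (by omega)
    linarith [hm1.2, hmN.1]
  have hInt := GP.real_int hy hab R
  have him : ∫ τ in m1..mN, (I * R.aeval (τ:ℂ) / Q N y τ).im = 0 := by
    have h3 := Complex.imCLM.intervalIntegral_comp_comm hInt
    simp only [Complex.imCLM_apply] at h3
    rw [h3]
    simpa [cL, Lam_real] using h0 0 (by omega)
  -- value on the gaps
  have hgap : ∀ i, 1 ≤ i → i ≤ N - 1 → ∀ x ∈ Ico (y (2*i)) (y (2*i+1)), ∃ r > 0, -c * (I * R.aeval (x:ℂ) / Q N y x).im = r * ‖Q N y x‖⁻¹ := by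
    intro i h1 h2 x hx
    rw [ival_even (m := N - i) ((cnt_Ico hy (by omega) (by omega) hx).trans (by omega)), im_ofReal_mul, I_im, mul_one, hc x]
    obtain ⟨r, hr, hr2⟩ := prod_sign (ξ := ξ) (τ := x) (i := i) (n := N-2) h1 (by
      intro j hj hij
      have h3 := (hξ j hj).1
      rw [Finset.mem_Icc] at hj
      have := y_mono hy (show 1 ≤ 2*i+1 by omega) (show 2*i+1 ≤ 2*j+1 by omega) (by omega)
      linarith [hx.2]) (by
      intro j hj hij
      have h3 := (hξ j hj).2
      rw [Finset.mem_Icc] at hj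
      have := y_mono hy (show 1 ≤ 2*j+2 by omega) (show 2*j+2 ≤ 2*i by omega) (by omega)
      linarith [hx.1])
    refine ⟨c^2 * r, by positivity, ?_⟩
    rw [hr2, show N - i = (N - 2 + 1 - i) + 1 by omega, pow_succ]
    have hpow : ((-1:ℝ)^(N-2+1-i)) * (-1)^(N-2+1-i) = 1 := by rw [← mul_pow]; norm_num
    linear_combination (c^2 * r * ‖Q N y x‖⁻¹) * hpow
  have h23 := hy 2 3 (by omega) (by omega) (by omega)
  have hpos := integral_pos_aux (f := fun τ : ℝ => -c * (I * R.aeval (τ:ℂ) / Q N y τ).im) (a := m1) (b := mN) (c := y 2) (d := y 3) 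
    ((show IntervalIntegrable (fun τ : ℝ => (I * R.aeval (τ:ℂ) / Q N y τ).im) volume _ _ from 
      ⟨hInt.1.im, hInt.2.im⟩).const_mul (-c)) h23 hm1.2.le ?_ ?_ ?_
  · rw [intervalIntegral.integral_const_mul, him, mul_zero] at hpos
    exact lt_irrefl _ hpos
  · exact (y_mono hy (by omega) (show 3 ≤ 2*N-1 by omega) (by omega)).trans hmN.1.le
  · intro x hx
    obtain ⟨k, hk, hiff⟩ := comp_exists hy x
    have hk1 : 1 ≤ k := by
      have := hiff 1 (by omega) (by omega)
      by_contra hn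
      have := this.mpr (by omega)
      linarith [hx.1, hm1.1]
    have hk2 : k < 2 * N := by
      have := hiff (2*N) (by omega) (by omega)
      exact this.mp (by linarith [hx.2, hmN.2])
    rcases Nat.even_or_odd' k with ⟨i, hi | hi⟩
    · obtain ⟨r, hr, hr2⟩ := hgap i (by omega) (by omega) x ⟨by
        by_contra hn
        have := (hiff (2*i) (by omega) (by omega)).mp (not_le.mp hn)
        omega, (hiff (2*i+1) (by omega) (by omega)).mpr (by omega)⟩
      rw [hr2]; positivity
    · rw [ival_odd (m := N - i - 1) ((cnt_eq hiff).trans (by omega)), ofReal_im, mul_zero]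
  · intro x hx
    obtain ⟨r, hr, hr2⟩ := hgap 1 le_rfl (by omega) x ⟨hx.1.le, hx.2⟩
    show 0 < -c * _
    rw [hr2]
    refine mul_pos hr (inv_pos.mpr (norm_pos_iff.mpr (Q_ne_zero ?_)))
    intro k hk h0
    rw [Finset.mem_Icc] at hk
    have h0' : x = y k := by exact_mod_cast h0
    have := iff_of_Ico hy (k := 2) (by omega) (by omega) ⟨hx.1.le, hx.2⟩ k hk.1 hk.2
    rw [h0'] at this
    simp at this
    have := y_mono hy hk.1 this (by omega)
    linarith [hx.1]

lemma pt_le (hy : ∀ i j : ℕ, 1 ≤ i → i < j → j ≤ 2 * N → y i < y j) {i : ℕ} (h1 : 1 ≤ i) (h2 : i < N - 1) : pt y i ≤ pt y (i+1) := by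
  have hp1 := pt_mem hy h1 (by omega)
  have hp2 := pt_mem hy (i := i+1) (by omega) (by omega)
  have := hy (2*i+1) (2*(i+1)) (by omega) (by omega) (by omega)
  linarith [hp1.2, hp2.1]

lemma m_le (hy : ∀ i j : ℕ, 1 ≤ i → i < j → j ≤ 2 * N → y i < y j) (hN : 2 ≤ N) (hm1 : m1 ∈ Ioo (y 1) (y 2)) 
    (hmN : mN ∈ Ioo (y (2*N-1)) (y (2*N))) : m1 ≤ mN := by
  have := y_mono hy (show 1 ≤ 2 by omega) (show 2 ≤ 2*N-1 by omega) (by omega)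
  linarith [hm1.2, hmN.1]

lemma exists_G (hy : ∀ i j : ℕ, 1 ≤ i → i < j → j ≤ 2 * N → y i < y j) (hN : 2 ≤ N) (hm1 : m1 ∈ Ioo (y 1) (y 2)) 
    (hmN : mN ∈ Ioo (y (2*N-1)) (y (2*N))) : 
    ∃ G : (Fin (N-1) → ℝ) →ₗ[ℝ] Polynomial.degreeLT ℝ (N-1), ∀ p : Polynomial.degreeLT ℝ (N-1), 
      G (fun i => cL N y m1 mN i (fun z => I * (p : Polynomial ℝ).aeval z)) = p := by
  have hab := m_le hy hN hm1 hmN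
  let L : Polynomial.degreeLT ℝ (N-1) →ₗ[ℝ] (Fin (N-1) → ℝ) := 
    { toFun := fun p i => cL N y m1 mN i (fun z => I * (p : Polynomial ℝ).aeval z)
      map_add' := by
        intro p q
        ext i
        by_cases hi : (i:ℕ) = 0
        · have := (GP.real hy hab).lin.map_add p q
          simp only [GP.lin, LinearMap.coe_mk, AddHom.coe_mk] at this
          simp only [cL, hi, if_true, Pi.add_apply, Submodule.coe_add]
          rw [this, add_im]
        · have := (GP.real hy (pt_le hy (i := i) (by omega) i.2)).lin.map_add p q
          simp only [GP.lin, LinearMap.coe_mk, AddHom.coe_mk] at this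
          simp only [cL, hi, if_false, Pi.add_apply, Submodule.coe_add]
          rw [this, add_re]
      map_smul' := by
        intro c p
        ext i
        by_cases hi : (i:ℕ) = 0
        · have := (GP.real hy hab).lin.map_smul c p
          simp only [GP.lin, LinearMap.coe_mk, AddHom.coe_mk] at this
          simp only [cL, hi, if_true, Pi.smul_apply, Submodule.coe_smul, RingHom.id_apply]
          rw [this, real_smul, im_ofReal_mul, smul_eq_mul]
        · have := (GP.real hy (pt_le hy (i := i) (by omega) i.2)).lin.map_smul c p
          simp only [GP.lin, LinearMap.coe_mk, AddHom.coe_mk] at this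
          simp only [cL, hi, if_false, Pi.smul_apply, Submodule.coe_smul, RingHom.id_apply]
          rw [this, real_smul, re_ofReal_mul, smul_eq_mul] }
  have hker : L.ker = ⊥ := by
    rw [LinearMap.ker_eq_bot']
    intro p hp
    ext1
    apply inj_aux hy hN hm1 hmN (Polynomial.mem_degreeLT.mp p.2)
    intro i hi
    exact congrFun hp ⟨i, hi⟩
  obtain ⟨G, hG⟩ := L.exists_leftInverse_of_injective hker
  exact ⟨G, fun p => LinearMap.congr_fun hG p⟩

end
end PK

namespace PK
section
open scoped Interval
open MeasureTheory
variable {N : ℕ} {y : ℕ → ℝ} {t s m1 mN : ℝ} {h : ℂ → ℂ} {u v : ℂ} {a b : ℝ}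

lemma Mp_cont (t s : ℝ) : ContinuousOn (Mp N y t s) ({(t:ℂ), (s:ℂ)} : Set ℂ)ᶜ := by
  unfold Mp
  apply ContinuousOn.mul continuousOn_const
  apply ContinuousOn.sub
  · apply ContinuousOn.div continuousOn_const (by fun_prop)
    intro z hz h0; apply hz; right; exact sub_eq_zero.mp h0
  · apply ContinuousOn.div continuousOn_const (by fun_prop)
    intro z hz h0; apply hz; left; exact sub_eq_zero.mp h0

lemma Mp_path (hp : ∀ τ ∈ Icc a b, u + (τ:ℂ) * v ∉ ({(t:ℂ), (s:ℂ)} : Set ℂ)) : 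
    ContinuousOn (fun τ : ℝ => Mp N y t s (u + τ * v)) (Icc a b) :=
  (Mp_cont t s).comp (by fun_prop) (fun τ hτ => hp τ hτ)

lemma poly_path (p : Polynomial ℝ) : ContinuousOn (fun τ : ℝ => (fun z : ℂ => I * p.aeval z) (u + τ * v)) (Icc a b) :=
  ((poly_cont p).comp (by fun_prop : Continuous (fun τ : ℝ => u + τ * v))).continuousOn

lemma GP.split (G : GP N y u v a b) (p : Polynomial ℝ) (hp : ∀ τ ∈ Icc a b, u + (τ:ℂ) * v ∉ ({(t:ℂ), (s:ℂ)} : Set ℂ)) :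
    Lam N y u v a b (fun z => Mp N y t s z + I * p.aeval z) = Lam N y u v a b (Mp N y t s) + Lam N y u v a b (fun z => I * p.aeval z) := 
  G.Lam_add (Mp_path hp) (poly_path p)

lemma GP.lim' (G : GP N y u v a b) (H : Sol N y t s m1 mN h) (p : Polynomial ℝ) (hp : ∀ τ ∈ Icc a b, u + (τ:ℂ) * v ∉ ({(t:ℂ), (s:ℂ)} : Set ℂ)) 
    (hpe : ∀ z ∈ UHP, deriv h z * Q N y z = Mp N y t s z + I * p.aeval z) :
    Tendsto (fun ε : ℝ => h (u + b * v + ε * I) - h (u + a * v + ε * I)) (𝓝[>] 0) (𝓝 (Lam N y u v a b (Mp N y t s) + Lam N y u v a b (fun z => I * p.aeval z))) := by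
  rw [← G.split p hp]
  refine G.lim H.diff (T := {(t:ℂ), (s:ℂ)}) ?_ ((Mp_cont t s).add (poly_cont p).continuousOn) hp hpe
  rintro z (rfl | rfl) <;> simp

lemma real_avoid {q : ℝ} (hq : q < a ∨ b < q) : ∀ τ ∈ Icc a b, (0:ℂ) + (τ:ℂ) * 1 ≠ q := by
  intro τ hτ h0
  have : τ = q := by
    have : (τ:ℂ) = q := by simpa using h0
    exact_mod_cast this
  rcases hq with h | h
  · linarith [hτ.1]
  · linarith [hτ.2]

lemma slant_avoid {z0 : ℂ} (hz : z0 ∈ UHP) {q : ℝ} (hq : q ≠ mN) : ∀ τ ∈ Icc (0:ℝ) 1, (mN:ℂ) + (τ:ℂ) * (z0 - mN) ≠ q := by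
  intro τ hτ h0
  have h2 := congrArg Complex.im h0
  simp at h2
  have : 0 < z0.im := hz
  rcases h2 with h2 | h2
  · rw [h2] at h0; simp at h0; exact hq h0.symm
  · linarith

lemma notMem_pair {γ : ℂ} (h1 : γ ≠ t) (h2 : γ ≠ s) : γ ∉ ({(t:ℂ), (s:ℂ)} : Set ℂ) := by
  rintro (h | h)
  · exact h1 h
  · exact h2 h

lemma pt_in (hy : ∀ i j : ℕ, 1 ≤ i → i < j → j ≤ 2 * N → y i < y j) (hm1 : m1 ∈ Ioo (y 1) (y 2)) 
    (hmN : mN ∈ Ioo (y (2*N-1)) (y (2*N))) {i : ℕ} (h1 : 1 ≤ i) (h2 : i ≤ N - 1) : m1 ≤ pt y i ∧ pt y i ≤ mN := by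
  have hp := pt_mem hy h1 h2
  have e1 := y_mono hy (show 1 ≤ 2 by omega) (show 2 ≤ 2*i by omega) (by omega)
  have e2 := y_mono hy (show 1 ≤ 2*i+1 by omega) (show 2*i+1 ≤ 2*N-1 by omega) (by omega)
  constructor
  · linarith [hp.1, hm1.2]
  · linarith [hp.2, hmN.1]

/-- The constraints and the value formula. -/
lemma Sol.formula (H : Sol N y t s m1 mN h) (hy : ∀ i j : ℕ, 1 ≤ i → i < j → j ≤ 2 * N → y i < y j) (hN : 2 ≤ N) (hm1 : m1 ∈ Ioo (y 1) (y 2)) 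
    (hmN : mN ∈ Ioo (y (2*N-1)) (y (2*N))) (hmY : ∀ k ∈ Finset.Icc 1 (2*N), mN ≠ y k) (ht : t < m1 ∨ mN < t) (hs : s < m1 ∨ mN < s) {z0 : ℂ} (hz : z0 ∈ UHP) : 
    ∃ p : Polynomial.degreeLT ℝ (N-1), (∀ i < N - 1, cL N y m1 mN i (fun z => I * (p : Polynomial ℝ).aeval z) = - cL N y m1 mN i (Mp N y t s)) ∧
      (h z0).im = (Lam N y mN (z0 - mN) 0 1 (Mp N y t s)).im + ((GP.slant hz hmY).lin p).im := by
  obtain ⟨p, hp, hpe⟩ := H.poly hN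
  have hab := m_le hy hN hm1 hmN
  refine ⟨⟨p, hp⟩, ?_, ?_⟩
  · intro i hi
    simp only
    by_cases hi0 : i = 0
    · simp only [cL, hi0, if_true]
      have h1 := (GP.real hy hab).lim' H p (fun τ hτ => notMem_pair (real_avoid ht τ hτ) (real_avoid hs τ hτ)) hpe
      have h2 := (Complex.continuous_im.tendsto _).comp h1
      have h3 : Tendsto (fun ε : ℝ => (h ((mN:ℂ) + ε * I)).im - (h ((m1:ℂ) + ε * I)).im) (𝓝[>] 0) (𝓝 (0 - 0)) := 
        (H.zeroN.comp (tendsto_vert mN)).sub (H.zero1.comp (tendsto_vert m1))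
      have h4 := tendsto_nhds_unique h2 (h3.congr (fun ε => by simp))
      rw [add_im] at h4
      linarith
    · simp only [cL, hi0, if_false]
      have hpl := pt_le hy (i := i) (by omega) hi
      have i1 := pt_in hy hm1 hmN (i := i) (by omega) (by omega)
      have i2 := pt_in hy hm1 hmN (i := i+1) (by omega) (by omega)
      have h1 := (GP.real hy hpl).lim' H p (fun τ hτ => notMem_pair 
        (real_avoid (ht.imp (fun q => q.trans_le i1.1) (fun q => i2.2.trans_lt q)) τ hτ) 
        (real_avoid (hs.imp (fun q => q.trans_le i1.1) (fun q => i2.2.trans_lt q)) τ hτ)) hpe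
      have h2 := (Complex.continuous_re.tendsto _).comp h1
      obtain ⟨c, hc⟩ := H.gap
      have h3 : Tendsto (fun ε : ℝ => (h ((pt y (i+1):ℂ) + ε * I)).re - (h ((pt y i:ℂ) + ε * I)).re) (𝓝[>] 0) (𝓝 (c - c)) := 
        ((hc (i+1) (by omega) (by omega) _ (pt_mem hy (by omega) (by omega))).comp (tendsto_vert _)).sub 
        ((hc i (by omega) (by omega) _ (pt_mem hy (by omega) (by omega))).comp (tendsto_vert _))
      have h4 := tendsto_nhds_unique h2 (h3.congr (fun ε => by simp))
      rw [add_re] at h4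
      linarith
  · have htm : t ≠ mN := by
      rcases ht with q | q
      · exact (q.trans_le hab).ne
      · exact q.ne'
    have hsm : s ≠ mN := by
      rcases hs with q | q
      · exact (q.trans_le hab).ne
      · exact q.ne'
    have h1 := (GP.slant hz hmY).lim' H p (fun τ hτ => notMem_pair (slant_avoid hz htm τ hτ) (slant_avoid hz hsm τ hτ)) hpe
    have h2 := (Complex.continuous_im.tendsto _).comp h1
    have hc : Tendsto (fun ε : ℝ => h (z0 + ε * I)) (𝓝[>] 0) (𝓝 (h z0)) := by
      have c1 := (H.diff.differentiableAt (isOpen_UHP.mem_nhds hz)).continuousAt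
      have c2 : Tendsto (fun ε : ℝ => z0 + ε * I) (𝓝[>] 0) (𝓝 z0) := by
        have : Continuous (fun ε : ℝ => z0 + ε * I) := by fun_prop
        have h2 := (this.tendsto 0).mono_left (nhdsWithin_le_nhds (s := Ioi 0))
        simpa using h2
      exact c1.tendsto.comp c2
    have h3 : Tendsto (fun ε : ℝ => (h (z0 + ε * I)).im - (h ((mN:ℂ) + ε * I)).im) (𝓝[>] 0) (𝓝 ((h z0).im - 0)) := 
      ((Complex.continuous_im.tendsto _).comp hc).sub (H.zeroN.comp (tendsto_vert mN))
    have h4 := tendsto_nhds_unique h2 (h3.congr (fun ε => by simp))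
    rw [add_im] at h4
    simp only [GP.lin, LinearMap.coe_mk, AddHom.coe_mk]
    linarith

theorem general (hy : ∀ i j : ℕ, 1 ≤ i → i < j → j ≤ 2 * N → y i < y j) (hN : 2 ≤ N) (hm1 : m1 ∈ Ioo (y 1) (y 2)) 
    (hmN : mN ∈ Ioo (y (2*N-1)) (y (2*N))) {x : ℝ} (hx : ∀ k ∈ Finset.Icc 1 (2*N), x ≠ y k) (hxm : x < m1 ∨ mN < x)
    {l : Filter (ℝ × ℝ)} (hl : l ≤ 𝓝[{p | p.1 ≠ p.2}] (x,x)) {H : ℝ → ℝ → ℂ → ℂ} 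
    (hS : ∀ᶠ p in l, Sol N y p.1 p.2 m1 mN (H p.1 p.2)) {z0 : ℂ} (hz : z0 ∈ UHP) : 
    ∃ ℓ : ℝ, Tendsto (fun p : ℝ × ℝ => (H p.1 p.2 z0).im / (p.2 - p.1)) l (𝓝 ℓ) := by
  have hab := m_le hy hN hm1 hmN
  have hmY : ∀ k ∈ Finset.Icc 1 (2*N), mN ≠ y k := by
    intro k hk h0
    rw [Finset.mem_Icc] at hk
    have h1 := hmN
    have := iff_of_Ico hy (k := 2*N-1) (p := mN) (by omega) (by omega) ⟨hmN.1.le, by rw [show 2*N-1+1 = 2*N by omega]; exact hmN.2⟩ k hk.1 hk.2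
    rw [h0] at this
    simp at this
    have := y_mono hy hk.1 this (by omega)
    linarith [hmN.1]
  obtain ⟨G, hG⟩ := exists_G hy hN hm1 hmN
  have hxN : x ≠ mN := by
    rcases hxm with q | q
    · exact (q.trans_le hab).ne
    · exact q.ne'
  obtain ⟨ℓs, hℓs⟩ := (GP.slant hz hmY).tslim hx (slant_avoid hz hxN)
  have hcL : ∀ i : Fin (N-1), ∃ r : ℝ, Tendsto (fun p : ℝ × ℝ => cL N y m1 mN i (Mp N y p.1 p.2) / (p.2 - p.1)) l (𝓝 r) := by
    intro i
    by_cases hi0 : (i:ℕ) = 0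
    · obtain ⟨r, hr⟩ := (GP.real hy hab).tslim hx (real_avoid hxm)
      refine ⟨r.im, (((Complex.continuous_im.tendsto _).comp hr).mono_left hl).congr (fun p => ?_)⟩
      simp only [Function.comp, cL, hi0, if_true]
      rw [← ofReal_sub, div_ofReal_im]
    · have i1 := pt_in hy hm1 hmN (i := i) (by omega) (by omega)
      have i2 := pt_in hy hm1 hmN (i := i+1) (by omega) (by omega)
      obtain ⟨r, hr⟩ := (GP.real hy (pt_le hy (i := i) (by omega) i.2)).tslim hx 
        (real_avoid (hxm.imp (fun q => q.trans_le i1.1) (fun q => i2.2.trans_lt q)))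
      refine ⟨r.re, (((Complex.continuous_re.tendsto _).comp hr).mono_left hl).congr (fun p => ?_)⟩
      simp only [Function.comp, cL, hi0, if_false]
      rw [← ofReal_sub, div_ofReal_re]
  choose r hr using hcL
  let Φ : (Fin (N-1) → ℝ) →ₗ[ℝ] ℝ := Complex.imLm ∘ₗ (GP.slant hz hmY).lin ∘ₗ (Polynomial.degreeLT ℝ (N-1)).subtype ∘ₗ G
  have hΦ : Continuous Φ := Φ.continuous_of_finiteDimensional
  have hr' : Tendsto (fun (p : ℝ × ℝ) (i : Fin (N-1)) => cL N y m1 mN i (Mp N y p.1 p.2) / (p.2 - p.1)) l (𝓝 r) := 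
    tendsto_pi_nhds.mpr hr
  have hlim := (((Complex.continuous_im.tendsto _).comp hℓs).mono_left hl).sub ((hΦ.tendsto r).comp hr')
  refine ⟨_, hlim.congr' ?_⟩
  have t1 : Tendsto (fun p : ℝ × ℝ => p.1) l (𝓝 x) := ((continuous_fst.tendsto (x,x)).mono_left nhdsWithin_le_nhds).mono_left hl
  have t2 : Tendsto (fun p : ℝ × ℝ => p.2) l (𝓝 x) := ((continuous_snd.tendsto (x,x)).mono_left nhdsWithin_le_nhds).mono_left hl
  have hop : ∀ᶠ q in 𝓝 x, q < m1 ∨ mN < q := by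
    rcases hxm with q | q
    · filter_upwards [gt_mem_nhds q] with z hz using Or.inl hz
    · filter_upwards [lt_mem_nhds q] with z hz using Or.inr hz
  filter_upwards [hS, t1.eventually hop, t2.eventually hop] with p hp h1 h2
  obtain ⟨P, hP1, hP2⟩ := hp.formula hy hN hm1 hmN hmY h1 h2 hz
  have hPG : P = - G (fun i => cL N y m1 mN i (Mp N y p.1 p.2)) := by
    rw [← map_neg, ← hG P]
    congr 1
    ext i
    exact hP1 i i.2
  have hsc : Φ (fun i => cL N y m1 mN i (Mp N y p.1 p.2) / (p.2 - p.1)) = - ((GP.slant hz hmY).lin P).im / (p.2 - p.1) := by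
    have e1 : (fun i : Fin (N-1) => cL N y m1 mN i (Mp N y p.1 p.2) / (p.2 - p.1)) = (p.2 - p.1)⁻¹ • (fun i : Fin (N-1) => cL N y m1 mN i (Mp N y p.1 p.2)) := by
      ext i; simp [div_eq_inv_mul]
    rw [e1, map_smul, hPG]
    simp [Φ, div_eq_inv_mul]
  simp only [Function.comp]
  rw [hsc, hP2, ← ofReal_sub, div_ofReal_im]
  ring

end
end PK

namespace PK
section
open scoped Interval
open MeasureTheory
variable {N : ℕ} {y : ℕ → ℝ} {t s m1 mN : ℝ} {h : ℂ → ℂ} {u v : ℂ} {a b : ℝ}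

lemma side_lt {σ p q R : ℝ} (h1 : R ≤ |σ - p|) (h2 : |q - p| < R) (h : p < σ) : q < σ := by
  rw [abs_of_pos (by linarith)] at h1
  linarith [(abs_lt.mp h2).2]

lemma side_gt {σ p q R : ℝ} (h1 : R ≤ |σ - p|) (h2 : |q - p| < R) (h : σ ≤ p) : σ < q := by
  rw [abs_of_nonpos (by linarith)] at h1
  linarith [(abs_lt.mp h2).1]

lemma notY (hy : ∀ i j : ℕ, 1 ≤ i → i < j → j ≤ 2 * N → y i < y j) {w : ℕ} (hw1 : 1 ≤ w) (hwN : w ≤ N) {p : ℝ} 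
    (hp : p ∈ Ioo (y (2*w-1)) (y (2*w))) : ∀ k ∈ Finset.Icc 1 (2*N), p ≠ y k := by
  intro k hk h0
  rw [Finset.mem_Icc] at hk
  have := iff_of_Ico hy (k := 2*w-1) (p := p) (by omega) (by omega) ⟨hp.1.le, by rw [show 2*w-1+1 = 2*w by omega]; exact hp.2⟩ k hk.1 hk.2
  rw [h0] at this
  simp at this
  have := y_mono hy hk.1 this (by omega)
  linarith [hp.1]

lemma cnt_w (hy : ∀ i j : ℕ, 1 ≤ i → i < j → j ≤ 2 * N → y i < y j) {w : ℕ} (hw1 : 1 ≤ w) (hwN : w ≤ N) {p : ℝ} 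
    (hp : p ∈ Ioo (y (2*w-1)) (y (2*w))) : Odd (cnt N y p) := by
  have := cnt_Ico hy (k := 2*w-1) (p := p) (by omega) (by omega) ⟨hp.1.le, by rw [show 2*w-1+1 = 2*w by omega]; exact hp.2⟩
  rw [this]
  exact ⟨N - w, by omega⟩

lemma mkSol (hy : ∀ i j : ℕ, 1 ≤ i → i < j → j ≤ 2 * N → y i < y j) {w : ℕ} (hw1 : 1 ≤ w) (hwN : w ≤ N) 
    (ht : y (2*w-1) < t) (hts : t < s) (hs : s < y (2*w))
    (hdiff : DifferentiableOn ℂ h UHP)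
    (hout : ∀ p : ℝ, (p < y 1 ∨ y (2 * N) < p) → Tendsto (fun z => (h z).re) (𝓝[UHP] (p : ℂ)) (𝓝 0))
    (hgap : ∃ c : ℝ, ∀ i : ℕ, 1 ≤ i → i ≤ N - 1 → ∀ p ∈ Set.Ioo (y (2 * i)) (y (2 * i + 1)),
      Tendsto (fun z => (h z).re) (𝓝[UHP] (p : ℂ)) (𝓝 c))
    (hD : ∀ i : ℕ, 1 ≤ i → i ≤ N → i ≠ w → ∃ c : ℝ, ∀ p ∈ Set.Ioo (y (2 * i - 1)) (y (2 * i)),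
      Tendsto (fun z => (h z).im) (𝓝[UHP] (p : ℂ)) (𝓝 c))
    (h0 : ∀ p ∈ Set.Ioo (y (2 * w - 1)) t ∪ Set.Ioo s (y (2 * w)), Tendsto (fun z => (h z).im) (𝓝[UHP] (p : ℂ)) (𝓝 0))
    (h1 : ∀ p ∈ Set.Ioo t s, Tendsto (fun z => (h z).im) (𝓝[UHP] (p : ℂ)) (𝓝 1))
    (hb : ∃ C : ℝ, ∀ z ∈ UHP, |(h z).im| ≤ C)
    (hz1 : Tendsto (fun z => (h z).im) (𝓝[UHP] (m1:ℂ)) (𝓝 0))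
    (hzN : Tendsto (fun z => (h z).im) (𝓝[UHP] (mN:ℂ)) (𝓝 0)) : Sol N y t s m1 mN h where
  diff := hdiff
  bdd := by
    obtain ⟨C, hC⟩ := hb
    exact ⟨max C 1, by positivity, fun z hz => (hC z hz).trans (le_max_left _ _)⟩
  locD := by
    intro p R hR hsep hodd
    obtain ⟨k, hk, hiff⟩ := comp_exists hy p
    rw [cnt_eq hiff] at hodd
    have hkodd : k % 2 = 1 := by obtain ⟨m, hm⟩ := hodd; omega
    obtain ⟨i, hi⟩ : ∃ i, k = 2 * i - 1 ∧ 1 ≤ i ∧ i ≤ N := ⟨(k+1)/2, by omega⟩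
    obtain ⟨hi, hi1, hi2⟩ := hi
    have hyS : ∀ j, 1 ≤ j → j ≤ 2*N → y j ∈ Sg N y t s := by
      intro j hj hj2
      simp only [Sg, Finset.mem_insert, Finset.mem_image, Finset.mem_Icc]
      exact Or.inr (Or.inr ⟨j, ⟨hj, hj2⟩, rfl⟩)
    have hq1 : ∀ q : ℝ, |q - p| < R → q ∈ Ioo (y (2*i-1)) (y (2*i)) := by
      intro q hq
      constructor
      · apply side_gt (hsep _ (hyS _ (by omega) (by omega))) hq
        by_contra hn
        have := (hiff (2*i-1) (by omega) (by omega)).mp (not_le.mp hn)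
        omega
      · apply side_lt (hsep _ (hyS _ (by omega) (by omega))) hq
        exact (hiff (2*i) (by omega) (by omega)).mpr (by omega)
    by_cases hiw : i = w
    · subst hiw
      have htS := hsep t (by simp [Sg])
      have hsS := hsep s (by simp [Sg])
      rcases lt_or_ge p t with c1 | c1
      · exact ⟨0, fun q hq => h0 q (Or.inl ⟨(hq1 q hq).1, side_lt htS hq c1⟩)⟩
      rcases lt_or_ge p s with c2 | c2
      · exact ⟨1, fun q hq => h1 q ⟨side_gt htS hq c1, side_lt hsS hq c2⟩⟩
      · exact ⟨0, fun q hq => h0 q (Or.inr ⟨side_gt hsS hq c2, (hq1 q hq).2⟩)⟩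
    · obtain ⟨c, hc⟩ := hD i hi1 hi2 hiw
      exact ⟨c, fun q hq => hc q (hq1 q hq)⟩
  locN := by
    intro p R hR hsep heven
    obtain ⟨k, hk, hiff⟩ := comp_exists hy p
    rw [cnt_eq hiff] at heven
    have hkev : k % 2 = 0 := by obtain ⟨m, hm⟩ := heven; omega
    obtain ⟨i, hi⟩ : ∃ i, k = 2 * i := ⟨k/2, by omega⟩
    have hyS : ∀ j, 1 ≤ j → j ≤ 2*N → y j ∈ Sg N y t s := by
      intro j hj hj2
      simp only [Sg, Finset.mem_insert, Finset.mem_image, Finset.mem_Icc]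
      exact Or.inr (Or.inr ⟨j, ⟨hj, hj2⟩, rfl⟩)
    have hL : 1 ≤ i → ∀ q : ℝ, |q - p| < R → y (2*i) < q := by
      intro hi1 q hq
      apply side_gt (hsep _ (hyS _ (by omega) (by omega))) hq
      by_contra hn
      have := (hiff (2*i) (by omega) (by omega)).mp (not_le.mp hn)
      omega
    have hU : i < N → ∀ q : ℝ, |q - p| < R → q < y (2*i+1) := by
      intro hi1 q hq
      apply side_lt (hsep _ (hyS _ (by omega) (by omega))) hq
      exact (hiff (2*i+1) (by omega) (by omega)).mpr (by omega)
    rcases Nat.eq_zero_or_pos i with c1 | c1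
    · refine ⟨0, fun q hq => hout q (Or.inl ?_)⟩
      have := hU (by omega) q hq
      rwa [c1] at this
    rcases lt_or_ge i N with c2 | c2
    · obtain ⟨c, hc⟩ := hgap
      exact ⟨c, fun q hq => hc i c1 (by omega) q ⟨hL c1 q hq, hU c2 q hq⟩⟩
    · refine ⟨0, fun q hq => hout q (Or.inr ?_)⟩
      have := hL c1 q hq
      rwa [show i = N by omega] at this
  ts := hts
  win := by
    refine ⟨min (t - y (2*w-1)) (y (2*w) - s), lt_min (by linarith) (by linarith), ?_, h1⟩
    rintro q (hq | hq)
    · refine h0 q (Or.inl ⟨?_, hq.2⟩)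
      linarith [hq.1, min_le_left (t - y (2*w-1)) (y (2*w) - s)]
    · refine h0 q (Or.inr ⟨hq.1, ?_⟩)
      linarith [hq.2, min_le_right (t - y (2*w-1)) (y (2*w) - s)]
  todd := cnt_w hy hw1 hwN ⟨ht, by linarith⟩
  sodd := cnt_w hy hw1 hwN ⟨by linarith, hs⟩
  tY := notY hy hw1 hwN ⟨ht, by linarith⟩
  sY := notY hy hw1 hwN ⟨by linarith, hs⟩
  zero1 := hz1
  zeroN := hzN
  gap := hgap

end
end PK

/-- Existence of the boundary Poisson kernels as limits of the observables:
(a) with pole `x ∈ (y_{2N-1}, y_{2N})`, (b) with pole `w ∈ (y₁, y₂)`. -/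
theorem poisson_kernel_limits_exist (N : ℕ) (hN : 2 ≤ N) (y : ℕ → ℝ)
    (hy : ∀ i j : ℕ, 1 ≤ i → i < j → j ≤ 2 * N → y i < y j)
    (H : ℝ → ℝ → ℂ → ℂ)
    (hH : ∀ t s : ℝ, y (2 * N - 1) < t → t < s → s < y (2 * N) → SolvesBVP N y t s (H t s))
    (H' : ℝ → ℝ → ℂ → ℂ)
    (hH' : ∀ t s : ℝ, y 1 < t → t < s → s < y 2 → SolvesBVP' N y t s (H' t s)) :
    -- (a)
    (∀ z ∈ UHP, ∀ x ∈ Set.Ioo (y (2 * N - 1)) (y (2 * N)), ∃ l : ℝ,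
      Tendsto (fun p : ℝ × ℝ => (H p.1 p.2 z).im / (p.2 - p.1))
        (𝓝[{p : ℝ × ℝ | y (2 * N - 1) < p.1 ∧ p.1 < p.2 ∧ p.2 < y (2 * N)}] (x, x))
        (𝓝 l)) ∧
    -- (b)
    (∀ z ∈ UHP, ∀ w ∈ Set.Ioo (y 1) (y 2), ∃ l : ℝ,
      Tendsto (fun p : ℝ × ℝ => (H' p.1 p.2 z).im / (p.2 - p.1))
        (𝓝[{p : ℝ × ℝ | y 1 < p.1 ∧ p.1 < p.2 ∧ p.2 < y 2}] (w, w))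
        (𝓝 l)) := by
  constructor
  · intro z hz x hx
    have hm1 : (y 1 + y 2) / 2 ∈ Ioo (y 1) (y 2) := by
      have := hy 1 2 (by omega) (by omega) (by omega)
      constructor <;> linarith
    have hmN : (y (2*N-1) + x) / 2 ∈ Ioo (y (2*N-1)) (y (2*N)) := by
      constructor <;> linarith [hx.1, hx.2]
    refine PK.general (m1 := (y 1 + y 2) / 2) (mN := (y (2*N-1) + x) / 2) hy hN hm1 hmN 
      (PK.notY hy (w := N) (by omega) le_rfl hx) (Or.inr (by linarith [hx.1])) (nhdsWithin_mono _ ?_) ?_ hz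
    · rintro p ⟨_, hp, _⟩
      exact hp.ne
    · have ht : ∀ᶠ p : ℝ × ℝ in 𝓝[{p : ℝ × ℝ | y (2 * N - 1) < p.1 ∧ p.1 < p.2 ∧ p.2 < y (2 * N)}] (x, x), (y (2*N-1) + x) / 2 < p.1 :=
        nhdsWithin_le_nhds ((continuous_fst.tendsto (x,x)).eventually (lt_mem_nhds (by show _ < x; linarith [hx.1])))
      filter_upwards [self_mem_nhdsWithin, ht] with p hp hpt
      obtain ⟨p1, p2, p3⟩ := hp
      obtain ⟨b1, b2, b3, b4, b5, b6, b7, _⟩ := hH p.1 p.2 p1 p2 p3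
      exact PK.mkSol hy (w := N) (by omega) le_rfl p1 p2 p3 b1 b2 b3 (fun i h1 h2 h3 => b4 i h1 (by omega))
        (fun q hq => b5 q (by rcases hq with hq | hq
                              · exact Or.inl (Or.inr hq)
                              · exact Or.inr hq)) b6 b7
        (b5 _ (Or.inl (Or.inl hm1))) (b5 _ (Or.inl (Or.inr ⟨hmN.1, hpt⟩)))
  · intro z hz x hx
    have hm1 : (x + y 2) / 2 ∈ Ioo (y 1) (y 2) := by
      constructor <;> linarith [hx.1, hx.2]
    have hmN : (y (2*N-1) + y (2*N)) / 2 ∈ Ioo (y (2*N-1)) (y (2*N)) := by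
      have := hy (2*N-1) (2*N) (by omega) (by omega) (by omega)
      constructor <;> linarith
    refine PK.general (m1 := (x + y 2) / 2) (mN := (y (2*N-1) + y (2*N)) / 2) hy hN hm1 hmN 
      (PK.notY hy (w := 1) le_rfl (by omega) hx) (Or.inl (by linarith [hx.2])) (nhdsWithin_mono _ ?_) ?_ hz
    · rintro p ⟨_, hp, _⟩
      exact hp.ne
    · have ht : ∀ᶠ p : ℝ × ℝ in 𝓝[{p : ℝ × ℝ | y 1 < p.1 ∧ p.1 < p.2 ∧ p.2 < y 2}] (x, x), p.2 < (x + y 2) / 2 :=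
        nhdsWithin_le_nhds ((continuous_snd.tendsto (x,x)).eventually (gt_mem_nhds (by show x < _; linarith [hx.2])))
      filter_upwards [self_mem_nhdsWithin, ht] with p hp hpt
      obtain ⟨p1, p2, p3⟩ := hp
      obtain ⟨b1, b2, b3, b4, b5, b6, b7, _⟩ := hH' p.1 p.2 p1 p2 p3
      exact PK.mkSol hy (w := 1) le_rfl (by omega) p1 p2 p3 b1 b2 b3 (fun i h1 h2 h3 => b4 i (by omega) h2)
        (fun q hq => b5 q (by rcases hq with hq | hq
                              · exact Or.inl (Or.inr hq)
                              · exact Or.inr hq)) b6 b7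
        (b5 _ (Or.inr ⟨hpt, hm1.2⟩)) (b5 _ (Or.inl (Or.inl hmN)))
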